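/- arXiv:2604.10478 — 2 statements merged into one kernel-verified Lean document; each statement's English description precedes it below -/
import Mathlib

section
/- Let R, S and T be rings and suppose there is a recollement of the unbounded derived categories D(R-Mod), D(S-Mod), D(T-Mod) with functors i^*, i_* = i_!, i^!, j_!, j^* = j^!, j_*. (1) If i_*(R) is isomorphic in D(S-Mod) to a bounded complex of finitely generated (respectively, arbitrary) projective S-modules, then (i) fd(R) ≤ fd(S) + w_R(i^*(S)) (respectively, Fd(R) ≤ Fd(S) + w_R(i^*(S))), and (ii) fd(S) ≤ fd(R) + fd(T) + w_S(i_*(R)) + w_S(j_!(T)) + 1 (respectively, Fd(S) ≤ Fd(R) + Fd(T) + w_S(i_*(R)) + w_S(j_!(T)) + 1). (2) If j_! restricts to a functor D^b(T-Mod) → D^b(S-Mod), then fd(T) ≤ fd(S) + cw(j^!(Hom_ℤ(S, ℚ/ℤ))) (respectively, Fd(T) ≤ Fd(S) + cw(j^!(Hom_ℤ(S, ℚ/ℤ)))). -/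
/-! Core definitions for homological dimensions in triangulated categories and for
finitistic dimensions of rings, following Chen–Chen–Zhang, "Finiteness of homological
dimensions in triangulated categories". -/

open CategoryTheory CategoryTheory.Limits CategoryTheory.Pretriangulated

universe w v u

namespace TriFD

/-- Cast of an integer to `EReal`. -/
noncomputable def ec (n : ℤ) : EReal := ((n : ℝ) : EReal)

/-- Cast of a natural number to `EReal`. -/
noncomputable def en (n : ℕ) : EReal := ((n : ℝ) : EReal)


/-- `M` has projective dimension `≤ n` over `R`. -/
def ModPdLE (R : Type u) [Ring R] : ℕ → ∀ (M : Type u) [AddCommGroup M] [Module R M], Prop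
  | 0 => fun M _ _ => Module.Projective R M
  | n + 1 => fun M _ _ => ∃ (P : Type u) (_ : AddCommGroup P) (_ : Module R P)
      (f : P →ₗ[R] M), Module.Projective R P ∧ Function.Surjective f ∧
        ModPdLE R n (LinearMap.ker f)

/-- `M` has a projective resolution of length `≤ n` by finitely generated projectives. -/
def ModFgPdLE (R : Type u) [Ring R] : ℕ → ∀ (M : Type u) [AddCommGroup M] [Module R M], Prop
  | 0 => fun M _ _ => Module.Projective R M ∧ Module.Finite R M
  | n + 1 => fun M _ _ => ∃ (P : Type u) (_ : AddCommGroup P) (_ : Module R P)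
      (f : P →ₗ[R] M), (Module.Projective R P ∧ Module.Finite R P) ∧ Function.Surjective f ∧
        ModFgPdLE R n (LinearMap.ker f)

/-- The projective dimension of the `R`-module `M`, as an element of `ℝ ∪ {±∞}`. -/
noncomputable def modPd (R : Type u) [Ring R] (M : Type u) [AddCommGroup M] [Module R M] :
    EReal :=
  sInf {x : EReal | ∃ n : ℕ, x = en n ∧ ModPdLE R n M}

/-- The (small) finitistic dimension of the ring `R`. -/
noncomputable def ringfd (R : Type u) [Ring R] : EReal :=
  sSup {x : EReal | ∃ (M : Type u) (_ : AddCommGroup M) (_ : Module R M),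
    (∃ n : ℕ, ModFgPdLE R n M) ∧ x = modPd R M}

/-- The big finitistic dimension of the ring `R`. -/
noncomputable def ringFd (R : Type u) [Ring R] : EReal :=
  sSup {x : EReal | ∃ (M : Type u) (_ : AddCommGroup M) (_ : Module R M),
    (∃ n : ℕ, ModPdLE R n M) ∧ x = modPd R M}

/-- The global dimension of the ring `R`. -/
noncomputable def ringGldim (R : Type u) [Ring R] : EReal :=
  sSup {x : EReal | ∃ (M : Type u) (_ : AddCommGroup M) (_ : Module R M), x = modPd R M}

/-- A bounded complex of finitely generated projective modules concentrated in degrees `[a,b]`. -/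
def IsFgProjComplexIn (R : Type u) [Ring R] (Q : CochainComplex (ModuleCat.{u} R) ℤ)
    (a b : ℤ) : Prop :=
  (∀ i : ℤ, Projective (Q.X i) ∧ Module.Finite R (Q.X i)) ∧
  ∀ i : ℤ, (i < a ∨ b < i) → IsZero (Q.X i)

/-- A bounded complex of projective modules concentrated in degrees `[a,b]`. -/
def IsProjComplexIn (R : Type u) [Ring R] (Q : CochainComplex (ModuleCat.{u} R) ℤ)
    (a b : ℤ) : Prop :=
  (∀ i : ℤ, Projective (Q.X i)) ∧ ∀ i : ℤ, (i < a ∨ b < i) → IsZero (Q.X i)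

/-- A bounded complex of injective modules concentrated in degrees `[β,α]`. -/
def IsInjComplexIn (R : Type u) [Ring R] (Q : CochainComplex (ModuleCat.{u} R) ℤ)
    (β α : ℤ) : Prop :=
  (∀ i : ℤ, Injective (Q.X i)) ∧ ∀ i : ℤ, (i < β ∨ α < i) → IsZero (Q.X i)

variable (R : Type u) [Ring R] [HasDerivedCategory.{w} (ModuleCat.{u} R)]

/-- The homological width of an object of the derived category with respect to bounded
complexes of finitely generated projectives. -/
noncomputable def complexWidthFg (P : DerivedCategory (ModuleCat.{u} R)) : ℕ :=
  sInf {d : ℕ | ∃ (a b : ℤ) (Q : CochainComplex (ModuleCat.{u} R) ℤ),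
    b - a = (d : ℤ) ∧ IsFgProjComplexIn R Q a b ∧
    Nonempty (DerivedCategory.Q.obj Q ≅ P)}

/-- The homological width of an object of the derived category with respect to bounded
complexes of arbitrary projectives. -/
noncomputable def complexWidth (P : DerivedCategory (ModuleCat.{u} R)) : ℕ :=
  sInf {d : ℕ | ∃ (a b : ℤ) (Q : CochainComplex (ModuleCat.{u} R) ℤ),
    b - a = (d : ℤ) ∧ IsProjComplexIn R Q a b ∧
    Nonempty (DerivedCategory.Q.obj Q ≅ P)}

/-- The homological cowidth of an object of the derived category with respect to bounded
complexes of injectives. -/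
noncomputable def complexCowidth (P : DerivedCategory (ModuleCat.{u} R)) : ℕ :=
  sInf {d : ℕ | ∃ (β α : ℤ) (Q : CochainComplex (ModuleCat.{u} R) ℤ),
    α - β = (d : ℤ) ∧ IsInjComplexIn R Q β α ∧
    Nonempty (DerivedCategory.Q.obj Q ≅ P)}

/-- An object of the derived category with bounded cohomology, i.e. an object of
`D^b(R-Mod)`. -/
def IsBoundedComplex (P : DerivedCategory (ModuleCat.{u} R)) : Prop :=
  ∃ a b : ℤ, ∀ i : ℤ, (i < a ∨ b < i) →
    IsZero ((DerivedCategory.homologyFunctor (ModuleCat.{u} R) i).obj P)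

/-- The ring `R`, viewed as a stalk complex in its derived category. -/
noncomputable def ringObj : DerivedCategory (ModuleCat.{u} R) :=
  (DerivedCategory.singleFunctor (ModuleCat.{u} R) 0).obj (ModuleCat.of R R)

/-- The left `R`-module structure on `Hom_ℤ(R, ℚ/ℤ)`, given by `(r • f) x = f (x * r)`. -/
noncomputable instance : Module R (R →+ AddCircle (1 : ℚ)) where
  smul r f := f.comp (AddMonoidHom.mulRight r)
  one_smul f := by ext x; show f (x * 1) = f x; rw [mul_one]
  mul_smul r s f := by ext x; show f (x * (r * s)) = f (x * r * s); rw [mul_assoc]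
  smul_zero r := by ext x; rfl
  smul_add r f g := by ext x; rfl
  add_smul r s f := by ext x; show f (x * (r + s)) = f (x * r) + f (x * s); rw [mul_add, map_add]
  zero_smul f := by ext x; show f (x * 0) = 0; rw [mul_zero, map_zero]

/-- The character module `Hom_ℤ(R, ℚ/ℤ)`, viewed as a stalk complex in the derived
category of left `R`-modules. -/
noncomputable def dualObj : DerivedCategory (ModuleCat.{u} R) :=
  (DerivedCategory.singleFunctor (ModuleCat.{u} R) 0).obj
    (ModuleCat.of R (R →+ AddCircle (1 : ℚ)))

section DistinguishedTriangles

variable {𝒟 : Type*} [Category 𝒟] [HasZeroObject 𝒟] [HasShift 𝒟 ℤ] [Preadditive 𝒟]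
  [∀ n : ℤ, (shiftFunctor 𝒟 n).Additive] [Pretriangulated 𝒟]
  {X Y Z W : 𝒟} {f : X ⟶ Y} {g : Y ⟶ Z} {h : Z ⟶ X⟦(1 : ℤ)⟧}

lemma distTriang_comp₁₂ (H : Triangle.mk f g h ∈ distTriang 𝒟) : f ≫ g = 0 :=
  comp_distTriang_mor_zero₁₂ _ H

lemma distTriang_comp₂₃ (H : Triangle.mk f g h ∈ distTriang 𝒟) : g ≫ h = 0 :=
  comp_distTriang_mor_zero₂₃ _ H

lemma distTriang_comp₃₁ (H : Triangle.mk f g h ∈ distTriang 𝒟) : h ≫ f⟦(1 : ℤ)⟧' = 0 :=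
  comp_distTriang_mor_zero₃₁ _ H

lemma exists_lift₂ (H : Triangle.mk f g h ∈ distTriang 𝒟) (φ : W ⟶ Y) (hφ : φ ≫ g = 0) :
    ∃ ψ : W ⟶ X, φ = ψ ≫ f :=
  Triangle.coyoneda_exact₂ _ H φ hφ

lemma exists_lift₃ (H : Triangle.mk f g h ∈ distTriang 𝒟) (φ : W ⟶ Z) (hφ : φ ≫ h = 0) :
    ∃ ψ : W ⟶ Y, φ = ψ ≫ g :=
  Triangle.coyoneda_exact₃ _ H φ hφ

lemma exists_desc₂ (H : Triangle.mk f g h ∈ distTriang 𝒟) (φ : Y ⟶ W) (hφ : f ≫ φ = 0) :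
    ∃ ψ : Z ⟶ W, φ = g ≫ ψ :=
  Triangle.yoneda_exact₂ _ H φ hφ

lemma exists_desc₃ (H : Triangle.mk f g h ∈ distTriang 𝒟) (φ : Z ⟶ W) (hφ : g ≫ φ = 0) :
    ∃ ψ : X⟦(1 : ℤ)⟧ ⟶ W, φ = h ≫ ψ :=
  Triangle.yoneda_exact₃ _ H φ hφ

lemma exists_rotate (H : Triangle.mk f g h ∈ distTriang 𝒟) :
    Triangle.mk g h (-f⟦(1 : ℤ)⟧') ∈ distTriang 𝒟 :=
  rot_of_distTriang _ H

lemma exists_invRotate (H : Triangle.mk f g h ∈ distTriang 𝒟) :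
    ∃ (k : Z⟦(-1 : ℤ)⟧ ⟶ X) (g' : Y ⟶ Z⟦(-1 : ℤ)⟧⟦(1 : ℤ)⟧), Triangle.mk k f g' ∈ distTriang 𝒟 :=
  ⟨_, _, inv_rot_of_distTriang _ H⟩

lemma distTriang_of_iso₃ (H : Triangle.mk f g h ∈ distTriang 𝒟) (e : Z ≅ W) :
    Triangle.mk f (g ≫ e.hom) (e.inv ≫ h) ∈ distTriang 𝒟 := by
  refine isomorphic_distinguished _ H _ (Triangle.isoMk _ _ (Iso.refl X) (Iso.refl Y) e.symm
    ?_ ?_ ?_)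
  · exact (Category.comp_id f).trans (Category.id_comp f).symm
  · change (g ≫ e.hom) ≫ e.inv = 𝟙 Y ≫ g
    simp
  · change (e.inv ≫ h) ≫ (𝟙 X)⟦(1 : ℤ)⟧' = e.inv ≫ h
    simp

lemma distTriang_of_iso₁ (H : Triangle.mk f g h ∈ distTriang 𝒟) (e : X ≅ W) :
    Triangle.mk (e.inv ≫ f) g (h ≫ e.hom⟦(1 : ℤ)⟧') ∈ distTriang 𝒟 := by
  refine isomorphic_distinguished _ H _ (Triangle.isoMk _ _ e.symm (Iso.refl Y) (Iso.refl Z)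
    ?_ ?_ ?_)
  · exact Category.comp_id (e.inv ≫ f)
  · exact (Category.comp_id g).trans (Category.id_comp g).symm
  · change (h ≫ e.hom⟦(1 : ℤ)⟧') ≫ e.inv⟦(1 : ℤ)⟧' = 𝟙 Z ≫ h
    simp [← Functor.map_comp]

end DistinguishedTriangles

section ShiftedHoms

variable {𝒟 : Type*} [Category 𝒟] [HasShift 𝒟 ℤ] [Preadditive 𝒟]
  [∀ n : ℤ, (shiftFunctor 𝒟 n).Additive] {X Y : 𝒟}

lemma shift_hom_eq_zero (a b : ℤ) (hab : a + b = 0)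
    (H : ∀ f : X ⟶ Y⟦b⟧, f = 0) (f : X⟦a⟧ ⟶ Y) : f = 0 := by
  apply (shiftFunctor 𝒟 b).map_injective
  rw [Functor.map_zero, ← cancel_epi ((shiftFunctorCompIsoId 𝒟 a b hab).inv.app X)]
  rw [comp_zero]
  exact H _

lemma hom_shift_eq_zero (a b : ℤ) (hab : a + b = 0)
    (H : ∀ f : X⟦b⟧ ⟶ Y, f = 0) (f : X ⟶ Y⟦a⟧) : f = 0 := by
  apply (shiftFunctor 𝒟 b).map_injective
  rw [Functor.map_zero, ← cancel_mono ((shiftFunctorCompIsoId 𝒟 a b hab).hom.app Y)]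
  rw [zero_comp]
  exact H _

end ShiftedHoms

section TStructureBasics

variable {C : Type u} [Category.{v} C] [Abelian C] [HasDerivedCategory.{w} C]

open DerivedCategory.TStructure

local notation "𝒟" => DerivedCategory C

lemma hom_eq_zero {X Y : 𝒟} {n m : ℤ} (hX : X.IsLE n) (hY : Y.IsGE m) (h : n < m) (f : X ⟶ Y) :
    f = 0 :=
  t.zero_of_isLE_of_isGE f n m h hX hY

lemma isLE_mono {X : 𝒟} {n m : ℤ} (hX : X.IsLE n) (h : n ≤ m) : X.IsLE m :=
  t.isLE_of_le X n m h

lemma isGE_mono {X : 𝒟} {n m : ℤ} (hX : X.IsGE n) (h : m ≤ n) : X.IsGE m :=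
  t.isGE_of_ge X m n h

lemma isLE_of_hom_zero {X : 𝒟} (n : ℤ)
    (H : ∀ Y : 𝒟, Y.IsGE (n + 1) → ∀ f : X ⟶ Y, f = 0) : X.IsLE n :=
  (t.isLE_iff_orthogonal n (n + 1) rfl X).2 fun Y f hY => H Y hY f

lemma isGE_of_hom_zero {X : 𝒟} (n : ℤ)
    (H : ∀ Y : 𝒟, Y.IsLE (n - 1) → ∀ f : Y ⟶ X, f = 0) : X.IsGE n :=
  (t.isGE_iff_orthogonal (n - 1) n (by lia) X).2 fun Y f hY => H Y hY f

lemma isLE_shift {X : 𝒟} {n : ℤ} (hX : X.IsLE n) (a m : ℤ) (h : a + m = n) :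
    (X⟦a⟧).IsLE m := t.isLE_shift X n a m h

lemma isGE_shift {X : 𝒟} {n : ℤ} (hX : X.IsGE n) (a m : ℤ) (h : a + m = n) :
    (X⟦a⟧).IsGE m := t.isGE_shift X n a m h

lemma isLE_ext {X Y Z : 𝒟} {f : X ⟶ Y} {g : Y ⟶ Z} {h : Z ⟶ X⟦(1 : ℤ)⟧}
    (H : Triangle.mk f g h ∈ distTriang 𝒟) {n : ℤ} (hX : X.IsLE n) (hZ : Z.IsLE n) : Y.IsLE n :=
  t.isLE₂ _ H n hX hZ

lemma isGE_ext {X Y Z : 𝒟} {f : X ⟶ Y} {g : Y ⟶ Z} {h : Z ⟶ X⟦(1 : ℤ)⟧}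
    (H : Triangle.mk f g h ∈ distTriang 𝒟) {n : ℤ} (hX : X.IsGE n) (hZ : Z.IsGE n) : Y.IsGE n :=
  t.isGE₂ _ H n hX hZ

lemma isLE_cone {X Y Z : 𝒟} {f : X ⟶ Y} {g : Y ⟶ Z} {h : Z ⟶ X⟦(1 : ℤ)⟧}
    (H : Triangle.mk f g h ∈ distTriang 𝒟) {n : ℤ} (hX : X.IsLE (n + 1)) (hY : Y.IsLE n) :
    Z.IsLE n :=
  isLE_ext (exists_rotate H) hY (isLE_shift hX 1 n (by lia))

lemma isGE_cone {X Y Z : 𝒟} {f : X ⟶ Y} {g : Y ⟶ Z} {h : Z ⟶ X⟦(1 : ℤ)⟧}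
    (H : Triangle.mk f g h ∈ distTriang 𝒟) {n : ℤ} (hX : X.IsGE (n + 1)) (hY : Y.IsGE n) :
    Z.IsGE n :=
  isGE_ext (exists_rotate H) hY (isGE_shift hX 1 n (by lia))

lemma isLE_of_retract {X Y : 𝒟} {n : ℤ} (hY : Y.IsLE n) (i : X ⟶ Y) (r : Y ⟶ X)
    (h : i ≫ r = 𝟙 X) : X.IsLE n :=
  isLE_of_hom_zero n fun Z hZ f => by
    rw [← Category.id_comp f, ← h, Category.assoc, hom_eq_zero hY hZ (by lia) (r ≫ f), comp_zero]

lemma isGE_of_retract {X Y : 𝒟} {n : ℤ} (hY : Y.IsGE n) (i : X ⟶ Y) (r : Y ⟶ X)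
    (h : i ≫ r = 𝟙 X) : X.IsGE n :=
  isGE_of_hom_zero n fun Z hZ f => by
    rw [← Category.comp_id f, ← h, ← Category.assoc, hom_eq_zero hZ hY (by lia) (f ≫ i), zero_comp]

lemma isLE_of_isZero {X : 𝒟} (hX : IsZero X) (n : ℤ) : X.IsLE n :=
  isLE_of_hom_zero n fun _ _ f => hX.eq_of_src f 0

lemma isGE_of_isZero {X : 𝒟} (hX : IsZero X) (n : ℤ) : X.IsGE n :=
  isGE_of_hom_zero n fun _ _ f => hX.eq_of_tgt f 0

lemma exists_trunc (X : 𝒟) (n : ℤ) : ∃ (A B : 𝒟) (_ : A.IsLE n) (_ : B.IsGE (n + 1))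
    (f : A ⟶ X) (g : X ⟶ B) (h : B ⟶ A⟦(1 : ℤ)⟧), Triangle.mk f g h ∈ distTriang 𝒟 := by
  obtain ⟨A, B, hA, hB, f, g, h, H⟩ := t.exists_triangle X n (n + 1) rfl
  exact ⟨A, B, ⟨hA⟩, ⟨hB⟩, f, g, h, H⟩

/-- `X` has projective dimension at most `n`: there are no nonzero morphisms from `X` to
objects whose cohomology lives in degrees `< -n`. -/
def PdLE (X : DerivedCategory C) (n : ℤ) : Prop :=
  ∀ ⦃Y : DerivedCategory C⦄, Y.IsLE (-n - 1) → ∀ f : X ⟶ Y, f = 0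

lemma PdLE.mono {X : 𝒟} {n m : ℤ} (hX : PdLE X n) (h : n ≤ m) : PdLE X m :=
  fun _ hY f => hX (isLE_mono hY (by lia)) f

lemma PdLE.ext {X Y Z : 𝒟} {f : X ⟶ Y} {g : Y ⟶ Z} {h : Z ⟶ X⟦(1 : ℤ)⟧}
    (H : Triangle.mk f g h ∈ distTriang 𝒟) {n : ℤ} (hX : PdLE X n) (hZ : PdLE Z n) :
    PdLE Y n := fun W hW φ => by
  obtain ⟨ψ, rfl⟩ := exists_desc₂ H φ (hX hW _)
  rw [hZ hW ψ, comp_zero]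

lemma PdLE.shift {X : 𝒟} {n : ℤ} (hX : PdLE X n) (a m : ℤ) (h : n + a = m) : PdLE (X⟦a⟧) m :=
  fun _ hY f => shift_hom_eq_zero a (-a) (by lia)
    (fun f => hX (isLE_shift hY (-a) _ (by lia)) f) f

lemma PdLE.cone {X Y Z : 𝒟} {f : X ⟶ Y} {g : Y ⟶ Z} {h : Z ⟶ X⟦(1 : ℤ)⟧}
    (H : Triangle.mk f g h ∈ distTriang 𝒟) {n : ℤ} (hX : PdLE X (n - 1)) (hY : PdLE Y n) :
    PdLE Z n :=
  PdLE.ext (exists_rotate H) hY (hX.shift 1 n (by lia))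

lemma PdLE.fiber {X Y Z : 𝒟} {f : X ⟶ Y} {g : Y ⟶ Z} {h : Z ⟶ X⟦(1 : ℤ)⟧}
    (H : Triangle.mk f g h ∈ distTriang 𝒟) {n : ℤ} (hY : PdLE Y n) (hZ : PdLE Z (n + 1)) :
    PdLE X n := by
  obtain ⟨k, g', H'⟩ := exists_invRotate H
  exact PdLE.ext H' (hZ.shift (-1) n (by lia)) hY

lemma PdLE.of_retract {X Y : 𝒟} {n : ℤ} (hY : PdLE Y n) (i : X ⟶ Y) (r : Y ⟶ X)
    (h : i ≫ r = 𝟙 X) : PdLE X n := fun Z hZ f => by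
  rw [← Category.id_comp f, ← h, Category.assoc, hY hZ (r ≫ f), comp_zero]

lemma PdLE.of_iso {X Y : 𝒟} {n : ℤ} (hY : PdLE Y n) (e : X ≅ Y) : PdLE X n :=
  hY.of_retract e.hom e.inv e.hom_inv_id

lemma PdLE.of_isZero {X : 𝒟} (hX : IsZero X) (n : ℤ) : PdLE X n :=
  fun _ _ f => hX.eq_of_src f 0

/-- The object `M` of `C`, viewed as a stalk complex in degree `0`. -/
noncomputable abbrev st (M : C) : DerivedCategory C := (DerivedCategory.singleFunctor C 0).obj M

lemma st_isLE (M : C) : (st M).IsLE 0 := inferInstance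

lemma st_isGE (M : C) : (st M).IsGE 0 := inferInstance

lemma stShift_isLE (M : C) (b : ℤ) : ((st M)⟦-b⟧).IsLE b := isLE_shift (st_isLE M) _ _ (by lia)

lemma stShift_isGE (M : C) (b : ℤ) : ((st M)⟦-b⟧).IsGE b := isGE_shift (st_isGE M) _ _ (by lia)

lemma exists_iso_stShift {X : 𝒟} {b : ℤ} (h₁ : X.IsLE b) (h₂ : X.IsGE b) :
    ∃ M : C, Nonempty (X ≅ (st M)⟦-b⟧) := by
  have := isLE_shift h₁ b 0 (by lia)
  have := isGE_shift h₂ b 0 (by lia)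
  obtain ⟨M, ⟨e⟩⟩ := DerivedCategory.exists_iso_singleFunctor_obj_of_isGE_of_isLE (X⟦b⟧) 0
  exact ⟨M, ⟨((shiftFunctorCompIsoId 𝒟 b (-b) (by lia)).app X).symm ≪≫
    (shiftFunctor 𝒟 (-b)).mapIso e⟩⟩

lemma exists_st_triangle (S : ShortComplex C) (hS : S.ShortExact) :
    ∃ h, Triangle.mk ((DerivedCategory.singleFunctor C 0).map S.f)
      ((DerivedCategory.singleFunctor C 0).map S.g) h ∈ distTriang 𝒟 :=
  ⟨_, hS.singleTriangle_distinguished⟩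

lemma exists_stShift_triangle (S : ShortComplex C) (hS : S.ShortExact) (b : ℤ) :
    ∃ h, Triangle.mk ((-b).negOnePow • ((DerivedCategory.singleFunctor C 0).map S.f)⟦-b⟧')
      ((-b).negOnePow • ((DerivedCategory.singleFunctor C 0).map S.g)⟦-b⟧') h ∈ distTriang 𝒟 := by
  obtain ⟨h, H⟩ := exists_st_triangle S hS
  exact ⟨_, Triangle.shift_distinguished _ H (-b)⟩

/-- The projection of an object onto its top cohomology. -/
lemma exists_top {X : 𝒟} {b : ℤ} (h : X.IsLE b) : ∃ (N : C) (A : 𝒟) (_ : A.IsLE (b - 1))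
    (f : A ⟶ X) (g : X ⟶ (st N)⟦-b⟧) (h : (st N)⟦-b⟧ ⟶ A⟦(1 : ℤ)⟧),
    Triangle.mk f g h ∈ distTriang 𝒟 := by
  obtain ⟨A, B, hA, hB, f, g, k, H⟩ := exists_trunc X (b - 1)
  have hB' : B.IsLE b := isLE_cone H (isLE_mono hA (by lia)) h
  obtain ⟨N, ⟨e⟩⟩ := exists_iso_stShift hB' (isGE_mono hB (by lia))
  refine ⟨N, A, hA, f, g ≫ e.hom, e.inv ≫ k, distTriang_of_iso₃ H e⟩

/-- The inclusion of the bottom cohomology into an object. -/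
lemma exists_bot {X : 𝒟} {b : ℤ} (h : X.IsGE b) : ∃ (N : C) (B : 𝒟) (_ : B.IsGE (b + 1))
    (f : (st N)⟦-b⟧ ⟶ X) (g : X ⟶ B) (h : B ⟶ (st N)⟦-b⟧⟦(1 : ℤ)⟧),
    Triangle.mk f g h ∈ distTriang 𝒟 := by
  obtain ⟨A, B, hA, hB, f, g, k, H⟩ := exists_trunc X b
  have hA' : A.IsGE b := by
    obtain ⟨k, g', H'⟩ := exists_invRotate H
    exact isGE_ext H' (isGE_mono (isGE_shift hB (-1) (b + 2) (by lia)) (by lia)) h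
  obtain ⟨N, ⟨e⟩⟩ := exists_iso_stShift hA hA'
  refine ⟨N, B, hB, e.inv ≫ f, g, k ≫ e.hom⟦(1 : ℤ)⟧', distTriang_of_iso₁ H e⟩

/-- Attaching a projective to kill the top cohomology. -/
lemma exists_cover {X : 𝒟} {b : ℤ} {N P : C} {A : 𝒟} (hA : A.IsLE (b - 1))
    {f : A ⟶ X} {g : X ⟶ (st N)⟦-b⟧} {h : (st N)⟦-b⟧ ⟶ A⟦(1 : ℤ)⟧}
    (H : Triangle.mk f g h ∈ distTriang 𝒟) (p : P ⟶ N) [Epi p] (hP : PdLE (st P) 0) :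
    ∃ (Z : 𝒟) (_ : Z.IsLE (b - 1)) (α : (st P)⟦-b⟧ ⟶ X) (β : X ⟶ Z)
      (γ : Z ⟶ (st P)⟦-b⟧⟦(1 : ℤ)⟧), Triangle.mk α β γ ∈ distTriang 𝒟 := by
  obtain ⟨α, hα⟩ := exists_lift₃ H (((DerivedCategory.singleFunctor C 0).map p)⟦-b⟧')
    (hP.shift (-b) (-b) (by lia) (isLE_mono (isLE_shift hA 1 (b - 2) (by lia)) (by lia)) _)
  obtain ⟨Z, β, γ, H'⟩ := distinguished_cocone_triangle α
  refine ⟨Z, isLE_of_hom_zero _ fun Y hY φ => ?_, α, β, γ, H'⟩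
  have hβφ : β ≫ φ = 0 := by
    obtain ⟨ψ, hψ⟩ := exists_desc₂ H (β ≫ φ) (hom_eq_zero hA hY (by lia) _)
    obtain ⟨k, K⟩ := exists_stShift_triangle _
      (ShortComplex.ShortExact.mk' (ShortComplex.exact_kernel p) inferInstance ‹_›) b
    have : ((-b).negOnePow • ((DerivedCategory.singleFunctor C 0).map p)⟦-b⟧') ≫ ψ = 0 := by
      rw [Linear.units_smul_comp, hα, Category.assoc, ← hψ, ← Category.assoc, distTriang_comp₁₂ H',
        zero_comp, smul_zero]
    obtain ⟨χ, rfl⟩ := exists_desc₃ K ψ this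
    rw [hψ, hom_eq_zero (isLE_shift (stShift_isLE _ b) 1 (b - 1) (by lia)) hY (by lia) χ,
      comp_zero, comp_zero]
  obtain ⟨ψ, rfl⟩ := exists_desc₃ H' φ hβφ
  rw [hom_eq_zero (isLE_shift (stShift_isLE _ b) 1 (b - 1) (by lia)) hY (by lia) ψ, comp_zero]

end TStructureBasics

section StrictComplexes

variable {C : Type u} [Category.{v} C] [Abelian C]

/-- A class of objects closed under retracts and finite direct sums. -/
structure IsAddClass (Φ : C → Prop) : Prop where
  zero : ∀ X, IsZero X → Φ X
  retract : ∀ {X Y} (i : X ⟶ Y) (r : Y ⟶ X), i ≫ r = 𝟙 X → Φ Y → Φ X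
  biprod : ∀ {X Y}, Φ X → Φ Y → Φ (X ⊞ Y)

lemma isAddClass_projective : IsAddClass (fun X : C => Projective X) where
  zero X hX := ⟨fun f e _ => ⟨0, hX.eq_of_src _ _⟩⟩
  retract i r h hY := have := hY; Retract.projective ⟨i, r, h⟩
  biprod hX hY := by infer_instance

lemma isAddClass_injective : IsAddClass (fun X : C => Injective X) where
  zero X hX := ⟨fun f e _ => ⟨0, hX.eq_of_tgt _ _⟩⟩
  retract i r h hY := have := hY; Retract.injective ⟨i, r, h⟩
  biprod hX hY := by infer_instance

lemma hom_eq_zero_of_strict {K L : CochainComplex C ℤ} {a : ℤ}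
    (hK : ∀ i < a, IsZero (K.X i)) (hL : ∀ i, a ≤ i → IsZero (L.X i)) (φ : K ⟶ L) : φ = 0 := by
  ext i
  by_cases hi : i < a
  · exact (hK i hi).eq_of_src _ _
  · exact (hL i (by lia)).eq_of_tgt _ _

variable [HasDerivedCategory.{w} C]

local notation "𝒟" => DerivedCategory C

lemma exists_map_of_projective (K L : CochainComplex C ℤ) (b : ℤ) [∀ i, Projective (K.X i)]
    [K.IsStrictlyLE b] (f : DerivedCategory.Q.obj K ⟶ DerivedCategory.Q.obj L) :
    ∃ φ : K ⟶ L, f = DerivedCategory.Q.map φ := by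
  have := CochainComplex.isKProjective_of_projective K b
  obtain ⟨g, hg⟩ := (CochainComplex.IsKProjective.Qh_map_bijective K
    ((HomotopyCategory.quotient C (.up ℤ)).obj L)).2 f
  obtain ⟨φ, rfl⟩ := (HomotopyCategory.quotient C (.up ℤ)).map_surjective g
  exact ⟨φ, hg.symm⟩

lemma exists_map_of_injective (K L : CochainComplex C ℤ) (b : ℤ) [∀ i, Injective (L.X i)]
    [L.IsStrictlyGE b] (f : DerivedCategory.Q.obj K ⟶ DerivedCategory.Q.obj L) :
    ∃ φ : K ⟶ L, f = DerivedCategory.Q.map φ := by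
  have := CochainComplex.isKInjective_of_injective L b
  obtain ⟨g, hg⟩ := (CochainComplex.IsKInjective.Qh_map_bijective
    ((HomotopyCategory.quotient C (.up ℤ)).obj K) L).2 f
  obtain ⟨φ, rfl⟩ := (HomotopyCategory.quotient C (.up ℤ)).map_surjective g
  exact ⟨φ, hg.symm⟩

/-- `X` is isomorphic to a complex concentrated in degrees `[a, b]` with terms in `Φ`. -/
def IsRep (Φ : C → Prop) (a b : ℤ) (X : DerivedCategory C) : Prop :=
  ∃ K : CochainComplex C ℤ, (∀ i, Φ (K.X i)) ∧ (∀ i, (i < a ∨ b < i) → IsZero (K.X i)) ∧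
    Nonempty (DerivedCategory.Q.obj K ≅ X)

lemma IsRep.of_iso {Φ : C → Prop} {a b : ℤ} {X Y : 𝒟} (h : IsRep Φ a b X) (e : X ≅ Y) :
    IsRep Φ a b Y := by
  obtain ⟨K, h₁, h₂, ⟨e'⟩⟩ := h
  exact ⟨K, h₁, h₂, ⟨e' ≪≫ e⟩⟩

lemma IsRep.shift {Φ : C → Prop} {a b : ℤ} {X : 𝒟} (h : IsRep Φ a b X) (n a' b' : ℤ)
    (ha : a' + n = a) (hb : b' + n = b) : IsRep Φ a' b' (X⟦n⟧) := by
  obtain ⟨K, h₁, h₂, ⟨e⟩⟩ := h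
  exact ⟨K⟦n⟧, fun i => h₁ (i + n), fun i hi => h₂ (i + n) (by lia),
    ⟨(DerivedCategory.Q.commShiftIso n).app K ≪≫ (shiftFunctor 𝒟 n).mapIso e⟩⟩

lemma IsRep.of_isZero {Φ : C → Prop} (hΦ : IsAddClass Φ) (a b : ℤ) {X : 𝒟} (hX : IsZero X) :
    IsRep Φ a b X := by
  obtain ⟨K, hK⟩ := HasZeroObject.zero (C := CochainComplex C ℤ)
  exact ⟨K, fun i => hΦ.zero _ ((HomologicalComplex.eval C _ i).map_isZero hK),
    fun i _ => (HomologicalComplex.eval C _ i).map_isZero hK,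
    ⟨(DerivedCategory.Q.map_isZero hK).iso hX⟩⟩

lemma isRep_st {Φ : C → Prop} (hΦ : IsAddClass Φ) {P : C} (hP : Φ P) :
    IsRep Φ 0 0 (st P) := by
  have h0 : ∀ i : ℤ, (i < 0 ∨ 0 < i) →
      IsZero (((HomologicalComplex.single C (.up ℤ) 0).obj P).X i) :=
    fun i hi => HomologicalComplex.isZero_single_obj_X _ _ _ _ (by lia)
  refine ⟨(HomologicalComplex.single C (.up ℤ) 0).obj P, fun i => ?_, h0, ⟨Iso.refl _⟩⟩
  by_cases hi : i = 0
  · subst hi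
    let e := HomologicalComplex.singleObjXSelf (.up ℤ) 0 P
    exact hΦ.retract e.hom e.inv e.hom_inv_id hP
  · exact hΦ.zero _ (h0 i (by lia))

lemma isRep_stShift {Φ : C → Prop} (hΦ : IsAddClass Φ) {P : C} (hP : Φ P) (b : ℤ) :
    IsRep Φ b b ((st P)⟦-b⟧) :=
  (isRep_st hΦ hP).shift (-b) b b (by lia) (by lia)

lemma exists_cone_iso {K L : CochainComplex C ℤ} {X Y Z : 𝒟} {f : X ⟶ Y} {g : Y ⟶ Z}
    {h : Z ⟶ X⟦(1 : ℤ)⟧} (H : Triangle.mk f g h ∈ distTriang 𝒟)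
    (eX : DerivedCategory.Q.obj K ≅ X) (eY : DerivedCategory.Q.obj L ≅ Y) (φ : K ⟶ L)
    (comm : DerivedCategory.Q.map φ ≫ eY.hom = eX.hom ≫ f) :
    Nonempty (DerivedCategory.Q.obj (CochainComplex.mappingCone φ) ≅ Z) := by
  have H' := DerivedCategory.mappingCone_triangle_distinguished φ
  exact ⟨Triangle.π₃.mapIso (isoTriangleOfIso₁₂ _ _ H' H eX eY comm)⟩

lemma IsRep.mono {Φ : C → Prop} {a b a' b' : ℤ} {X : 𝒟} (h : IsRep Φ a b X) (ha : a' ≤ a)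
    (hb : b ≤ b') : IsRep Φ a' b' X := by
  obtain ⟨K, h₁, h₂, ⟨e⟩⟩ := h
  exact ⟨K, h₁, fun i hi => h₂ i (by lia), ⟨e⟩⟩

lemma IsRep.cone {Φ : C → Prop} (hΦ : IsAddClass Φ)
    (h : (∀ P, Φ P → Projective P) ∨ (∀ P, Φ P → Injective P)) {a b : ℤ} {X Y Z : 𝒟}
    {f : X ⟶ Y} {g : Y ⟶ Z} {k : Z ⟶ X⟦(1 : ℤ)⟧} (H : Triangle.mk f g k ∈ distTriang 𝒟)
    (hX : IsRep Φ (a + 1) (b + 1) X) (hY : IsRep Φ a b Y) : IsRep Φ a b Z := by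
  obtain ⟨K, hK₁, hK₂, ⟨eK⟩⟩ := hX
  obtain ⟨L, hL₁, hL₂, ⟨eL⟩⟩ := hY
  have : ∃ φ : K ⟶ L, eK.hom ≫ f ≫ eL.inv = DerivedCategory.Q.map φ := by
    rcases h with h | h
    · have := fun i => h _ (hK₁ i)
      have : K.IsStrictlyLE (b + 1) := by
        rw [CochainComplex.isStrictlyLE_iff]
        exact fun i hi => hK₂ i (Or.inr hi)
      exact exists_map_of_projective K L (b + 1) _
    · have := fun i => h _ (hL₁ i)
      have : L.IsStrictlyGE a := by
        rw [CochainComplex.isStrictlyGE_iff]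
        exact fun i hi => hL₂ i (Or.inl hi)
      exact exists_map_of_injective K L a _
  obtain ⟨φ, hφ⟩ := this
  refine ⟨CochainComplex.mappingCone φ, fun i => ?_, fun i hi => ?_,
    exists_cone_iso H eK eL φ (by rw [← hφ]; simp)⟩
  · let e := HomologicalComplex.homotopyCofiber.XIsoBiprod φ i (i + 1) rfl
    exact hΦ.retract e.hom e.inv e.hom_inv_id (hΦ.biprod (hK₁ _) (hL₁ _))
  · rw [CochainComplex.mappingCone.isZero_X_iff]
    exact ⟨hK₂ _ (by lia), hL₂ _ (by lia)⟩

lemma IsRep.ext {Φ : C → Prop} (hΦ : IsAddClass Φ)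
    (h : (∀ P, Φ P → Projective P) ∨ (∀ P, Φ P → Injective P)) {a b : ℤ} {X Y Z : 𝒟}
    {f : X ⟶ Y} {g : Y ⟶ Z} {k : Z ⟶ X⟦(1 : ℤ)⟧} (H : Triangle.mk f g k ∈ distTriang 𝒟)
    (hX : IsRep Φ a b X) (hZ : IsRep Φ a b Z) : IsRep Φ a b Y := by
  obtain ⟨k, g', H'⟩ := exists_invRotate H
  exact IsRep.cone hΦ h H' (hZ.shift (-1) _ _ (by lia) (by lia)) hX

lemma IsRep.isLE {Φ : C → Prop} {a b : ℤ} {X : 𝒟} (h : IsRep Φ a b X) : X.IsLE b := by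
  obtain ⟨K, -, hK, ⟨e⟩⟩ := h
  have : K.IsStrictlyLE b := by
    rw [CochainComplex.isStrictlyLE_iff]
    exact fun i hi => hK i (Or.inr hi)
  exact DerivedCategory.TStructure.t.isLE_of_iso e b

lemma IsRep.isGE {Φ : C → Prop} {a b : ℤ} {X : 𝒟} (h : IsRep Φ a b X) : X.IsGE a := by
  obtain ⟨K, -, hK, ⟨e⟩⟩ := h
  have : K.IsStrictlyGE a := by
    rw [CochainComplex.isStrictlyGE_iff]
    exact fun i hi => hK i (Or.inl hi)
  exact DerivedCategory.TStructure.t.isGE_of_iso e a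

lemma IsRep.pdLE {Φ : C → Prop} (hΦ : ∀ P, Φ P → Projective P) {a b : ℤ} {X : 𝒟}
    (h : IsRep Φ a b X) : PdLE X (-a) := by
  intro Y hY f
  obtain ⟨K, hK, hK', ⟨e⟩⟩ := h
  have := fun i => hΦ _ (hK i)
  have : K.IsStrictlyLE b := by
    rw [CochainComplex.isStrictlyLE_iff]
    exact fun i hi => hK' i (Or.inr hi)
  obtain ⟨L, hL, ⟨e'⟩⟩ := DerivedCategory.exists_iso_Q_obj_of_isLE Y (- -a - 1)
  obtain ⟨φ, hφ⟩ := exists_map_of_projective K L b (e.hom ≫ f ≫ e'.hom)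
  have : φ = 0 := hom_eq_zero_of_strict (a := a) (fun i hi => hK' i (Or.inl hi))
    (fun i hi => L.isZero_of_isStrictlyLE (- -a - 1) i (by lia)) φ
  rw [this, Functor.map_zero] at hφ
  rw [← cancel_epi e.hom, ← cancel_mono e'.hom, Category.assoc, hφ]
  simp

/-- Dual to `PdLE` for complexes of injectives. -/
lemma IsRep.hom_eq_zero {Φ : C → Prop} (hΦ : ∀ P, Φ P → Injective P) {a b : ℤ} {X Y : 𝒟}
    (h : IsRep Φ a b X) (hY : Y.IsGE (b + 1)) (f : Y ⟶ X) : f = 0 := by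
  obtain ⟨K, hK, hK', ⟨e⟩⟩ := h
  have := fun i => hΦ _ (hK i)
  have : K.IsStrictlyGE a := by
    rw [CochainComplex.isStrictlyGE_iff]
    exact fun i hi => hK' i (Or.inl hi)
  obtain ⟨L, hL, ⟨e'⟩⟩ := DerivedCategory.exists_iso_Q_obj_of_isGE Y (b + 1)
  obtain ⟨φ, hφ⟩ := exists_map_of_injective L K a (e'.inv ≫ f ≫ e.inv)
  have : φ = 0 := hom_eq_zero_of_strict (a := b + 1)
    (fun i hi => L.isZero_of_isStrictlyGE (b + 1) i (by lia))
    (fun i hi => hK' i (by lia)) φ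
  rw [this, Functor.map_zero] at hφ
  rw [← cancel_epi e'.inv, ← cancel_mono e.inv, Category.assoc, hφ]
  simp

lemma pdLE_st_of_projective (P : C) [h : Projective P] : PdLE (st P) 0 :=
  (isRep_st isAddClass_projective h).pdLE fun _ h => h

/-- Every object of `Ψ` which is bounded above by `b` admits a morphism from `P[-b]`, with `P` in
`Φ`, whose cone is in `Ψ` and bounded above by `b - 1`. -/
def HasCovers (Ψ : DerivedCategory C → Prop) (Φ : C → Prop) : Prop :=
  ∀ (X : DerivedCategory C) (b : ℤ), Ψ X → X.IsLE b → ∃ (P : C) (Z : DerivedCategory C)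
    (α : (st P)⟦-b⟧ ⟶ X) (β : X ⟶ Z) (γ : Z ⟶ (st P)⟦-b⟧⟦(1 : ℤ)⟧),
    Φ P ∧ Ψ Z ∧ Z.IsLE (b - 1) ∧ Triangle.mk α β γ ∈ distTriang _

lemma isZero_of_isLE_of_pdLE {X : 𝒟} {b n : ℤ} (hb : X.IsLE b) (hn : PdLE X n) (h : b < -n) :
    IsZero X := by
  rw [IsZero.iff_id_eq_zero]
  exact hn (isLE_mono hb (by lia)) _

lemma HasCovers.isRep {Ψ : DerivedCategory C → Prop} {Φ : C → Prop} (h : HasCovers Ψ Φ)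
    (hΦ : IsAddClass Φ) (hΦ' : ∀ P, Φ P → Projective P) {X : DerivedCategory C} {a b : ℤ}
    (hX : Ψ X) (hb : X.IsLE b) (ha : PdLE X (-a)) (hab : a ≤ b) : IsRep Φ a b X := by
  obtain ⟨n, rfl⟩ : ∃ n : ℕ, b = a + n := ⟨(b - a).toNat, by lia⟩
  clear hab
  induction n generalizing X with
  | zero =>
    obtain ⟨P, Z, α, β, γ, hP, -, hZ, H⟩ := h X _ hX hb
    obtain ⟨ρ, hρ⟩ := exists_lift₂ H (𝟙 X) (ha (isLE_mono hZ (by lia)) _)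
    obtain ⟨N, ⟨e⟩⟩ := exists_iso_stShift hb (isGE_of_retract (stShift_isGE P _) ρ α hρ.symm)
    let F := DerivedCategory.singleFunctor C 0 ⋙ shiftFunctor 𝒟 (-(a + ((0 : ℕ) : ℤ)))
    obtain ⟨i, hi⟩ := F.map_surjective (e.inv ≫ ρ)
    obtain ⟨r, hr⟩ := F.map_surjective (α ≫ e.hom)
    have : i ≫ r = 𝟙 N := F.map_injective (by
      rw [F.map_comp, hi, hr, F.map_id, Category.assoc, reassoc_of% hρ.symm]
      exact e.inv_hom_id)
    exact ((isRep_stShift hΦ (hΦ.retract i r this hP) _).of_iso e.symm).mono (by lia) le_rfl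
  | succ n ih =>
    obtain ⟨P, Z, α, β, γ, hP, hZ', hZ, H⟩ := h X _ hX hb
    have := ih hZ' (PdLE.cone H (((isRep_stShift hΦ hP _).pdLE hΦ').mono (by lia)) ha)
      (isLE_mono hZ (by lia))
    exact IsRep.ext hΦ (Or.inl hΦ') H ((isRep_stShift hΦ hP _).mono (by lia) le_rfl)
      (this.mono le_rfl (by lia))

lemma hasCovers_true [EnoughProjectives C] :
    HasCovers (fun _ : DerivedCategory C => True) (fun P => Projective P) := by
  intro X b _ hb
  obtain ⟨N, A, hA, f, g, h, H⟩ := exists_top hb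
  obtain ⟨Z, hZ, α, β, γ, H'⟩ := exists_cover hA H (Projective.π N) (pdLE_st_of_projective _)
  exact ⟨_, Z, α, β, γ, inferInstance, trivial, hZ, H'⟩

lemma isGE_of_pdLE [EnoughProjectives C] {X : 𝒟} {b n : ℤ} (hb : X.IsLE b) (hn : PdLE X n) :
    X.IsGE (-n) := by
  by_cases h : b < -n
  · exact isGE_of_isZero (isZero_of_isLE_of_pdLE hb hn h) _
  · exact (hasCovers_true.isRep isAddClass_projective (fun _ h => h) trivial hb
      (by simpa using hn) (by lia)).isGE

end StrictComplexes

section FiniteHoms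

variable {𝒞 : Type*} [Category 𝒞] [Preadditive 𝒞] {ι : Type*} {Y : ι → 𝒞} {A : 𝒞}

/-- The morphisms `X ⟶ A` which are finite sums of morphisms factoring through one of the `c i`. -/
def finHom (c : ∀ i, Y i ⟶ A) (X : 𝒞) : AddSubgroup (X ⟶ A) :=
  AddSubgroup.closure {f | ∃ (i : ι) (g : X ⟶ Y i), f = g ≫ c i}

lemma comp_mem_finHom (c : ∀ i, Y i ⟶ A) {X : 𝒞} {i : ι} (g : X ⟶ Y i) :
    g ≫ c i ∈ finHom c X :=
  AddSubgroup.subset_closure ⟨i, g, rfl⟩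

lemma finHom_le {c : ∀ i, Y i ⟶ A} {X : 𝒞} {U : AddSubgroup (X ⟶ A)}
    (h : ∀ i (g : X ⟶ Y i), g ≫ c i ∈ U) : finHom c X ≤ U := by
  rw [finHom, AddSubgroup.closure_le]
  rintro _ ⟨i, g, rfl⟩
  exact h i g

lemma precomp_mem_finHom {c : ∀ i, Y i ⟶ A} {X X' : 𝒞} (a : X' ⟶ X) {f : X ⟶ A}
    (hf : f ∈ finHom c X) : a ≫ f ∈ finHom c X' := by
  have : finHom c X ≤ (finHom c X').comap (Preadditive.leftComp A a) :=
    finHom_le fun i g => by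
      change a ≫ g ≫ c i ∈ finHom c X'
      rw [← Category.assoc]
      exact comp_mem_finHom c _
  exact this hf

lemma exists_proj {c : Cofan Y} (hc : IsColimit c) : ∃ π : ∀ i, c.pt ⟶ Y i,
    (∀ i, c.inj i ≫ π i = 𝟙 _) ∧ ∀ i j, i ≠ j → c.inj i ≫ π j = 0 := by
  classical
  refine ⟨fun j => Cofan.IsColimit.desc hc fun i =>
    if h : i = j then eqToHom (congrArg Y h) else 0, fun i => ?_, fun i j hij => ?_⟩
  · rw [Cofan.IsColimit.fac]
    simp
  · rw [Cofan.IsColimit.fac]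
    simp [hij]

lemma inj_comp_sum {c : ∀ i, Y i ⟶ A} {π : ∀ i, A ⟶ Y i} (h₁ : ∀ i, c i ≫ π i = 𝟙 _)
    (h₂ : ∀ i j, i ≠ j → c i ≫ π j = 0) {i : ι} {J : Finset ι} (hi : i ∈ J) :
    c i ≫ (∑ j ∈ J, π j ≫ c j) = c i := by
  rw [Preadditive.comp_sum, Finset.sum_eq_single_of_mem i hi]
  · rw [reassoc_of% h₁ i]
  · intro j _ hj
    rw [← Category.assoc, h₂ i j hj.symm, zero_comp]

lemma exists_finset_of_mem_finHom {c : ∀ i, Y i ⟶ A} {π : ∀ i, A ⟶ Y i}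
    (h₁ : ∀ i, c i ≫ π i = 𝟙 _) (h₂ : ∀ i j, i ≠ j → c i ≫ π j = 0) {X : 𝒞} {f : X ⟶ A}
    (hf : f ∈ finHom c X) :
    ∃ J : Finset ι, ∀ J', J ⊆ J' → f ≫ (∑ j ∈ J', π j ≫ c j) = f := by
  classical
  induction hf using AddSubgroup.closure_induction with
  | mem f hf =>
    obtain ⟨i, g, rfl⟩ := hf
    refine ⟨{i}, fun J hJ => ?_⟩
    rw [Category.assoc, inj_comp_sum h₁ h₂ (hJ (Finset.mem_singleton_self i))]
  | zero => exact ⟨∅, fun J _ => zero_comp⟩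
  | add f g _ _ hf hg =>
    obtain ⟨J, hJ⟩ := hf
    obtain ⟨J', hJ'⟩ := hg
    exact ⟨J ∪ J', fun K hK => by
      rw [Preadditive.add_comp, hJ _ (Finset.union_subset_left hK),
        hJ' _ (Finset.union_subset_right hK)]⟩
  | neg f _ hf =>
    obtain ⟨J, hJ⟩ := hf
    exact ⟨J, fun K hK => by rw [Preadditive.neg_comp, hJ _ hK]⟩

lemma comp_sum_mem_finHom (c : ∀ i, Y i ⟶ A) (π : ∀ i, A ⟶ Y i) {X : 𝒞} (f : X ⟶ A)
    (J : Finset ι) : f ≫ (∑ j ∈ J, π j ≫ c j) ∈ finHom c X := by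
  rw [Preadditive.comp_sum]
  refine AddSubgroup.sum_mem _ fun j _ => ?_
  rw [← Category.assoc]
  exact comp_mem_finHom c _

end FiniteHoms

section CompactObjects

variable {A : Type u} [Ring A] [HasDerivedCategory.{w} (ModuleCat.{u} A)]
  {B : Type u} [Ring B] [HasDerivedCategory.{w} (ModuleCat.{u} B)]

local notation "𝒟" => DerivedCategory (ModuleCat A)

/-- Compact objects of the derived category. -/
def IsCpt (X : DerivedCategory (ModuleCat.{u} A)) : Prop :=
  ∀ ⦃ι : Type u⦄ (Y : ι → DerivedCategory (ModuleCat.{u} A)) (c : Cofan Y), IsColimit c →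
    ∀ f : X ⟶ c.pt, f ∈ finHom c.inj X

lemma IsCpt.of_retract {X Y : 𝒟} (hY : IsCpt Y) (i : X ⟶ Y) (r : Y ⟶ X) (h : i ≫ r = 𝟙 X) :
    IsCpt X := fun _ _ c hc f => by
  rw [← Category.id_comp f, ← h, Category.assoc]
  exact precomp_mem_finHom i (hY _ c hc _)

lemma IsCpt.ext {X Y Z : 𝒟} {f : X ⟶ Y} {g : Y ⟶ Z} {h : Z ⟶ X⟦(1 : ℤ)⟧}
    (H : Triangle.mk f g h ∈ distTriang 𝒟) (hX : IsCpt X) (hZ : IsCpt Z) : IsCpt Y := by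
  intro ι W c hc φ
  obtain ⟨π, h₁, h₂⟩ := exists_proj hc
  obtain ⟨J, hJ⟩ := exists_finset_of_mem_finHom h₁ h₂ (hX _ c hc (f ≫ φ))
  obtain ⟨ψ, hψ⟩ := exists_desc₂ H (φ - φ ≫ ∑ j ∈ J, π j ≫ c.inj j)
    (by rw [Preadditive.comp_sub, ← Category.assoc, hJ J subset_rfl, sub_self])
  rw [← sub_add_cancel φ (φ ≫ ∑ j ∈ J, π j ≫ c.inj j), hψ]
  exact add_mem (precomp_mem_finHom g (hZ _ c hc ψ)) (comp_sum_mem_finHom _ _ _ _)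

lemma map_mem_finHom {𝒞 ℰ ι : Type*} [Category 𝒞] [Preadditive 𝒞] [Category ℰ] [Preadditive ℰ]
    (F : 𝒞 ⥤ ℰ) [F.Additive] {Y : ι → 𝒞} {X Z : 𝒞} {c : ∀ i, Y i ⟶ Z} {f : X ⟶ Z}
    (hf : f ∈ finHom c X) : F.map f ∈ finHom (fun i => F.map (c i)) (F.obj X) := by
  have : finHom c X ≤ (finHom (fun i => F.map (c i)) (F.obj X)).comap F.mapAddHom :=
    finHom_le fun i g => by
      change F.map (g ≫ c i) ∈ finHom (fun i => F.map (c i)) (F.obj X)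
      rw [F.map_comp]
      exact comp_mem_finHom _ _
  exact this hf

/-- The image of a coproduct cofan under a left adjoint is a coproduct cofan. -/
noncomputable def isColimitMapCofan {𝒞 ℰ : Type*} [Category 𝒞] [Category ℰ] {F : 𝒞 ⥤ ℰ}
    {G : ℰ ⥤ 𝒞} (adj : F ⊣ G) {ι : Type u} {Y : ι → 𝒞} {c : Cofan Y} (hc : IsColimit c) :
    IsColimit (Cofan.mk (F.obj c.pt) fun i => F.map (c.inj i)) := by
  have := adj.leftAdjoint_preservesColimits
  exact isColimitCofanMkObjOfIsColimit F _ _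
    (hc.ofIsoColimit (Cocone.ext (Iso.refl _) fun ⟨i⟩ => Category.comp_id _))

/-- A functor whose right adjoint is itself a left adjoint preserves compact objects. -/
lemma IsCpt.map {F : DerivedCategory (ModuleCat.{u} A) ⥤ DerivedCategory (ModuleCat.{u} B)}
    {G : DerivedCategory (ModuleCat.{u} B) ⥤ DerivedCategory (ModuleCat.{u} A)}
    {G' : DerivedCategory (ModuleCat.{u} A) ⥤ DerivedCategory (ModuleCat.{u} B)}
    (adj : F ⊣ G) (adj' : G ⊣ G') [F.Additive] {X : 𝒟} (hX : IsCpt X) : IsCpt (F.obj X) := by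
  intro ι Y c hc f
  have := hX _ _ (isColimitMapCofan adj' hc) (adj.homEquiv _ _ f)
  have := map_mem_finHom F this
  rw [← (adj.homEquiv _ _).symm_apply_apply f, Adjunction.homEquiv_counit]
  revert this
  generalize F.map (adj.homEquiv _ _ f) = k
  intro hk
  have : finHom (fun i => F.map (G.map (c.inj i))) (F.obj X) ≤ (finHom c.inj (F.obj X)).comap
      (Preadditive.rightComp (F.obj X) (adj.counit.app c.pt)) :=
    finHom_le fun i g => by
      change (g ≫ F.map (G.map (c.inj i))) ≫ adj.counit.app c.pt ∈ finHom c.inj (F.obj X)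
      have e : F.map (G.map (c.inj i)) ≫ adj.counit.app c.pt =
          adj.counit.app (Y i) ≫ c.inj i := adj.counit_naturality (c.inj i)
      rw [Category.assoc, e, ← Category.assoc]
      exact comp_mem_finHom _ _
  exact this hk

/-- A fully faithful left adjoint reflects compact objects. -/
lemma IsCpt.of_map {F : DerivedCategory (ModuleCat.{u} A) ⥤ DerivedCategory (ModuleCat.{u} B)}
    {G : DerivedCategory (ModuleCat.{u} B) ⥤ DerivedCategory (ModuleCat.{u} A)}
    (adj : F ⊣ G) [F.Additive] [F.Full] [F.Faithful] {X : 𝒟} (hX : IsCpt (F.obj X)) :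
    IsCpt X := by
  intro ι Y c hc f
  have h := hX _ _ (isColimitMapCofan adj hc) (F.map f)
  have : finHom (fun i => F.map (c.inj i)) (F.obj X) ≤
      (finHom c.inj X).map (F.mapAddHom (X := X) (Y := c.pt)) :=
    finHom_le fun i g => by
      obtain ⟨g, rfl⟩ := F.map_surjective g
      exact ⟨g ≫ c.inj i, comp_mem_finHom _ _, F.map_comp _ _⟩
  obtain ⟨f', hf', h'⟩ := this h
  rwa [← F.map_injective h']

lemma IsCpt.shift {X : 𝒟} (hX : IsCpt X) (a : ℤ) : IsCpt (X⟦a⟧) :=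
  have : (shiftEquiv' 𝒟 a (-a) (by lia)).functor.Additive :=
    inferInstanceAs (shiftFunctor 𝒟 a).Additive
  hX.map (shiftEquiv' 𝒟 a (-a) (add_neg_cancel a)).toAdjunction
    (shiftEquiv' 𝒟 (-a) a (by lia)).toAdjunction

lemma IsCpt.of_isZero {X : 𝒟} (hX : IsZero X) : IsCpt X := fun _ _ c _ f => by
  rw [hX.eq_of_src f 0]
  exact zero_mem _

end CompactObjects

section Coproducts

variable {A : Type u} [Ring A]

/-- The class of finitely generated projective modules. -/
def IsFgProj (P : ModuleCat.{u} A) : Prop := Projective P ∧ Module.Finite A P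

lemma isAddClass_isFgProj : IsAddClass (IsFgProj (A := A)) where
  zero X hX := ⟨isAddClass_projective.zero X hX, by
    have := ModuleCat.subsingleton_of_isZero hX
    infer_instance⟩
  retract {X Y} i r h hY := ⟨isAddClass_projective.retract i r h hY.1, by
    have := hY.2
    refine Module.Finite.of_surjective r.hom fun x => ⟨i x, ?_⟩
    rw [← ModuleCat.comp_apply, h, ModuleCat.id_apply]⟩
  biprod {X Y} hX hY := ⟨isAddClass_projective.biprod hX.1 hY.1, by
    have := hX.2
    have := hY.2
    exact Module.Finite.equiv (ModuleCat.biprodIsoProd X Y).symm.toLinearEquiv⟩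

lemma isFgProj_ring : IsFgProj (ModuleCat.of A A) :=
  ⟨(IsProjective.iff_projective A).1 inferInstance, inferInstanceAs (Module.Finite A A)⟩

lemma exists_finset_apply_eq {ι : Type u} {M : ι → ModuleCat.{u} A} {c : Cofan M}
    (hc : IsColimit c) {π : ∀ i, c.pt ⟶ M i} (h₁ : ∀ i, c.inj i ≫ π i = 𝟙 _)
    (h₂ : ∀ i j, i ≠ j → c.inj i ≫ π j = 0) (x : c.pt) :
    ∃ J : Finset ι, ∀ J', J ⊆ J' → (∑ j ∈ J', π j ≫ c.inj j) x = x := by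
  classical
  let U : Submodule A c.pt :=
    { carrier := {x | ∃ J : Finset ι, ∀ J', J ⊆ J' → (∑ j ∈ J', π j ≫ c.inj j) x = x}
      zero_mem' := ⟨∅, fun _ _ => map_zero _⟩
      add_mem' := by
        rintro x y ⟨J, hJ⟩ ⟨J', hJ'⟩
        exact ⟨J ∪ J', fun K hK => by
          rw [map_add, hJ _ (Finset.union_subset_left hK), hJ' _ (Finset.union_subset_right hK)]⟩
      smul_mem' := by
        rintro r x ⟨J, hJ⟩
        exact ⟨J, fun K hK => by rw [map_smul, hJ _ hK]⟩ }
  have hU : ModuleCat.ofHom U.mkQ = 0 := Cofan.IsColimit.hom_ext hc _ _ fun i => by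
    ext y
    have : c.inj i y ∈ U := ⟨{i}, fun J hJ => by
      rw [← ModuleCat.comp_apply, inj_comp_sum h₁ h₂ (hJ (Finset.mem_singleton_self i))]⟩
    simpa using this
  have : U.mkQ x = 0 := congrArg (fun f => f.hom x) hU
  rwa [Submodule.mkQ_apply, Submodule.Quotient.mk_eq_zero] at this

lemma exists_finset_comp_eq {ι : Type u} {M : ι → ModuleCat.{u} A} {c : Cofan M}
    (hc : IsColimit c) {π : ∀ i, c.pt ⟶ M i} (h₁ : ∀ i, c.inj i ≫ π i = 𝟙 _)
    (h₂ : ∀ i j, i ≠ j → c.inj i ≫ π j = 0) {P : ModuleCat.{u} A} [Module.Finite A P]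
    (f : P ⟶ c.pt) :
    ∃ J : Finset ι, ∀ J', J ⊆ J' → f ≫ (∑ j ∈ J', π j ≫ c.inj j) = f := by
  classical
  obtain ⟨S, hS⟩ := Module.Finite.fg_top (R := A) (M := P)
  choose J hJ using fun x => exists_finset_apply_eq hc h₁ h₂ (f x)
  refine ⟨S.biUnion J, fun J' hJ' => ?_⟩
  ext1
  refine LinearMap.ext_on hS fun x hx => ?_
  exact hJ x J' ((Finset.subset_biUnion_of_mem J hx).trans hJ')

lemma exists_finset_complex {ι : Type u} {L : ι → CochainComplex (ModuleCat.{u} A) ℤ}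
    {c : Cofan L} (hc : IsColimit c) {π : ∀ i, c.pt ⟶ L i} (h₁ : ∀ i, c.inj i ≫ π i = 𝟙 _)
    (h₂ : ∀ i j, i ≠ j → c.inj i ≫ π j = 0) {K : CochainComplex (ModuleCat.{u} A) ℤ} {a b : ℤ}
    (hK : ∀ i, Module.Finite A (K.X i)) (hK' : ∀ i, (i < a ∨ b < i) → IsZero (K.X i))
    (f : K ⟶ c.pt) : ∃ J : Finset ι, f ≫ (∑ j ∈ J, π j ≫ c.inj j) = f := by
  classical
  have (n : ℤ) : ∃ J : Finset ι, ∀ J', J ⊆ J' →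
      f.f n ≫ (∑ j ∈ J', (π j).f n ≫ (c.inj j).f n) = f.f n :=
    have := hK n
    exists_finset_comp_eq
      (c := Cofan.mk (c.pt.X n) fun i => (c.inj i).f n)
      (isColimitCofanMkObjOfIsColimit (HomologicalComplex.eval _ _ n) _ _
        (hc.ofIsoColimit (Cocone.ext (Iso.refl _) fun ⟨i⟩ => Category.comp_id _)))
      (π := fun i => (π i).f n)
      (fun i => congrArg (fun g => g.f n) (h₁ i))
      (fun i j hij => congrArg (fun g => g.f n) (h₂ i j hij)) (f.f n)
  choose J hJ using this
  refine ⟨(Finset.Icc a b).biUnion J, ?_⟩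
  ext1 n
  by_cases hn : n ∈ Finset.Icc a b
  · have := hJ n _ (Finset.subset_biUnion_of_mem J hn)
    rw [HomologicalComplex.comp_f]
    convert this
    exact (HomologicalComplex.eval _ _ n).map_sum _ _
  · exact (hK' n (by rw [Finset.mem_Icc] at hn; lia)).eq_of_src _ _

variable [HasDerivedCategory.{w} (ModuleCat.{u} A)]

open DerivedCategory

lemma mem_finHom_Q {ι : Type u} {L : ι → CochainComplex (ModuleCat.{u} A) ℤ}
    {c : Cofan L} (hc : IsColimit c) {X : DerivedCategory (ModuleCat.{u} A)} {a b : ℤ}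
    (hX : IsRep IsFgProj a b X) (f : X ⟶ Q.obj c.pt) :
    f ∈ finHom (fun i => Q.map (c.inj i)) X := by
  obtain ⟨K, hK, hK', ⟨e⟩⟩ := hX
  have (i : ℤ) : Projective (K.X i) := (hK i).1
  have : K.IsStrictlyLE b := by
    rw [CochainComplex.isStrictlyLE_iff]
    exact fun i hi => hK' i (Or.inr hi)
  obtain ⟨φ, hφ⟩ := exists_map_of_projective K c.pt b (e.hom ≫ f)
  obtain ⟨π, h₁, h₂⟩ := exists_proj hc
  obtain ⟨J, hJ⟩ := exists_finset_complex hc h₁ h₂ (fun i => (hK i).2) hK' φ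
  have h := map_mem_finHom Q (hJ ▸ comp_sum_mem_finHom c.inj π φ J : φ ∈ finHom c.inj K)
  rw [← hφ] at h
  simpa using precomp_mem_finHom e.inv h

/-- The shifted free module of rank one, as an object of the derived category. -/
noncomputable abbrev free (A : Type u) [Ring A] [HasDerivedCategory.{w} (ModuleCat.{u} A)]
    (i : ℤ) : DerivedCategory (ModuleCat.{u} A) := (st (ModuleCat.of A A))⟦-i⟧

lemma isRep_free (i : ℤ) : IsRep IsFgProj i i (free A i) :=
  isRep_stShift isAddClass_isFgProj isFgProj_ring i

lemma isLE_of_free {X : DerivedCategory (ModuleCat.{u} A)} (n : ℤ)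
    (h : ∀ i, n < i → ∀ f : free A i ⟶ X, f = 0) : X.IsLE n := by
  rw [isLE_iff]
  intro i hi
  obtain ⟨Y, B, hY, hB, f, g, k, H⟩ := exists_trunc X i
  have hY' : Y.IsLE (i - 1) := by
    obtain ⟨N, Y', hY', f', g', k', H'⟩ := exists_top hY
    have hN : IsZero N := by
      rw [IsZero.iff_id_eq_zero]
      ext x
      let φ : free A i ⟶ (st N)⟦-i⟧ := ((singleFunctor _ 0).map
        (ModuleCat.ofHom (LinearMap.toSpanSingleton A N x)))⟦-i⟧'
      obtain ⟨ψ, hψ⟩ := exists_lift₃ H' φ ((isRep_free i).pdLE (fun _ h => h.1)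
        (isLE_mono (isLE_shift hY' 1 (i - 2) (by lia)) (by lia)) _)
      obtain ⟨l, k₂, H₂⟩ := exists_invRotate H
      obtain ⟨χ, hχ⟩ := exists_lift₂ H₂ ψ (h i hi _)
      have hχ' : χ = 0 := hom_eq_zero (stShift_isLE _ i) 
        (isGE_shift hB (-1) (i + 2) (by lia)) (by lia) χ
      have hφ : φ = 0 := by rw [hψ, hχ, hχ', zero_comp, zero_comp]
      have : ModuleCat.ofHom (LinearMap.toSpanSingleton A N x) = 0 :=
        (singleFunctor _ 0 ⋙ shiftFunctor _ (-i)).map_injective (by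
          rw [Functor.map_zero]
          exact hφ)
      simpa using congrArg (fun g => g.hom (1 : A)) this
    refine isLE_ext H' hY' (isLE_of_isZero ?_ _)
    exact (singleFunctor _ 0 ⋙ shiftFunctor _ (-i)).map_isZero hN
  exact (HomologySequence.exact₂ _ H i).isZero_X₂
    ((isZero_of_isLE Y (i - 1) i (by lia)).eq_of_src _ _)
    ((isZero_of_isGE B (i + 1) i (by lia)).eq_of_tgt _ _)

lemma isZero_of_free {X : DerivedCategory (ModuleCat.{u} A)}
    (h : ∀ i, ∀ f : free A i ⟶ X, f = 0) : IsZero X := by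
  have (n : ℤ) : X.IsLE n := isLE_of_free n fun i _ => h i
  have : IsIso (0 : X ⟶ X) := by
    rw [DerivedCategory.isIso_iff]
    intro n
    have hn := isZero_of_isLE X (n - 1) n (by lia)
    exact hn.isIso hn _
  rw [IsZero.iff_id_eq_zero, ← IsIso.hom_inv_id (0 : X ⟶ X), zero_comp]

lemma isIso_of_free {X Y : DerivedCategory (ModuleCat.{u} A)} (f : X ⟶ Y)
    (h₁ : ∀ i (v : free A i ⟶ X), v ≫ f = 0 → v = 0)
    (h₂ : ∀ i (v : free A i ⟶ Y), ∃ v', v' ≫ f = v) : IsIso f := by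
  obtain ⟨Z, g, k, H⟩ := distinguished_cocone_triangle f
  refine (Triangle.isZero₃_iff_isIso₁ _ H).1
    (isZero_of_free fun i (v : free A i ⟶ Z) => ?_)
  have hv : v ≫ k = 0 := by
    let e : free A i ≅ (free A (i + 1))⟦(1 : ℤ)⟧ :=
      (shiftFunctorAdd' _ (-(i + 1)) 1 (-i) (by lia)).app _
    obtain ⟨w, hw⟩ := (shiftFunctor _ (1 : ℤ)).map_surjective (e.inv ≫ v ≫ k)
    have : w = 0 := h₁ _ w ((shiftFunctor _ (1 : ℤ)).map_injective (by
      rw [Functor.map_comp, hw, Functor.map_zero, Category.assoc, Category.assoc,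
        distTriang_comp₃₁ H, comp_zero, comp_zero]))
    rw [this, Functor.map_zero] at hw
    rw [← cancel_epi e.inv, ← hw, comp_zero]
  obtain ⟨v', rfl⟩ := exists_lift₃ H v hv
  obtain ⟨v'', rfl⟩ := h₂ i v'
  exact (Category.assoc _ _ _).trans ((congrArg _ (distTriang_comp₁₂ H)).trans comp_zero)

lemma exists_desc_Q {ι : Type u} {L : ι → CochainComplex (ModuleCat.{u} A) ℤ}
    {c : Cofan L} (hc : IsColimit c) {M : CochainComplex (ModuleCat.{u} A) ℤ}
    (a : ∀ i, Q.obj (L i) ⟶ Q.obj M) : ∃ h : Q.obj c.pt ⟶ Q.obj M,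
      ∀ i, Q.map (c.inj i) ≫ h = a i := by
  choose L' s hs g hg using fun i => right_fac (a i)
  let c' := Cofan.mk (∐ L') (Sigma.ι L')
  have hc' : IsColimit c' := coproductIsCoproduct L'
  let σ : c'.pt ⟶ c.pt := Cofan.IsColimit.desc hc' fun i => s i ≫ c.inj i
  have hσ (i : ι) : c'.inj i ≫ σ = s i ≫ c.inj i := Cofan.IsColimit.fac _ _ _
  obtain ⟨π, h₁, h₂⟩ := exists_proj hc
  obtain ⟨π', h₁', h₂'⟩ := exists_proj hc'
  have hπ (j : ι) : σ ≫ π j = π' j ≫ s j := Cofan.IsColimit.hom_ext hc' _ _ fun i => by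
    rw [← Category.assoc, hσ, Category.assoc, ← Category.assoc (c'.inj i)]
    by_cases hij : i = j
    · subst hij
      rw [h₁, h₁', Category.comp_id, Category.id_comp]
    · rw [h₂ _ _ hij, h₂' _ _ hij, comp_zero, zero_comp]
  have : IsIso (Q.map σ) := by
    refine isIso_of_free _ (fun i v hv => ?_) fun i v => ?_
    · obtain ⟨J, hJ⟩ := exists_finset_of_mem_finHom (π := fun j => Q.map (π' j))
        (fun i => by rw [← Q.map_comp, h₁', Q.map_id])
        (fun i j hij => by rw [← Q.map_comp, h₂' _ _ hij, Q.map_zero])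
        (mem_finHom_Q hc' (isRep_free i) v)
      rw [← hJ J subset_rfl, Preadditive.comp_sum]
      refine Finset.sum_eq_zero fun j _ => ?_
      have : v ≫ Q.map (π' j) = 0 := by
        rw [← cancel_mono (Q.map (s j)), Category.assoc, ← Q.map_comp, ← hπ, Q.map_comp,
          reassoc_of% hv, zero_comp, zero_comp]
      rw [← Category.assoc, this, zero_comp]
    · have : finHom (fun i => Q.map (c.inj i)) (free A i) ≤
          (Preadditive.rightComp (free A i) (Q.map σ)).range := finHom_le fun j g =>
        ⟨g ≫ inv (Q.map (s j)) ≫ Q.map (c'.inj j), by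
          change (g ≫ inv (Q.map (s j)) ≫ Q.map (c'.inj j)) ≫ Q.map σ = _
          rw [Category.assoc, Category.assoc, ← Q.map_comp, hσ, Q.map_comp,
            IsIso.inv_hom_id_assoc]⟩
      exact this (mem_finHom_Q hc (isRep_free i) v)
  refine ⟨inv (Q.map σ) ≫ Q.map (Cofan.IsColimit.desc hc' g), fun i => ?_⟩
  have : Q.map (c.inj i) = inv (Q.map (s i)) ≫ Q.map (c'.inj i) ≫ Q.map σ := by
    rw [← Q.map_comp, hσ, Q.map_comp, IsIso.inv_hom_id_assoc]
  rw [this, Category.assoc, Category.assoc, IsIso.hom_inv_id_assoc, ← Q.map_comp,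
    Cofan.IsColimit.fac, hg]

lemma eq_zero_of_Q_comp_eq_zero {ι : Type u} {L : ι → CochainComplex (ModuleCat.{u} A) ℤ}
    {c : Cofan L} (hc : IsColimit c) {Y : DerivedCategory (ModuleCat.{u} A)}
    (h : Q.obj c.pt ⟶ Y) (hh : ∀ i, Q.map (c.inj i) ≫ h = 0) : h = 0 := by
  obtain ⟨W, p, k, H⟩ := distinguished_cocone_triangle₁ h
  choose l hl using fun i => exists_lift₂ H _ (hh i)
  let e' := Q.objObjPreimageIso W
  obtain ⟨r, hr⟩ := exists_desc_Q hc (fun i => l i ≫ e'.inv)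
  let e := r ≫ e'.hom ≫ p
  have he (i : ι) : Q.map (c.inj i) ≫ e = Q.map (c.inj i) := by
    rw [← Category.assoc, hr]
    simp [← hl]
  have he' (j : ℤ) (v : free A j ⟶ Q.obj c.pt) : v ≫ e = v := by
    have := finHom_le (c := fun i => Q.map (c.inj i)) (X := free A j)
      (U := (Preadditive.rightComp (free A j) e).eqLocus (AddMonoidHom.id _)) fun i g => by
        change (g ≫ Q.map (c.inj i)) ≫ e = g ≫ Q.map (c.inj i)
        rw [Category.assoc, he]
    exact this (mem_finHom_Q hc (isRep_free j) v)
  have : IsIso e := isIso_of_free e (fun i v hv => by rw [← he' i v, hv])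
    fun i v => ⟨v, he' i v⟩
  rw [← cancel_epi e, comp_zero, Category.assoc, Category.assoc, distTriang_comp₁₂ H,
    comp_zero, comp_zero]

lemma nonempty_isColimit_Q {ι : Type u} {L : ι → CochainComplex (ModuleCat.{u} A) ℤ}
    {c : Cofan L} (hc : IsColimit c) :
    Nonempty (IsColimit (Cofan.mk (Q.obj c.pt) fun i => Q.map (c.inj i))) := by
  have (Y : DerivedCategory (ModuleCat.{u} A)) (a : ∀ i, Q.obj (L i) ⟶ Y) :
      ∃ h : Q.obj c.pt ⟶ Y, ∀ i, Q.map (c.inj i) ≫ h = a i := by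
    obtain ⟨h, hh⟩ := exists_desc_Q hc (fun i => a i ≫ (Q.objObjPreimageIso Y).inv)
    exact ⟨h ≫ (Q.objObjPreimageIso Y).hom, fun i => by simp [reassoc_of% hh i]⟩
  choose d hd using this
  refine ⟨Cofan.IsColimit.mk _ (fun s => d s.pt s.inj) (fun s => hd s.pt s.inj)
    fun s m hm => sub_eq_zero.1 (eq_zero_of_Q_comp_eq_zero hc _ fun i => ?_)⟩
  rw [Preadditive.comp_sub, hd]
  exact sub_eq_zero.2 (hm i)

lemma exists_iso_Q_coproduct {ι : Type u} (Y : ι → DerivedCategory (ModuleCat.{u} A)) :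
    ∃ (L : ι → CochainComplex (ModuleCat.{u} A) ℤ) (e : ∀ i, Q.obj (L i) ≅ Y i) (c : Cofan L)
      (_ : IsColimit c),
      Nonempty (IsColimit (Cofan.mk (Q.obj c.pt) fun i => (e i).inv ≫ Q.map (c.inj i))) := by
  let L i := Q.objPreimage (Y i)
  let e (i : ι) : Q.obj (L i) ≅ Y i := Q.objObjPreimageIso (Y i)
  obtain ⟨h⟩ := nonempty_isColimit_Q (coproductIsCoproduct L)
  refine ⟨L, e, _, coproductIsCoproduct L, ⟨Cofan.IsColimit.mk _
    (fun s => Cofan.IsColimit.desc h fun i => (e i).hom ≫ s.inj i) (fun s i => ?_)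
    fun s m hm => Cofan.IsColimit.hom_ext h _ _ fun i => ?_⟩⟩
  · have := Cofan.IsColimit.fac h (fun i => (e i).hom ≫ s.inj i) i
    rw [← Iso.inv_comp_eq] at this
    exact (Category.assoc _ _ _).trans this
  · rw [Cofan.IsColimit.fac]
    rw [← Iso.inv_comp_eq]
    exact (Category.assoc _ _ _).symm.trans (hm i)

lemma exists_coproduct {ι : Type u} (Y : ι → DerivedCategory (ModuleCat.{u} A)) :
    ∃ c : Cofan Y, Nonempty (IsColimit c) := by
  obtain ⟨L, e, c, hc, h⟩ := exists_iso_Q_coproduct Y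
  exact ⟨_, h⟩

lemma IsRep.isCpt {X : DerivedCategory (ModuleCat.{u} A)} {a b : ℤ}
    (hX : IsRep IsFgProj a b X) : IsCpt X := by
  intro ι Y c hc f
  obtain ⟨L, e, c', hc', ⟨h⟩⟩ := exists_iso_Q_coproduct Y
  let φ : Q.obj c'.pt ⟶ c.pt := Cofan.IsColimit.desc h c.inj
  let ψ : c.pt ⟶ Q.obj c'.pt := Cofan.IsColimit.desc hc fun i => (e i).inv ≫ Q.map (c'.inj i)
  have hφ (i : ι) : Q.map (c'.inj i) ≫ φ = (e i).hom ≫ c.inj i := by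
    have := Cofan.IsColimit.fac h c.inj i
    rw [← Iso.inv_comp_eq]
    exact (Category.assoc _ _ _).symm.trans this
  have hψφ : ψ ≫ φ = 𝟙 _ := Cofan.IsColimit.hom_ext hc _ _ fun i => by
    rw [← Category.assoc, Cofan.IsColimit.fac, Category.assoc, hφ, Iso.inv_hom_id_assoc,
      Category.comp_id]
  have : finHom (fun i => Q.map (c'.inj i)) X ≤
      (finHom c.inj X).comap (Preadditive.rightComp X φ) := finHom_le fun i g => by
    change (g ≫ Q.map (c'.inj i)) ≫ φ ∈ finHom c.inj X
    rw [Category.assoc, hφ, ← Category.assoc]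
    exact comp_mem_finHom _ _
  have h₁ : (f ≫ ψ) ≫ φ ∈ finHom c.inj X := this (mem_finHom_Q hc' hX (f ≫ ψ))
  rwa [Category.assoc, hψφ, Category.comp_id] at h₁

end Coproducts

section Generation

variable {A : Type u} [Ring A] [HasDerivedCategory.{w} (ModuleCat.{u} A)]

local notation "𝒟" => DerivedCategory (ModuleCat A)

open DerivedCategory

/-- A class of objects containing zero objects, closed under shifts and extensions. -/
structure IsTriClass (Ψ : DerivedCategory (ModuleCat.{u} A) → Prop) : Prop where
  zero : ∀ X, IsZero X → Ψ X
  shift : ∀ X (a : ℤ), Ψ X → Ψ (X⟦a⟧)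
  ext : ∀ {X Y Z} {f : X ⟶ Y} {g : Y ⟶ Z} {h : Z ⟶ X⟦(1 : ℤ)⟧},
    Triangle.mk f g h ∈ distTriang _ → Ψ X → Ψ Z → Ψ Y

namespace IsTriClass

variable {Ψ : DerivedCategory (ModuleCat.{u} A) → Prop} (hΨ : IsTriClass Ψ)
include hΨ

lemma fiber {X Y Z : 𝒟} {f : X ⟶ Y} {g : Y ⟶ Z} {h : Z ⟶ X⟦(1 : ℤ)⟧}
    (H : Triangle.mk f g h ∈ distTriang _) (hY : Ψ Y) (hZ : Ψ Z) : Ψ X := by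
  obtain ⟨k, l, H'⟩ := exists_invRotate H
  exact hΨ.ext H' (hΨ.shift _ _ hZ) hY

lemma cone {X Y Z : 𝒟} {f : X ⟶ Y} {g : Y ⟶ Z} {h : Z ⟶ X⟦(1 : ℤ)⟧}
    (H : Triangle.mk f g h ∈ distTriang _) (hX : Ψ X) (hY : Ψ Y) : Ψ Z := by
  exact hΨ.ext (exists_rotate H) hY (hΨ.shift _ _ hX)

lemma biprod {X Y : 𝒟} (hX : Ψ X) (hY : Ψ Y) : Ψ (X ⊞ Y) :=
  hΨ.ext (binaryBiproductTriangle_distinguished X Y) hX hY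

lemma and {Ψ' : DerivedCategory (ModuleCat.{u} A) → Prop} (hΨ' : IsTriClass Ψ') :
    IsTriClass (fun X => Ψ X ∧ Ψ' X) where
  zero X hX := ⟨hΨ.zero X hX, hΨ'.zero X hX⟩
  shift X a hX := ⟨hΨ.shift X a hX.1, hΨ'.shift X a hX.2⟩
  ext H hX hZ := ⟨hΨ.ext H hX.1 hZ.1, hΨ'.ext H hX.2 hZ.2⟩

lemma exists_factor {ι : Type u} {Y : ι → 𝒟} {c : Cofan Y} (hc : IsColimit c)
    (hY : ∀ i, Ψ (Y i)) {X : 𝒟} (hX : IsCpt X) (f : X ⟶ c.pt) :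
    ∃ (F : 𝒟) (_ : Ψ F) (r : c.pt ⟶ F) (b : F ⟶ c.pt), f ≫ r ≫ b = f := by
  classical
  obtain ⟨π, h₁, h₂⟩ := exists_proj hc
  obtain ⟨J, hJ⟩ := exists_finset_of_mem_finHom h₁ h₂ (hX _ c hc f)
  obtain ⟨Z, hZ⟩ := HasZeroObject.zero (C := 𝒟)
  suffices h : ∃ (F : 𝒟) (_ : Ψ F) (r : c.pt ⟶ F) (b : F ⟶ c.pt),
      r ≫ b = ∑ j ∈ J, π j ≫ c.inj j by
    obtain ⟨F, hF, r, b, h⟩ := h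
    exact ⟨F, hF, r, b, by rw [h, hJ J subset_rfl]⟩
  clear hJ
  induction J using Finset.induction_on with
  | empty => exact ⟨Z, hΨ.zero _ hZ, 0, 0, by simp⟩
  | insert j J hj ih =>
    obtain ⟨F, hF, r, b, h⟩ := ih
    exact ⟨Y j ⊞ F, hΨ.biprod (hY j) hF, biprod.lift (π j) r, biprod.desc (c.inj j) b, by
      rw [biprod.lift_desc, Finset.sum_insert hj, h]⟩

end IsTriClass

lemma isTriClass_isCpt : IsTriClass (IsCpt (A := A)) where
  zero _ := IsCpt.of_isZero
  shift _ a h := h.shift a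
  ext := IsCpt.ext

lemma isTriClass_isRep {Φ : ModuleCat.{u} A → Prop} (hΦ : IsAddClass Φ)
    (hΦ' : ∀ P, Φ P → Projective P) : IsTriClass (fun X => ∃ a b, IsRep Φ a b X) where
  zero X hX := ⟨0, 0, IsRep.of_isZero hΦ _ _ hX⟩
  shift X n := fun ⟨a, b, h⟩ => ⟨a - n, b - n, h.shift _ _ _ (by lia) (by lia)⟩
  ext H := fun ⟨a, b, h⟩ ⟨a', b', h'⟩ => ⟨min a a', max b b', IsRep.ext hΦ (Or.inl hΦ') H
    (h.mono (by lia) (by lia)) (h'.mono (by lia) (by lia))⟩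

/-- A morphism from a compact object to the homotopy colimit of a sequence which is phantom with
respect to shifts of the free module vanishes at a finite stage. -/
lemma exists_eq_zero_of_tower {X : ℕ → 𝒟} (t : ∀ n, X n ⟶ X (n + 1))
    (ht : ∀ n i (v : free A i ⟶ X n), v ≫ t n = 0) {K : 𝒟} (hK : IsCpt K)
    (f : ∀ n, K ⟶ X n) (hf : ∀ n, f (n + 1) = f n ≫ t n) : ∃ n, f n = 0 := by
  classical
  obtain ⟨c, ⟨hc⟩⟩ := exists_coproduct fun i : ULift.{u} ℕ => X i.down
  let s : c.pt ⟶ c.pt := Cofan.IsColimit.desc hc fun i => t i.down ≫ c.inj ⟨i.down + 1⟩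
  have hs (n : ℕ) : c.inj ⟨n⟩ ≫ s = t n ≫ c.inj ⟨n + 1⟩ := Cofan.IsColimit.fac hc _ ⟨n⟩
  have hs' (i : ℤ) (v : free A i ⟶ c.pt) : v ≫ s = 0 := by
    have := finHom_le (c := c.inj) (X := free A i)
      (U := (Preadditive.rightComp (free A i) s).ker) fun i g => by
        change (g ≫ c.inj i) ≫ s = 0
        rw [Category.assoc, hs, ← Category.assoc, ht, zero_comp]
    exact this ((isRep_free i).isCpt _ c hc v)
  have : IsIso (𝟙 _ - s) := isIso_of_free _
    (fun i v hv => by simpa [Preadditive.comp_sub, hs'] using hv)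
    (fun i v => ⟨v, by simp [Preadditive.comp_sub, hs']⟩)
  obtain ⟨π, h₁, h₂⟩ := exists_proj hc
  obtain ⟨g, hg⟩ : ∃ g : K ⟶ c.pt, g = g ≫ s + f 0 ≫ c.inj ⟨0⟩ := by
    refine ⟨(f 0 ≫ c.inj ⟨0⟩) ≫ inv (𝟙 _ - s), ?_⟩
    have h : ((f 0 ≫ c.inj ⟨0⟩) ≫ inv (𝟙 _ - s)) ≫ (𝟙 _ - s) = f 0 ≫ c.inj ⟨0⟩ := by
      rw [Category.assoc, IsIso.inv_hom_id, Category.comp_id]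
    rw [Preadditive.comp_sub, Category.comp_id] at h
    exact sub_eq_iff_eq_add'.1 h
  have hg' (n : ℕ) : g ≫ π ⟨n⟩ = g ≫ s ≫ π ⟨n⟩ + f 0 ≫ c.inj ⟨0⟩ ≫ π ⟨n⟩ := by
    rw [← Category.assoc, ← Category.assoc, ← Preadditive.add_comp, ← hg]
  have hs₀ : s ≫ π ⟨0⟩ = 0 := Cofan.IsColimit.hom_ext hc _ _ fun ⟨n⟩ => by
    rw [← Category.assoc, hs, Category.assoc, h₂ _ _ (by simp), comp_zero, comp_zero]
  have hs₁ (n : ℕ) : s ≫ π ⟨n + 1⟩ = π ⟨n⟩ ≫ t n := Cofan.IsColimit.hom_ext hc _ _ fun ⟨m⟩ => by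
    rw [← Category.assoc, hs, Category.assoc, ← Category.assoc (c.inj _)]
    by_cases hm : m = n
    · subst hm
      rw [h₁, h₁, Category.comp_id, Category.id_comp]
    · rw [h₂ _ _ (by simpa using hm), h₂ _ _ (by simpa using hm), comp_zero, zero_comp]
  have hgf (n : ℕ) : g ≫ π ⟨n⟩ = f n := by
    induction n with
    | zero =>
      rw [hg', hs₀, h₁, comp_zero, zero_add, Category.comp_id]
    | succ n ih =>
      rw [hg', hs₁, h₂ _ _ (by simp), comp_zero, add_zero, ← Category.assoc, ih, hf]
  obtain ⟨J, hJ⟩ := exists_finset_of_mem_finHom h₁ h₂ (hK _ c hc g)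
  obtain ⟨⟨n⟩, hn⟩ := Infinite.exists_notMem_finset J
  refine ⟨n, ?_⟩
  rw [← hgf, ← hJ J subset_rfl, Category.assoc, Preadditive.sum_comp, Finset.sum_eq_zero,
    comp_zero]
  intro j hj
  rw [Category.assoc, h₂ _ _ (by rintro rfl; exact hn hj), comp_zero]

lemma exists_killing (X : DerivedCategory (ModuleCat.{u} A)) :
    ∃ (Y : DerivedCategory (ModuleCat.{u} A)) (t : X ⟶ Y),
      (∀ i (v : free A i ⟶ X), v ≫ t = 0) ∧ ∃ (ι : Type u) (n : ι → ℤ)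
        (c : Cofan fun j => free A (n j)) (_ : IsColimit c) (p : c.pt ⟶ X)
        (k : Y ⟶ c.pt⟦(1 : ℤ)⟧), Triangle.mk p t k ∈ distTriang _ := by
  have (i : ℤ) : Small.{u} (free A i ⟶ X) := by
    obtain ⟨K, hK, hK', ⟨e⟩⟩ := isRep_free (A := A) i
    have (i : ℤ) : Projective (K.X i) := (hK i).1
    have : K.IsStrictlyLE i := by
      rw [CochainComplex.isStrictlyLE_iff]
      exact fun j hj => hK' j (Or.inr hj)
    refine small_of_surjective (α := K ⟶ Q.objPreimage X)
      (f := fun φ => e.inv ≫ Q.map φ ≫ (Q.objObjPreimageIso X).hom) fun v => ?_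
    obtain ⟨φ, hφ⟩ := exists_map_of_projective K _ i (e.hom ≫ v ≫ (Q.objObjPreimageIso X).inv)
    exact ⟨φ, by simp [← hφ]⟩
  obtain ⟨c, ⟨hc⟩⟩ := exists_coproduct
    fun j : (Σ i : ℤ, Shrink.{u} (free A i ⟶ X)) => free A j.1
  let p := Cofan.IsColimit.desc hc fun j => (equivShrink _).symm j.2
  obtain ⟨Y, t, k, H⟩ := distinguished_cocone_triangle p
  refine ⟨Y, t, fun i v => ?_, _, _, c, hc, p, k, H⟩
  have : v = c.inj ⟨i, equivShrink _ v⟩ ≫ p := by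
    rw [Cofan.IsColimit.fac, Equiv.symm_apply_apply]
  rw [this, Category.assoc, distTriang_comp₁₂ H, comp_zero]

lemma IsTriClass.factors_of_comp_factors {Ψ : DerivedCategory (ModuleCat.{u} A) → Prop}
    (hΨ : IsTriClass Ψ) (hΨ' : ∀ X, Ψ X → IsCpt X) {ι : Type u} {M : ι → 𝒟} {c : Cofan M}
    (hc : IsColimit c) (hM : ∀ i, Ψ (M i)) {X Y : 𝒟} {p : c.pt ⟶ X} {t : X ⟶ Y}
    {k : Y ⟶ c.pt⟦(1 : ℤ)⟧} (H : Triangle.mk p t k ∈ distTriang _) {K : 𝒟} (hK : IsCpt K)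
    {α : K ⟶ X} (hα : ∃ (B : 𝒟) (_ : Ψ B) (a : K ⟶ B) (b : B ⟶ Y), α ≫ t = a ≫ b) :
    ∃ (B : 𝒟) (_ : Ψ B) (a : K ⟶ B) (b : B ⟶ X), α = a ≫ b := by
  obtain ⟨B, hB, a, β, hα⟩ := hα
  obtain ⟨F, hF, r, b, hr⟩ := hΨ.exists_factor
    (isColimitMapCofan (shiftEquiv' 𝒟 (1 : ℤ) (-1) (by lia)).toAdjunction hc)
    (fun i => hΨ.shift _ 1 (hM i)) (hΨ' _ hB) (β ≫ k)
  change c.pt⟦(1 : ℤ)⟧ ⟶ F at r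
  change F ⟶ c.pt⟦(1 : ℤ)⟧ at b
  replace hr : (β ≫ k) ≫ r ≫ b = β ≫ k := hr
  obtain ⟨B', u, l, H'⟩ := distinguished_cocone_triangle₁ ((β ≫ k) ≫ r)
  obtain ⟨a', ha'⟩ := exists_lift₂ H' a (by
    rw [← Category.assoc, ← Category.assoc, ← hα, Category.assoc α, distTriang_comp₂₃ H,
      comp_zero, zero_comp])
  obtain ⟨γ, hγ⟩ := exists_lift₃ H (u ≫ β) (by
    have := distTriang_comp₁₂ H'
    rw [Category.assoc, ← hr, ← Category.assoc _ r b, ← Category.assoc, this, zero_comp])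
  obtain ⟨δ, hδ⟩ := exists_lift₂ H (α - a' ≫ γ) (by
    rw [Preadditive.sub_comp, hα, Category.assoc, ← hγ, ← Category.assoc, ← ha', sub_self])
  obtain ⟨F', hF', r', b', hr'⟩ := hΨ.exists_factor hc hM hK δ
  refine ⟨B' ⊞ F', hΨ.biprod (hΨ.fiber H' hB hF) hF', biprod.lift a' (δ ≫ r'),
    biprod.desc γ (b' ≫ p), ?_⟩
  rw [biprod.lift_desc, Category.assoc, ← Category.assoc r', ← Category.assoc δ, hr', ← hδ]
  abel

/-- A compact object is a retract of an object of any class of objects which contains the free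
module of rank one and is closed under shifts and extensions. -/
theorem IsTriClass.exists_retract {Ψ : DerivedCategory (ModuleCat.{u} A) → Prop}
    (hΨ : IsTriClass Ψ) (h : Ψ (st (ModuleCat.of A A))) {K : 𝒟} (hK : IsCpt K) :
    ∃ (B : 𝒟) (_ : Ψ B) (i : K ⟶ B) (r : B ⟶ K), i ≫ r = 𝟙 K := by
  have hΨ' := hΨ.and isTriClass_isCpt
  choose Y t ht ι n c hc p k H using exists_killing (A := A)
  let X : ℕ → 𝒟 := fun n => n.rec K fun _ Z => Y Z
  let f : ∀ n, K ⟶ X n := fun n => n.rec (𝟙 K) fun m g => g ≫ t (X m)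
  obtain ⟨N, hN⟩ := exists_eq_zero_of_tower (X := X) (fun n => t (X n)) (fun n => ht (X n)) hK f
    fun n => rfl
  obtain ⟨Z, hZ⟩ := HasZeroObject.zero (C := 𝒟)
  have hf (m : ℕ) : ∃ (B : 𝒟) (_ : Ψ B ∧ IsCpt B) (a : K ⟶ B) (b : B ⟶ X (N - m)),
      f (N - m) = a ≫ b := by
    induction m with
    | zero => exact ⟨Z, hΨ'.zero _ hZ, (0 : K ⟶ Z), hZ.to_ _, hN.trans zero_comp.symm⟩
    | succ m ih =>
      by_cases hm : N ≤ m
      · rwa [show N - (m + 1) = N - m by lia]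
      · obtain ⟨l, hl⟩ : ∃ l, N - (m + 1) = l := ⟨_, rfl⟩
        rw [show N - m = l + 1 by lia] at ih
        rw [hl]
        exact hΨ'.factors_of_comp_factors (fun _ h => h.2) (hc (X l))
          (fun i => hΨ'.shift _ _ ⟨h, (isRep_st isAddClass_isFgProj isFgProj_ring).isCpt⟩)
          (H (X l)) hK ih
  have := hf N
  rw [Nat.sub_self] at this
  obtain ⟨B, hB, a, b, e⟩ := this
  exact ⟨B, hB.1, a, b, e.symm⟩

end Generation

section CompactCovers

variable {A : Type u} [Ring A] [HasDerivedCategory.{w} (ModuleCat.{u} A)]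

local notation "𝒟" => DerivedCategory (ModuleCat A)

open DerivedCategory

lemma IsRep.exists_fg_comp_eq_zero {X : 𝒟} {a b : ℤ} (hX : IsRep IsFgProj a b X)
    {N : ModuleCat.{u} A} (f : X ⟶ st N) : ∃ N₀ : Submodule A N, N₀.FG ∧
      f ≫ (singleFunctor (ModuleCat.{u} A) 0).map (ModuleCat.ofHom N₀.mkQ) = 0 := by
  obtain ⟨L, hL, hL', ⟨e⟩⟩ := hX
  have (i : ℤ) : Projective (L.X i) := (hL i).1
  have : L.IsStrictlyLE b := by
    rw [CochainComplex.isStrictlyLE_iff]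
    exact fun i hi => hL' i (Or.inr hi)
  let K (M : ModuleCat.{u} A) : CochainComplex (ModuleCat.{u} A) ℤ :=
    (HomologicalComplex.single _ (.up ℤ) 0).obj M
  obtain ⟨φ, hφ⟩ := exists_map_of_projective L (K N) b (e.hom ≫ f)
  let p : L.X 0 ⟶ N := φ.f 0 ≫ (HomologicalComplex.singleObjXSelf (.up ℤ) 0 N).hom
  have := (hL 0).2
  refine ⟨LinearMap.range p.hom, ?_, ?_⟩
  · rw [LinearMap.range_eq_map]
    exact this.fg_top.map _
  · rw [← cancel_epi e.hom, ← Category.assoc, comp_zero]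
    refine (congrArg (fun ψ : Q.obj L ⟶ Q.obj (K N) => ψ ≫ Q.map
      ((HomologicalComplex.single _ (.up ℤ) 0).map
        (ModuleCat.ofHom (LinearMap.range p.hom).mkQ))) hφ).trans ?_
    suffices h : φ ≫ (HomologicalComplex.single _ (.up ℤ) 0).map
        (ModuleCat.ofHom (LinearMap.range p.hom).mkQ) = 0 by
      rw [← Q.map_comp, h, Q.map_zero]
      rfl
    refine HomologicalComplex.to_single_hom_ext ?_
    rw [HomologicalComplex.comp_f, HomologicalComplex.single_map_f_self, ← Category.assoc]
    have hp : p ≫ ModuleCat.ofHom (LinearMap.range p.hom).mkQ = 0 := by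
      ext x
      simp
    change p ≫ ModuleCat.ofHom _ ≫ _ = 0
    rw [← Category.assoc, hp, zero_comp]

lemma IsCpt.exists_isRep_retract {X : 𝒟} (hX : IsCpt X) : ∃ (B : 𝒟) (a b : ℤ)
    (_ : IsRep IsFgProj a b B) (i : X ⟶ B) (r : B ⟶ X), i ≫ r = 𝟙 X := by
  obtain ⟨B, ⟨a, b, hB⟩, i, r, h⟩ := (isTriClass_isRep isAddClass_isFgProj
    fun _ h => h.1).exists_retract ⟨0, 0, isRep_st isAddClass_isFgProj (isFgProj_ring (A := A))⟩ hX
  exact ⟨B, a, b, hB, i, r, h⟩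

lemma IsCpt.finite_top₀ {X : 𝒟} (hX : IsCpt X) {N : ModuleCat.{u} A} {Y : 𝒟} (hY : Y.IsLE (-1))
    {f : Y ⟶ X} {g : X ⟶ st N} {h : st N ⟶ Y⟦(1 : ℤ)⟧} (H : Triangle.mk f g h ∈ distTriang _) :
    Module.Finite A N := by
  obtain ⟨B, a, b, hB, i, r, hir⟩ := hX.exists_isRep_retract
  obtain ⟨N₀, hN₀, hr⟩ := hB.exists_fg_comp_eq_zero (r ≫ g)
  have hg : g ≫ (singleFunctor (ModuleCat.{u} A) 0).map (ModuleCat.ofHom N₀.mkQ) = 0 := by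
    rw [← Category.id_comp g, ← hir, Category.assoc, Category.assoc, ← Category.assoc r, hr,
      comp_zero]
  obtain ⟨ψ, hψ⟩ := exists_desc₃ H _ hg
  rw [hom_eq_zero (isLE_shift hY 1 (-2) (by lia)) (st_isGE _) (by lia) ψ, comp_zero,
    ← Functor.map_zero (singleFunctor (ModuleCat.{u} A) 0)] at hψ
  have h := congrArg ModuleCat.Hom.hom ((singleFunctor (ModuleCat.{u} A) 0).map_injective hψ)
  have : N₀ = ⊤ := by
    rw [← N₀.ker_mkQ]
    exact LinearMap.ker_eq_top.2 h
  exact ⟨this ▸ hN₀⟩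

lemma IsCpt.finite_top {X : 𝒟} (hX : IsCpt X) {b : ℤ} {N : ModuleCat.{u} A} {Y : 𝒟}
    (hY : Y.IsLE (b - 1)) {f : Y ⟶ X} {g : X ⟶ (st N)⟦-b⟧} {h : (st N)⟦-b⟧ ⟶ Y⟦(1 : ℤ)⟧}
    (H : Triangle.mk f g h ∈ distTriang _) : Module.Finite A N :=
  (hX.shift b).finite_top₀ (isLE_shift hY b (-1) (by lia))
    (distTriang_of_iso₃ (Triangle.shift_distinguished _ H b)
      ((shiftFunctorCompIsoId 𝒟 (-b) b (by lia)).app (st N)))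

lemma hasCovers_isCpt : HasCovers (IsCpt (A := A)) IsFgProj := by
  intro X b hX hb
  obtain ⟨N, Y, hY, f, g, h, H⟩ := exists_top hb
  have := hX.finite_top hY H
  obtain ⟨n, p, hp⟩ := Module.Finite.exists_fin' A N
  have hP : IsFgProj (ModuleCat.of A (Fin n → A)) :=
    ⟨(IsProjective.iff_projective (Fin n → A)).1 inferInstance,
      inferInstanceAs (Module.Finite A (Fin n → A))⟩
  have := hP.1
  have : Epi (ModuleCat.ofHom p : ModuleCat.of A (Fin n → A) ⟶ N) := by
    rwa [ModuleCat.epi_iff_surjective]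
  obtain ⟨Z, hZ, α, β, γ, H'⟩ := exists_cover hY H (ModuleCat.ofHom p) (pdLE_st_of_projective _)
  exact ⟨_, Z, α, β, γ, hP, isTriClass_isCpt.cone H'
    (isRep_stShift isAddClass_isFgProj hP b).isCpt hX, hZ, H'⟩

lemma IsCpt.exists_isLE {X : 𝒟} (hX : IsCpt X) : ∃ b, X.IsLE b := by
  obtain ⟨B, a, b, hB, i, r, h⟩ := hX.exists_isRep_retract
  exact ⟨b, isLE_of_retract hB.isLE i r h⟩

lemma IsCpt.exists_pdLE {X : 𝒟} (hX : IsCpt X) : ∃ n : ℕ, PdLE X n := by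
  obtain ⟨B, a, b, hB, i, r, h⟩ := hX.exists_isRep_retract
  exact ⟨(-a).toNat, ((hB.pdLE fun _ h => h.1).of_retract i r h).mono (by lia)⟩

lemma IsCpt.exists_isRep {X : 𝒟} (hX : IsCpt X) : ∃ a b, IsRep IsFgProj a b X := by
  obtain ⟨b, hb⟩ := hX.exists_isLE
  obtain ⟨n, hn⟩ := hX.exists_pdLE
  exact ⟨min b (-n), b, hasCovers_isCpt.isRep isAddClass_isFgProj (fun _ h => h.1) hX hb
    (hn.mono (by lia)) (by lia)⟩

end CompactCovers

section FinitisticDimension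

variable {A : Type u} [Ring A] [HasDerivedCategory.{w} (ModuleCat.{u} A)]

local notation "𝒟" => DerivedCategory (ModuleCat A)

open DerivedCategory

lemma exists_ker_triangle {P M : Type u} [AddCommGroup P] [Module A P] [AddCommGroup M]
    [Module A M] {f : P →ₗ[A] M} (hf : Function.Surjective f) :
    ∃ (i : st (ModuleCat.of A (LinearMap.ker f)) ⟶ st (ModuleCat.of A P)) (h : _),
      Triangle.mk i ((singleFunctor (ModuleCat.{u} A) 0).map (ModuleCat.ofHom f)) h ∈
        distTriang 𝒟 := by
  obtain ⟨h, H⟩ := exists_st_triangle _ (LinearMap.shortExact_shortComplexKer hf)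
  exact ⟨_, h, H⟩

lemma projective_iff_pdLE {M : Type u} [AddCommGroup M] [Module A M] :
    Module.Projective A M ↔ PdLE (st (ModuleCat.of A M)) 0 := by
  refine ⟨fun hM => have := (IsProjective.iff_projective M).1 hM
    pdLE_st_of_projective _, fun h => ?_⟩
  obtain ⟨i, k, H⟩ := exists_ker_triangle (Finsupp.linearCombination_id_surjective A M)
  have hk : k = 0 := h (isLE_shift (st_isLE _) 1 (-1) (by lia)) k
  obtain ⟨s, hs⟩ := exists_lift₃ H (𝟙 _) (by rw [hk, comp_zero])
  obtain ⟨s, rfl⟩ := (singleFunctor (ModuleCat.{u} A) 0).map_surjective s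
  have hs' := (singleFunctor (ModuleCat.{u} A) 0).map_injective
    (((CategoryTheory.Functor.map_id _ _).trans hs).trans (Functor.map_comp _ _ _).symm)
  exact Module.Projective.of_split s.hom _ (congrArg ModuleCat.Hom.hom hs').symm

lemma modPdLE_iff (n : ℕ) (M : Type u) [AddCommGroup M] [Module A M] :
    ModPdLE A n M ↔ PdLE (st (ModuleCat.of A M)) n := by
  induction n generalizing M with
  | zero => exact projective_iff_pdLE
  | succ n ih =>
    refine ⟨fun ⟨P, _, _, f, hP, hf, h⟩ => ?_, fun h => ?_⟩
    · obtain ⟨i, k, H⟩ := exists_ker_triangle hf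
      exact PdLE.cone H (((ih _).1 h).mono (by push_cast; lia))
        ((projective_iff_pdLE.1 hP).mono (by lia))
    · have hf := Finsupp.linearCombination_id_surjective A M
      obtain ⟨i, k, H⟩ := exists_ker_triangle hf
      exact ⟨_, _, _, _, inferInstance, hf, (ih _).2 (PdLE.fiber H
        ((projective_iff_pdLE.1 inferInstance).mono (by lia)) h)⟩

lemma isCpt_st {P : Type u} [AddCommGroup P] [Module A P] (hP : Module.Projective A P)
    (hP' : Module.Finite A P) : IsCpt (st (ModuleCat.of A P)) :=
  (isRep_st isAddClass_isFgProj ⟨(IsProjective.iff_projective P).1 hP, hP'⟩).isCpt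

lemma IsCpt.finite {M : Type u} [AddCommGroup M] [Module A M]
    (h : IsCpt (st (ModuleCat.of A M))) : Module.Finite A M := by
  obtain ⟨Z, hZ⟩ := HasZeroObject.zero (C := 𝒟)
  refine h.finite_top₀ (isLE_of_isZero hZ (-1)) (f := hZ.to_ _) (g := 𝟙 _) (h := 0)
    (isomorphic_distinguished _ (contractible_distinguished₁ _) _
      (Triangle.isoMk _ _ (hZ.iso (isZero_zero _)) (Iso.refl _) (Iso.refl _)
        (hZ.eq_of_src _ _) rfl ?_))
  exact ((shiftFunctor 𝒟 (1 : ℤ)).map_isZero (isZero_zero _)).eq_of_tgt _ _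

lemma exists_modFgPdLE_iff (M : Type u) [AddCommGroup M] [Module A M] :
    (∃ n, ModFgPdLE A n M) ↔ IsCpt (st (ModuleCat.of A M)) := by
  constructor
  · rintro ⟨n, h⟩
    induction n generalizing M with
    | zero => exact isCpt_st h.1 h.2
    | succ n ih =>
      obtain ⟨P, _, _, f, ⟨hP, hP'⟩, hf, h⟩ := h
      obtain ⟨i, k, H⟩ := exists_ker_triangle hf
      exact isTriClass_isCpt.cone H (ih _ h) (isCpt_st hP hP')
  · intro h
    obtain ⟨n, hn⟩ := h.exists_pdLE
    refine ⟨n, ?_⟩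
    induction n generalizing M with
    | zero => exact ⟨projective_iff_pdLE.2 hn, h.finite⟩
    | succ n ih =>
      have := h.finite
      obtain ⟨m, f, hf⟩ := Module.Finite.exists_fin' A M
      obtain ⟨i, k, H⟩ := exists_ker_triangle hf
      exact ⟨_, _, _, f, ⟨inferInstance, inferInstance⟩, hf, ih _
        (isTriClass_isCpt.fiber H (isCpt_st inferInstance inferInstance) h)
        (PdLE.fiber H ((projective_iff_pdLE.1 inferInstance).mono (by lia)) hn)⟩

/-- A class of bounded above objects, with enough projectives, in which finitistic dimensions can be
computed. -/
structure IsFinClass (Ψ : DerivedCategory (ModuleCat.{u} A) → Prop) : Prop extends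
    IsTriClass Ψ where
  covers : HasCovers Ψ fun P => Projective P
  exists_isLE : ∀ {X}, Ψ X → ∃ b, X.IsLE b

/-- The objects of finite projective dimension with bounded above cohomology. -/
def IsBig (X : DerivedCategory (ModuleCat.{u} A)) : Prop :=
  (∃ b, X.IsLE b) ∧ ∃ n : ℕ, PdLE X n

lemma isFinClass_isCpt : IsFinClass (IsCpt (A := A)) where
  toIsTriClass := isTriClass_isCpt
  covers X b hX hb := by
    obtain ⟨P, Z, α, β, γ, hP, h⟩ := hasCovers_isCpt X b hX hb
    exact ⟨P, Z, α, β, γ, hP.1, h⟩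
  exists_isLE h := h.exists_isLE

lemma isTriClass_isBig : IsTriClass (IsBig (A := A)) where
  zero X hX := ⟨⟨0, isLE_of_isZero hX 0⟩, 0, PdLE.of_isZero hX _⟩
  shift X a := fun ⟨⟨b, hb⟩, n, hn⟩ =>
    ⟨⟨b - a, isLE_shift hb _ _ (by lia)⟩, (n + a).toNat, (hn.shift a _ rfl).mono (by lia)⟩
  ext H := fun ⟨⟨b, hb⟩, n, hn⟩ ⟨⟨b', hb'⟩, n', hn'⟩ =>
    ⟨⟨max b b', isLE_ext H (isLE_mono hb (by lia)) (isLE_mono hb' (by lia))⟩, max n n',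
      PdLE.ext H (hn.mono (by lia)) (hn'.mono (by lia))⟩

lemma isFinClass_isBig : IsFinClass (IsBig (A := A)) where
  toIsTriClass := isTriClass_isBig
  covers X b hX hb := by
    obtain ⟨P, Z, α, β, γ, hP, -, hZ, H⟩ := hasCovers_true X b trivial hb
    refine ⟨P, Z, α, β, γ, hP, isTriClass_isBig.cone H ?_ hX, hZ, H⟩
    exact isTriClass_isBig.shift _ _ ⟨⟨0, st_isLE _⟩, 0, pdLE_st_of_projective _⟩
  exists_isLE h := h.1

lemma IsCpt.isBig {X : 𝒟} (h : IsCpt X) : IsBig X := ⟨h.exists_isLE, h.exists_pdLE⟩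

namespace IsFinClass

variable {Ψ : DerivedCategory (ModuleCat.{u} A) → Prop} (hΨ : IsFinClass Ψ)
include hΨ

lemma of_iso {X Y : 𝒟} (e : X ≅ Y) (h : Ψ X) : Ψ Y := by
  obtain ⟨Z, hZ⟩ := HasZeroObject.zero (C := 𝒟)
  have H : Triangle.mk e.hom (0 : Y ⟶ Z) 0 ∈ distTriang 𝒟 := by
    refine isomorphic_distinguished _ (contractible_distinguished X) _
      (Triangle.isoMk _ _ (Iso.refl _) e.symm (hZ.iso (isZero_zero _)) ?_ ?_ ?_)
    · exact e.hom_inv_id.trans (Category.comp_id _).symm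
    · exact (isZero_zero _).eq_of_tgt _ _
    · exact hZ.eq_of_src _ _
  exact hΨ.ext H h (hΨ.zero _ hZ)

/-- A uniform bound of the projective dimension of the modules in `Ψ` provides bounds of the
projective dimension of the bounded below complexes in `Ψ`. -/
lemma pdLE_of_isGE {f : ℕ} (hf : ∀ M : ModuleCat.{u} A, Ψ (st M) → PdLE (st M) f) {X : 𝒟} {c : ℤ}
    (hX : Ψ X) (hc : X.IsGE c) : PdLE X (f - c) := by
  obtain ⟨b, hb⟩ := hΨ.exists_isLE hX
  obtain ⟨n, hn⟩ : ∃ n : ℕ, b ≤ c + n := ⟨(b - c).toNat, by lia⟩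
  replace hb := isLE_mono hb hn
  clear hn
  induction n generalizing X with
  | zero =>
    obtain ⟨M, ⟨e⟩⟩ := exists_iso_stShift (isLE_mono hb (by simp)) hc
    have e' : X⟦c⟧ ≅ st M := (shiftFunctor 𝒟 c).mapIso e ≪≫
      (shiftFunctorCompIsoId 𝒟 (-c) c (by lia)).app (st M)
    exact ((hf M (hΨ.of_iso e' (hΨ.shift _ _ hX))).shift (-c) _ rfl).of_iso e
  | succ n ih =>
    obtain ⟨P, Z, α, β, γ, hP, hZ, hZ', H⟩ := hΨ.covers X _ hX hb
    refine PdLE.ext H (((pdLE_st_of_projective P).shift _ _ rfl).mono (by push_cast; lia))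
      (ih hZ (isGE_cone H (isGE_mono (stShift_isGE _ _) (by push_cast; lia)) hc)
        (isLE_mono hZ' (by push_cast; lia)))

end IsFinClass

end FinitisticDimension

section ExtendedReals

lemma en_le_en {m n : ℕ} : en m ≤ en n ↔ m ≤ n := by
  rw [en, en, EReal.coe_le_coe_iff, Nat.cast_le]

lemma en_add (m n : ℕ) : en (m + n) = en m + en n := by
  simp only [en, ← EReal.coe_add, Nat.cast_add]

lemma zero_le_en (n : ℕ) : 0 ≤ en n := by
  rw [en]
  exact_mod_cast n.cast_nonneg

variable {A : Type u} [Ring A]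

lemma modPd_nonneg {M : Type u} [AddCommGroup M] [Module A M] : 0 ≤ modPd A M := by
  refine le_sInf ?_
  rintro _ ⟨m, rfl, hm⟩
  exact zero_le_en m

variable [HasDerivedCategory.{w} (ModuleCat.{u} A)]

lemma modPd_le_iff {M : Type u} [AddCommGroup M] [Module A M] {n : ℕ} :
    modPd A M ≤ en n ↔ PdLE (st (ModuleCat.of A M)) n := by
  refine ⟨fun h => ?_, fun h => sInf_le ⟨n, rfl, (modPdLE_iff n M).2 h⟩⟩
  by_contra hn
  have : en (n + 1) ≤ modPd A M := by
    refine le_sInf ?_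
    rintro _ ⟨m, rfl, hm⟩
    rw [en_le_en]
    by_contra hm'
    exact hn (((modPdLE_iff m M).1 hm).mono (by lia))
  exact absurd (en_le_en.1 (this.trans h)) (by lia)

/-- The supremum of the projective dimensions of the modules in `Ψ`. -/
noncomputable def finDim (Ψ : DerivedCategory (ModuleCat.{u} A) → Prop) : EReal :=
  sSup {x : EReal | ∃ M : ModuleCat.{u} A, Ψ (st M) ∧ x = modPd A M}

lemma ringfd_eq : ringfd A = finDim (IsCpt (A := A)) := by
  refine congrArg sSup (Set.ext fun x => ⟨?_, ?_⟩)
  · rintro ⟨M, _, _, hM, rfl⟩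
    exact ⟨ModuleCat.of A M, (exists_modFgPdLE_iff M).1 hM, rfl⟩
  · rintro ⟨M, hM, rfl⟩
    exact ⟨M, _, _, (exists_modFgPdLE_iff M).2 hM, rfl⟩

lemma isBig_st {M : ModuleCat.{u} A} {n : ℕ} (h : PdLE (st M) n) : IsBig (st M) :=
  ⟨⟨0, st_isLE M⟩, n, h⟩

lemma ringFd_eq : ringFd A = finDim (IsBig (A := A)) := by
  refine congrArg sSup (Set.ext fun x => ⟨?_, ?_⟩)
  · rintro ⟨M, _, _, ⟨n, hM⟩, rfl⟩
    exact ⟨ModuleCat.of A M, isBig_st ((modPdLE_iff n M).1 hM), rfl⟩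
  · rintro ⟨M, ⟨-, n, hM⟩, rfl⟩
    exact ⟨M, _, _, ⟨n, (modPdLE_iff n M).2 hM⟩, rfl⟩

variable {Ψ : DerivedCategory (ModuleCat.{u} A) → Prop}

lemma finDim_le {n : ℕ} (h : ∀ M : ModuleCat.{u} A, Ψ (st M) → PdLE (st M) n) :
    finDim Ψ ≤ en n := by
  refine sSup_le ?_
  rintro _ ⟨M, hM, rfl⟩
  exact modPd_le_iff.2 (h M hM)

lemma modPd_le_finDim {M : ModuleCat.{u} A} (hM : Ψ (st M)) : modPd A M ≤ finDim Ψ :=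
  le_sSup ⟨M, hM, rfl⟩

lemma pdLE_of_finDim_le {n : ℕ} (h : finDim Ψ ≤ en n) {M : ModuleCat.{u} A} (hM : Ψ (st M)) :
    PdLE (st M) n :=
  modPd_le_iff.1 ((modPd_le_finDim hM).trans h)

namespace IsFinClass

variable (hΨ : IsFinClass Ψ)
include hΨ

lemma finDim_nonneg : 0 ≤ finDim Ψ := by
  obtain ⟨M, hM⟩ := HasZeroObject.zero (C := ModuleCat.{u} A)
  exact modPd_nonneg.trans (modPd_le_finDim (hΨ.zero _ (Functor.map_isZero _ hM)))

lemma finDim_eq : finDim Ψ = ⊤ ∨ ∃ n : ℕ, finDim Ψ = en n := by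
  classical
  by_cases h : ∃ n : ℕ, finDim Ψ ≤ en n
  · refine Or.inr ⟨_, le_antisymm (Nat.find_spec h) ?_⟩
    obtain h0 | ⟨k, hk⟩ : Nat.find h = 0 ∨ ∃ k, Nat.find h = k + 1 :=
      (Nat.eq_zero_or_eq_succ_pred _).imp_right fun h => ⟨_, h⟩
    · rw [h0]
      exact (by simp [en] : en 0 = 0).le.trans hΨ.finDim_nonneg
    · have := Nat.find_min h (m := k) (by lia)
      obtain ⟨M, hM, hk'⟩ : ∃ M : ModuleCat.{u} A, Ψ (st M) ∧ ¬ PdLE (st M) k := by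
        by_contra! hn
        exact this (finDim_le hn)
      rw [hk]
      refine le_trans ?_ (modPd_le_finDim hM)
      refine le_sInf ?_
      rintro _ ⟨m, rfl, hm⟩
      rw [en_le_en]
      by_contra hm'
      exact hk' (((modPdLE_iff m M).1 hm).mono (by lia))
  · left
    by_contra ht
    obtain ⟨x, hx⟩ : ∃ x : ℝ, finDim Ψ = x :=
      ⟨_, (EReal.coe_toReal ht fun hb => by simpa [hb] using hΨ.finDim_nonneg).symm⟩
    obtain ⟨n, hn⟩ := exists_nat_ge x
    exact h ⟨n, by rw [hx, en]; exact_mod_cast hn⟩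

/-- To bound a finitistic dimension by `finDim Ψ + en w`, one may assume that `finDim Ψ` is
a natural number. -/
lemma le_finDim_add {x : EReal} {w : ℕ} (h : ∀ f : ℕ,
    (∀ M : ModuleCat.{u} A, Ψ (st M) → PdLE (st M) f) → x ≤ en (f + w)) :
    x ≤ finDim Ψ + en w := by
  obtain h' | ⟨f, h'⟩ := hΨ.finDim_eq
  · rw [h', EReal.top_add_of_ne_bot (EReal.bot_lt_zero.trans_le (zero_le_en w)).ne']
    exact le_top
  · rw [h', ← en_add]
    exact h f fun M => pdLE_of_finDim_le h'.le

end IsFinClass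

lemma IsFinClass.le_finDim_add_finDim {B : Type u} [Ring B]
    [HasDerivedCategory.{w} (ModuleCat.{u} B)]
    {Ψ' : DerivedCategory (ModuleCat.{u} B) → Prop} (hΨ : IsFinClass Ψ) (hΨ' : IsFinClass Ψ')
    {x : EReal} {w₁ w₂ : ℕ} (h : ∀ f f' : ℕ,
      (∀ M : ModuleCat.{u} A, Ψ (st M) → PdLE (st M) f) →
      (∀ M : ModuleCat.{u} B, Ψ' (st M) → PdLE (st M) f') → x ≤ en (f + f' + w₁ + w₂ + 1)) :
    x ≤ finDim Ψ + finDim Ψ' + en w₁ + en w₂ + 1 := by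
  have h1 : (1 : EReal) = en 1 := by simp [en]
  have e : finDim Ψ + finDim Ψ' + en w₁ + en w₂ + 1 =
      finDim Ψ + (finDim Ψ' + en (w₁ + w₂ + 1)) := by
    rw [h1, en_add, en_add]
    ac_rfl
  rw [e]
  obtain h' | ⟨f, h'⟩ := hΨ.finDim_eq
  · rw [h', EReal.top_add_of_ne_bot]
    · exact le_top
    · exact (EReal.bot_lt_zero.trans_le
        (add_nonneg hΨ'.finDim_nonneg (zero_le_en _))).ne'
  · rw [h', ← add_assoc, add_comm (en f), add_assoc, ← en_add]
    refine hΨ'.le_finDim_add fun f' hf' => ?_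
    convert h f f' (fun M => pdLE_of_finDim_le h'.le) hf' using 2
    ring

end ExtendedReals

section Adjunctions

variable {A : Type u} [Ring A] [HasDerivedCategory.{w} (ModuleCat.{u} A)]
  {B : Type u} [Ring B] [HasDerivedCategory.{w} (ModuleCat.{u} B)]

lemma isGE_of_free {X : DerivedCategory (ModuleCat.{u} A)} (n : ℤ)
    (h : ∀ i, i < n → ∀ f : free A i ⟶ X, f = 0) : X.IsGE n := by
  obtain ⟨Y, Z, hY, hZ, f, g, k, H⟩ := exists_trunc X (n - 1)
  obtain ⟨l, g', H'⟩ := exists_invRotate H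
  have hY' : IsZero Y := isZero_of_free fun i v => by
    by_cases hi : i < n
    · obtain ⟨v, rfl⟩ := exists_lift₂ H' v (h i hi _)
      rw [hom_eq_zero (isRep_free i).isLE (isGE_shift hZ (-1) (n + 1) (by lia)) (by lia) v,
        zero_comp]
    · exact (isRep_free i).pdLE (fun _ h => h.1) (isLE_mono hY (by lia)) v
  exact isGE_ext H (isGE_of_isZero hY' n) (isGE_mono hZ (by lia))

lemma eq_zero_of_adj {𝒞 ℰ : Type*} [Category 𝒞] [Category ℰ] [Preadditive 𝒞] [Preadditive ℰ]
    {L : 𝒞 ⥤ ℰ} {G : ℰ ⥤ 𝒞} (adj : L ⊣ G) {X : 𝒞} {Y : ℰ} (h : ∀ f : L.obj X ⟶ Y, f = 0)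
    (g : X ⟶ G.obj Y) : g = 0 :=
  (adj.homEquiv _ _).symm.injective ((h _).trans (h _).symm)

lemma eq_zero_of_adj' {𝒞 ℰ : Type*} [Category 𝒞] [Category ℰ] [Preadditive 𝒞] [Preadditive ℰ]
    {L : 𝒞 ⥤ ℰ} {G : ℰ ⥤ 𝒞} (adj : L ⊣ G) {X : 𝒞} {Y : ℰ} (h : ∀ g : X ⟶ G.obj Y, g = 0)
    (f : L.obj X ⟶ Y) : f = 0 :=
  (adj.homEquiv _ _).injective ((h _).trans (h _).symm)

variable {L : DerivedCategory (ModuleCat.{u} A) ⥤ DerivedCategory (ModuleCat.{u} B)}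
  {G : DerivedCategory (ModuleCat.{u} B) ⥤ DerivedCategory (ModuleCat.{u} A)}
  (adj : L ⊣ G)

section

variable [L.CommShift ℤ]
include adj

lemma isLE_right {n : ℤ} (hL : PdLE (L.obj (st (ModuleCat.of A A))) n)
    {Y : DerivedCategory (ModuleCat.{u} B)} {m : ℤ} (hY : Y.IsLE m) : (G.obj Y).IsLE (m + n) :=
  isLE_of_free _ fun i _ => eq_zero_of_adj adj fun f =>
    (hL.shift (-i) (n - i) (by lia)).of_iso ((L.commShiftIso (-i)).app _)
      (isLE_mono hY (by lia)) f

lemma pdLE_left {n : ℤ} (hL : PdLE (L.obj (st (ModuleCat.of A A))) n)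
    {X : DerivedCategory (ModuleCat.{u} A)} {p : ℤ} (hX : PdLE X p) : PdLE (L.obj X) (p + n) :=
  fun _ hY => eq_zero_of_adj' adj fun g => hX (isLE_mono (isLE_right adj hL hY) (by lia)) g

lemma isGE_right {b : ℤ} (hL : (L.obj (st (ModuleCat.of A A))).IsLE b)
    {Y : DerivedCategory (ModuleCat.{u} B)} {m : ℤ} (hY : Y.IsGE m) : (G.obj Y).IsGE (m - b) :=
  isGE_of_free _ fun i hi => eq_zero_of_adj adj fun f => by
    rw [← cancel_epi ((L.commShiftIso (-i)).inv.app _), comp_zero]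
    exact hom_eq_zero (isLE_shift hL (-i) (b + i) (by lia)) hY (by lia) _

lemma isLE_left {b : ℤ} (hL : (L.obj (st (ModuleCat.of A A))).IsLE b)
    {X : DerivedCategory (ModuleCat.{u} A)} {m : ℤ} (hX : X.IsLE m) : (L.obj X).IsLE (m + b) :=
  isLE_of_hom_zero _ fun _ hY => eq_zero_of_adj' adj fun g =>
    hom_eq_zero hX (isGE_right adj hL hY) (by lia) g

lemma IsBig.map (hL : IsBig (L.obj (st (ModuleCat.of A A))))
    {X : DerivedCategory (ModuleCat.{u} A)} (hX : IsBig X) : IsBig (L.obj X) := by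
  obtain ⟨⟨b, hb⟩, n, hn⟩ := hL
  obtain ⟨⟨m, hm⟩, p, hp⟩ := hX
  exact ⟨⟨_, isLE_left adj hb hm⟩, p + n, by simpa using pdLE_left adj hn hp⟩

lemma IsBig.of_map [L.Full] [L.Faithful] (hL : IsBig (L.obj (st (ModuleCat.of A A))))
    {Y : DerivedCategory (ModuleCat.{u} B)} (hY : ∃ m, Y.IsLE m)
    (hY' : IsBig (L.obj (G.obj Y))) : IsBig (G.obj Y) := by
  obtain ⟨⟨b, hb⟩, n, hn⟩ := hL
  obtain ⟨m, hm⟩ := hY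
  obtain ⟨-, p, hp⟩ := hY'
  refine ⟨⟨_, isLE_right adj hn hm⟩, (p + b).toNat, fun Z hZ f => L.map_injective ?_⟩
  exact (hp (isLE_mono (isLE_left adj hb hZ) (by lia)) _).trans
    (hp (isLE_mono (isLE_left adj hb hZ) (by lia)) _).symm

end

lemma IsCpt.map_of_ring [L.CommShift ℤ] [L.IsTriangulated]
    (hL : IsCpt (L.obj (st (ModuleCat.of A A))))
    {X : DerivedCategory (ModuleCat.{u} A)} (hX : IsCpt X) : IsCpt (L.obj X) := by
  have : IsTriClass fun X => IsCpt (L.obj X) :=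
    { zero := fun X hX => IsCpt.of_isZero (L.map_isZero hX)
      shift := fun X a h => (h.shift a).of_retract _ _ ((L.commShiftIso a).app X).hom_inv_id
      ext := fun H => IsCpt.ext (L.map_distinguished _ H) }
  obtain ⟨Y, hY, i, r, h⟩ := this.exists_retract hL hX
  exact hY.of_retract (L.map i) (L.map r) (by rw [← L.map_comp, h, L.map_id])

/-- Finitistic dimensions along a fully faithful functor with a left adjoint. -/
lemma pdLE_of_fullyFaithful_right (adj : L ⊣ G) [L.CommShift ℤ] [G.Full] [G.Faithful]
    {Ψ : DerivedCategory (ModuleCat.{u} A) → Prop} (hΨ : IsFinClass Ψ) {f : ℕ}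
    (hf : ∀ M : ModuleCat.{u} A, Ψ (st M) → PdLE (st M) f) {a b : ℤ}
    (hL : IsRep (fun P => Projective P) a b (L.obj (st (ModuleCat.of A A))))
    {M : ModuleCat.{u} B} (hM : Ψ (G.obj (st M))) : PdLE (st M) (f + (b - a)) := by
  have h := pdLE_left adj (hL.pdLE fun _ h => h)
    (hΨ.pdLE_of_isGE hf hM (isGE_right adj hL.isLE (st_isGE M)))
  exact (h.mono (by lia)).of_iso (asIso (adj.counit.app (st M))).symm

end Adjunctions

section Recollements

variable {A : Type u} [Ring A] [HasDerivedCategory.{w} (ModuleCat.{u} A)]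
  {B : Type u} [Ring B] [HasDerivedCategory.{w} (ModuleCat.{u} B)]
  {B' : Type u} [Ring B'] [HasDerivedCategory.{w} (ModuleCat.{u} B')]

lemma exists_complexWidthFg {X : DerivedCategory (ModuleCat.{u} A)} (h : IsCpt X) :
    ∃ a b : ℤ, b - a = complexWidthFg A X ∧ IsRep IsFgProj a b X := by
  obtain ⟨a, b, h⟩ := h.exists_isRep
  obtain ⟨K, h₁, h₂, h₃⟩ := h.mono le_rfl (le_max_right a b)
  obtain ⟨a, b, K, hab, hK, e⟩ := Nat.sInf_mem (⟨(max a b - a).toNat, a, max a b, K, by lia,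
    ⟨h₁, h₂⟩, h₃⟩ : {d : ℕ | ∃ (a b : ℤ) (Q : CochainComplex (ModuleCat.{u} A) ℤ),
      b - a = (d : ℤ) ∧ IsFgProjComplexIn A Q a b ∧
      Nonempty (DerivedCategory.Q.obj Q ≅ X)}.Nonempty)
  exact ⟨a, b, hab, K, hK.1, hK.2, e⟩

lemma exists_complexWidth {X : DerivedCategory (ModuleCat.{u} A)} {a b : ℤ}
    (h : IsRep (fun P => Projective P) a b X) :
    ∃ a b : ℤ, b - a = complexWidth A X ∧ IsRep (fun P => Projective P) a b X := by
  obtain ⟨K, h₁, h₂, h₃⟩ := h.mono le_rfl (le_max_right a b)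
  obtain ⟨a, b, K, hab, hK, e⟩ := Nat.sInf_mem (⟨(max a b - a).toNat, a, max a b, K, by lia,
    ⟨h₁, h₂⟩, h₃⟩ : {d : ℕ | ∃ (a b : ℤ) (Q : CochainComplex (ModuleCat.{u} A) ℤ),
      b - a = (d : ℤ) ∧ IsProjComplexIn A Q a b ∧
      Nonempty (DerivedCategory.Q.obj Q ≅ X)}.Nonempty)
  exact ⟨a, b, hab, K, hK.1, hK.2, e⟩

lemma IsRep.projective {X : DerivedCategory (ModuleCat.{u} A)} {a b : ℤ}
    (h : IsRep IsFgProj a b X) : IsRep (fun P => Projective P) a b X := by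
  obtain ⟨K, hK, h⟩ := h
  exact ⟨K, fun i => (hK i).1, h⟩

lemma IsRep.isBig {X : DerivedCategory (ModuleCat.{u} A)} {a b : ℤ}
    (h : IsRep (fun P => Projective P) a b X) : IsBig X :=
  ⟨⟨b, h.isLE⟩, (-a).toNat, (h.pdLE fun _ h => h).mono (by lia)⟩

lemma isCpt_ring : IsCpt (st (ModuleCat.of A A)) :=
  isCpt_st inferInstance inferInstance

/-- Projective dimensions in the middle term of a recollement. -/
lemma pdLE_of_recollement
    {iStar : DerivedCategory (ModuleCat.{u} B) ⥤ DerivedCategory (ModuleCat.{u} A)}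
    {iLower : DerivedCategory (ModuleCat.{u} A) ⥤ DerivedCategory (ModuleCat.{u} B)}
    {iShriek : DerivedCategory (ModuleCat.{u} B) ⥤ DerivedCategory (ModuleCat.{u} A)}
    {jLower : DerivedCategory (ModuleCat.{u} B') ⥤ DerivedCategory (ModuleCat.{u} B)}
    {jStar : DerivedCategory (ModuleCat.{u} B) ⥤ DerivedCategory (ModuleCat.{u} B')}
    [iLower.CommShift ℤ] [jLower.CommShift ℤ] [iLower.Full] [iLower.Faithful]
    (adjI : iLower ⊣ iShriek) (adjJ : jLower ⊣ jStar)
    {Ψ : DerivedCategory (ModuleCat.{u} A) → Prop} (hΨ : IsFinClass Ψ)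
    {Ψ' : DerivedCategory (ModuleCat.{u} B') → Prop} (hΨ' : IsFinClass Ψ') {f f' : ℕ}
    (hf : ∀ M : ModuleCat.{u} A, Ψ (st M) → PdLE (st M) f)
    (hf' : ∀ M : ModuleCat.{u} B', Ψ' (st M) → PdLE (st M) f') {a b a' b' : ℤ}
    (hab : a ≤ b) (hab' : a' ≤ b')
    (hi : IsRep (fun P => Projective P) a b (iLower.obj (st (ModuleCat.of A A))))
    (hj : IsRep (fun P => Projective P) a' b' (jLower.obj (st (ModuleCat.of B' B'))))
    {M : DerivedCategory (ModuleCat.{u} B)} (hM : M.IsGE 0)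
    {f₁ : jLower.obj (jStar.obj M) ⟶ M} {f₂ : M ⟶ iLower.obj (iStar.obj M)}
    {f₃ : iLower.obj (iStar.obj M) ⟶ (jLower.obj (jStar.obj M))⟦(1 : ℤ)⟧}
    (H : Triangle.mk f₁ f₂ f₃ ∈ distTriang _)
    (hMj : Ψ' (jStar.obj M)) (hMi : Ψ (iStar.obj M)) :
    PdLE M (f + f' + (b - a) + (b' - a') + 1) := by
  have hP := hΨ'.pdLE_of_isGE hf' hMj (isGE_right adjJ hj.isLE hM)
  have hPj := pdLE_left adjJ (hj.pdLE fun _ h => h) hP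
  obtain ⟨m, hm⟩ := hΨ'.exists_isLE hMj
  have hGE := isGE_of_pdLE (isLE_left adjJ hj.isLE hm) hPj
  have hGE' : (iLower.obj (iStar.obj M)).IsGE (-(f' + b' - a') - 1) :=
    isGE_cone H (isGE_mono hGE (by lia)) (isGE_mono hM (by lia))
  have e : iStar.obj M ≅ iShriek.obj (iLower.obj (iStar.obj M)) :=
    asIso (adjI.unit.app (iStar.obj M))
  have hGE'' := isGE_of_retract (isGE_right adjI hi.isLE hGE') e.hom e.inv e.hom_inv_id
  have hQ := pdLE_left adjI (hi.pdLE fun _ h => h) (hΨ.pdLE_of_isGE hf hMi hGE'')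
  exact PdLE.ext H (hPj.mono (by lia)) (hQ.mono (by lia))

variable {iStar : DerivedCategory (ModuleCat.{u} B) ⥤ DerivedCategory (ModuleCat.{u} A)}
  {iLower : DerivedCategory (ModuleCat.{u} A) ⥤ DerivedCategory (ModuleCat.{u} B)}
  {iShriek : DerivedCategory (ModuleCat.{u} B) ⥤ DerivedCategory (ModuleCat.{u} A)}
  [iStar.CommShift ℤ] [iStar.IsTriangulated] [iLower.CommShift ℤ]
  [iLower.Full] [iLower.Faithful] (adjI : iStar ⊣ iLower) (adjI' : iLower ⊣ iShriek)
include adjI adjI'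

lemma ringfd_left_le [iLower.IsTriangulated] (hi : IsCpt (iLower.obj (ringObj A))) :
    ringfd A ≤ ringfd B + en (complexWidthFg A (iStar.obj (ringObj B))) := by
  obtain ⟨a, b, hw, h⟩ := exists_complexWidthFg (isCpt_ring.map adjI adjI')
  rw [ringfd_eq, ringfd_eq]
  refine isFinClass_isCpt.le_finDim_add fun f hf => finDim_le fun M hM => ?_
  exact (pdLE_of_fullyFaithful_right adjI isFinClass_isCpt hf h.projective
    (IsCpt.map_of_ring hi hM)).mono (by rw [hw]; rfl)

lemma ringFd_left_le (hi : IsBig (iLower.obj (ringObj A))) :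
    ringFd A ≤ ringFd B + en (complexWidth A (iStar.obj (ringObj B))) := by
  obtain ⟨_, _, h⟩ := (isCpt_ring.map adjI adjI').exists_isRep
  obtain ⟨a, b, hw, h⟩ := exists_complexWidth h.projective
  rw [ringFd_eq, ringFd_eq]
  refine isFinClass_isBig.le_finDim_add fun f hf => finDim_le fun M hM => ?_
  exact (pdLE_of_fullyFaithful_right adjI isFinClass_isBig hf h
    (IsBig.map adjI' hi hM)).mono (by rw [hw]; rfl)

variable {jLower : DerivedCategory (ModuleCat.{u} B') ⥤ DerivedCategory (ModuleCat.{u} B)}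
  {jStar : DerivedCategory (ModuleCat.{u} B) ⥤ DerivedCategory (ModuleCat.{u} B')}
  {jUpper : DerivedCategory (ModuleCat.{u} B') ⥤ DerivedCategory (ModuleCat.{u} B)}
  [jLower.CommShift ℤ] [jLower.IsTriangulated] [jLower.Full] [jLower.Faithful]
  (adjJ : jLower ⊣ jStar) (adjJ' : jStar ⊣ jUpper)
  (H : ∀ Y : DerivedCategory (ModuleCat.{u} B),
    ∃ h : iLower.obj (iStar.obj Y) ⟶ (jLower.obj (jStar.obj Y))⟦(1 : ℤ)⟧,
      Triangle.mk (adjJ.counit.app Y) (adjI.unit.app Y) h ∈ distTriang _)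
include adjJ' H

lemma ringfd_middle_le [iLower.IsTriangulated] (hi : IsCpt (iLower.obj (ringObj A))) :
    ringfd B ≤ ringfd A + ringfd B' + en (complexWidthFg B (iLower.obj (ringObj A))) +
      en (complexWidthFg B (jLower.obj (ringObj B'))) + 1 := by
  obtain ⟨a, b, hw, h⟩ := exists_complexWidthFg hi
  obtain ⟨a', b', hw', h'⟩ := exists_complexWidthFg (isCpt_ring.map adjJ adjJ')
  rw [ringfd_eq, ringfd_eq, ringfd_eq]
  refine isFinClass_isCpt.le_finDim_add_finDim isFinClass_isCpt fun f f' hf hf' =>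
    finDim_le fun M hM => ?_
  obtain ⟨k, H⟩ := H (st M)
  have hMi : IsCpt (iStar.obj (st M)) := hM.map adjI adjI'
  have hMj : IsCpt (jLower.obj (jStar.obj (st M))) :=
    isTriClass_isCpt.fiber H hM (IsCpt.map_of_ring hi hMi)
  refine (pdLE_of_recollement adjI' adjJ isFinClass_isCpt isFinClass_isCpt hf hf' (by lia) (by lia)
    h.projective h'.projective (st_isGE M) H (hMj.of_map adjJ) hMi).mono ?_
  rw [hw, hw']
  rfl

lemma ringFd_middle_le {a b : ℤ}
    (hi : IsRep (fun P => Projective P) a b (iLower.obj (ringObj A))) :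
    ringFd B ≤ ringFd A + ringFd B' + en (complexWidth B (iLower.obj (ringObj A))) +
      en (complexWidth B (jLower.obj (ringObj B'))) + 1 := by
  obtain ⟨a, b, hw, h⟩ := exists_complexWidth hi
  have hj := isCpt_ring.map adjJ adjJ'
  obtain ⟨_, _, h'⟩ := hj.exists_isRep
  obtain ⟨a', b', hw', h'⟩ := exists_complexWidth h'.projective
  rw [ringFd_eq, ringFd_eq, ringFd_eq]
  refine isFinClass_isBig.le_finDim_add_finDim isFinClass_isBig fun f f' hf hf' =>
    finDim_le fun M hM => ?_
  obtain ⟨k, H⟩ := H (st M)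
  have hMi : IsBig (iStar.obj (st M)) := IsBig.map adjI (isCpt_ring.map adjI adjI').isBig hM
  have hMj : IsBig (jLower.obj (jStar.obj (st M))) :=
    isFinClass_isBig.fiber H hM (IsBig.map adjI' hi.isBig hMi)
  refine (pdLE_of_recollement adjI' adjJ isFinClass_isBig isFinClass_isBig hf hf' (by lia) (by lia)
    h h' (st_isGE M) H (IsBig.of_map adjJ hj.isBig ⟨0, st_isLE M⟩ hMj) hMi).mono ?_
  rw [hw, hw']
  rfl

end Recollements

section Injectives

variable {C : Type u} [Category.{v} C] [Abelian C] [HasDerivedCategory.{w} C]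

local notation "𝒟" => DerivedCategory C

lemma isRep_stShift_injective (I : C) [h : Injective I] (b : ℤ) :
    IsRep (fun P => Injective P) b b ((st I)⟦-b⟧) :=
  isRep_stShift isAddClass_injective h b

lemma hom_stShift_injective_eq_zero (I : C) [Injective I] {b n : ℤ} {Y : 𝒟} (hY : Y.IsGE n)
    (h : b < n) (f : Y ⟶ (st I)⟦-b⟧) : f = 0 :=
  (isRep_stShift_injective I b).hom_eq_zero (fun _ h => h) (isGE_mono hY (by lia)) f

/-- Embedding the bottom cohomology into an injective. -/
lemma exists_cocover {X : 𝒟} {b : ℤ} {N I : C} {B : 𝒟} (hB : B.IsGE (b + 1))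
    {f : (st N)⟦-b⟧ ⟶ X} {g : X ⟶ B} {h : B ⟶ (st N)⟦-b⟧⟦(1 : ℤ)⟧}
    (H : Triangle.mk f g h ∈ distTriang 𝒟) (i : N ⟶ I) [Mono i] [Injective I] :
    ∃ (Z : 𝒟) (_ : Z.IsGE (b + 1)) (α : Z ⟶ X) (β : X ⟶ (st I)⟦-b⟧)
      (γ : (st I)⟦-b⟧ ⟶ Z⟦(1 : ℤ)⟧), Triangle.mk α β γ ∈ distTriang 𝒟 := by
  obtain ⟨k', g', H'⟩ := exists_invRotate H
  obtain ⟨β, hβ⟩ := exists_desc₂ H' (((DerivedCategory.singleFunctor C 0).map i)⟦-b⟧')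
    (hom_stShift_injective_eq_zero I (isGE_shift hB (-1) (b + 2) (by lia)) (by lia) _)
  obtain ⟨Z, α, γ, K⟩ := distinguished_cocone_triangle₁ β
  refine ⟨Z, isGE_of_hom_zero _ fun Y hY φ => ?_, α, β, γ, K⟩
  have hφα : φ ≫ α = 0 := by
    obtain ⟨χ, hχ⟩ := exists_lift₂ H (φ ≫ α) (hom_eq_zero hY hB (by lia) _)
    obtain ⟨k, T⟩ := exists_stShift_triangle _
      (ShortComplex.ShortExact.mk' (ShortComplex.exact_cokernel i) ‹_› inferInstance) b
    obtain ⟨_, _, T'⟩ := exists_invRotate T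
    obtain ⟨ψ, rfl⟩ := exists_lift₂ T' χ (by
      rw [Linear.comp_units_smul]
      change _ • (χ ≫ ((DerivedCategory.singleFunctor C 0).map i)⟦-b⟧') = 0
      rw [hβ, ← Category.assoc, ← hχ, Category.assoc, distTriang_comp₁₂ K, comp_zero, smul_zero])
    rw [hχ, hom_eq_zero hY (isGE_shift (stShift_isGE _ b) (-1) (b + 1) (by lia)) (by lia) ψ,
      zero_comp, zero_comp]
  obtain ⟨_, _, K'⟩ := exists_invRotate K
  obtain ⟨ψ, rfl⟩ := exists_lift₂ K' φ hφα
  rw [hom_eq_zero hY (isGE_shift (stShift_isGE _ b) (-1) (b + 1) (by lia)) (by lia) ψ, zero_comp]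

lemma injective_of_hom_eq_zero [EnoughInjectives C] {M : C} {b : ℤ}
    (h : ∀ (N : C) (f : (st N)⟦-(b + 1)⟧ ⟶ (st M)⟦-b⟧), f = 0) : Injective M := by
  obtain ⟨k, T⟩ := exists_stShift_triangle _ (ShortComplex.ShortExact.mk'
    (ShortComplex.exact_cokernel (Injective.ι M)) inferInstance inferInstance) b
  obtain ⟨l, k', T'⟩ := exists_invRotate T
  have hk : l = 0 := by
    rw [← cancel_epi ((shiftFunctorAdd' 𝒟 (-b) (-1) (-(b + 1)) (by lia)).hom.app _), comp_zero]
    exact h _ _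
  obtain ⟨ρ, hρ⟩ := exists_desc₂ T' (𝟙 _) (by rw [hk, zero_comp])
  let F := DerivedCategory.singleFunctor C 0 ⋙ shiftFunctor 𝒟 (-b)
  obtain ⟨r, hr⟩ := F.map_surjective ((-b).negOnePow • ρ)
  refine isAddClass_injective.retract (Injective.ι M) r (F.map_injective ?_) inferInstance
  rw [F.map_comp, hr, F.map_id, Linear.comp_units_smul]
  exact (Linear.units_smul_comp _ _ _).symm.trans hρ.symm

/-- A bounded below complex is represented by a complex of injectives in degrees `[β, α]` when
there are no nonzero morphisms to it from the shifts `N[-n]`, for `α < n`. -/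
lemma isRep_injective [EnoughInjectives C] {X : 𝒟} {β α : ℤ} (hβ : X.IsGE β) (hα : X.IsLE α)
    (h : ∀ (N : C) (n : ℤ), α < n → ∀ f : (st N)⟦-n⟧ ⟶ X, f = 0) (hβα : β ≤ α) :
    IsRep (fun P => Injective P) β α X := by
  obtain ⟨n, rfl⟩ : ∃ n : ℕ, β = α - n := ⟨(α - β).toNat, by lia⟩
  clear hβα
  induction n generalizing X with
  | zero =>
    obtain ⟨M, ⟨e⟩⟩ := exists_iso_stShift hα (isGE_mono (m := α) hβ (by simp))
    have : Injective M := injective_of_hom_eq_zero (b := α) fun N f => by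
      rw [← cancel_mono e.inv, zero_comp]
      exact h N _ (by lia) _
    exact ((isRep_stShift_injective M α).of_iso e.symm).mono (by lia) le_rfl
  | succ n ih =>
    obtain ⟨N, B, hB, f, g, k, H⟩ := exists_bot hβ
    obtain ⟨Z, hZ, a, b, c, K⟩ := exists_cocover hB H (Injective.ι N)
    obtain ⟨k', _, K'⟩ := exists_invRotate K
    have hI := (isRep_stShift_injective (Injective.under N) (α - (n + 1 : ℕ))).shift (-1)
      (α - n) (α - n) (by push_cast; lia) (by push_cast; lia)
    have : IsRep (fun P => Injective P) (α - n) α Z := by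
      refine ih (isLE_ext K' (isLE_mono hI.isLE (by lia)) hα) (fun N m hm φ => ?_)
        (isGE_mono hZ (by push_cast; lia))
      obtain ⟨ψ, rfl⟩ := exists_lift₂ K' φ (h N m hm _)
      rw [hI.hom_eq_zero (fun _ h => h) (isGE_mono (stShift_isGE N m) (by lia)) ψ, zero_comp]
    exact IsRep.ext isAddClass_injective (Or.inr fun _ h => h) K
      (this.mono (by push_cast; lia) le_rfl)
      ((isRep_stShift_injective _ _).mono le_rfl (by push_cast; lia))

/-- Every nonzero object has a nonzero morphism to `I`. -/
def IsCogen (I : C) : Prop := ∀ N : C, (∀ f : N ⟶ I, f = 0) → IsZero N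

variable {I : C} (hI : IsCogen I)
include hI

lemma isZero_of_isCogen {N : C} {b : ℤ} (h : ∀ f : (st N)⟦-b⟧ ⟶ (st I)⟦-b⟧, f = 0) :
    IsZero ((st N)⟦-b⟧) :=
  let F := DerivedCategory.singleFunctor C 0 ⋙ shiftFunctor 𝒟 (-b)
  F.map_isZero (hI N fun f => F.map_injective ((h (F.map f)).trans (F.map_zero _ _).symm))

lemma isLE_of_isCogen {X : 𝒟} {p : ℤ} (hX : ∃ b, X.IsLE b)
    (h : ∀ i, p < i → ∀ f : X ⟶ (st I)⟦-i⟧, f = 0) : X.IsLE p := by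
  obtain ⟨b, hb⟩ := hX
  obtain ⟨n, hn⟩ : ∃ n : ℕ, b ≤ p + n := ⟨(b - p).toNat, by lia⟩
  replace hb := isLE_mono hb hn
  clear hn
  induction n with
  | zero => exact isLE_mono hb (by simp)
  | succ n ih =>
    refine ih ?_
    obtain ⟨N, B, hB, f, g, k, H⟩ := exists_top hb
    have hN : IsZero ((st N)⟦-(p + (n + 1 : ℕ))⟧) := isZero_of_isCogen hI fun φ => by
      obtain ⟨ψ, rfl⟩ := exists_desc₃ H φ (h _ (by push_cast; lia) _)
      rw [hom_eq_zero (isLE_shift hB 1 _ (add_sub_cancel _ _)) (stShift_isGE I _) (by lia) ψ,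
        comp_zero]
    exact isLE_ext H (isLE_mono hB (by push_cast; lia)) (isLE_of_isZero hN _)

lemma isGE_of_isCogen [Injective I] {X : 𝒟} {p : ℤ} (hX : ∃ a, X.IsGE a)
    (h : ∀ i, i < p → ∀ f : X ⟶ (st I)⟦-i⟧, f = 0) : X.IsGE p := by
  obtain ⟨a, ha⟩ := hX
  obtain ⟨n, hn⟩ : ∃ n : ℕ, p - n ≤ a := ⟨(p - a).toNat, by lia⟩
  replace ha := isGE_mono ha hn
  clear hn
  induction n with
  | zero => exact isGE_mono ha (by simp)
  | succ n ih =>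
    refine ih ?_
    obtain ⟨N, B, hB, f, g, k, H⟩ := exists_bot ha
    obtain ⟨l, _, H'⟩ := exists_invRotate H
    have hN : IsZero ((st N)⟦-(p - (n + 1 : ℕ))⟧) := isZero_of_isCogen hI fun φ => by
      obtain ⟨ψ, rfl⟩ := exists_desc₂ H' φ (hom_stShift_injective_eq_zero I
        (isGE_shift hB (-1) _ (neg_add_cancel_left _ _)) (by lia) _)
      rw [h _ (by push_cast; lia) ψ, comp_zero]
    exact isGE_ext H (isGE_of_isZero hN _) (isGE_mono hB (by push_cast; lia))

end Injectives

section CharacterModules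

variable {A : Type u} [Ring A]

/-- The linear map to the character module of the ring induced by a character. -/
def toDual {N : Type u} [AddCommGroup N] [Module A N] (c : N →+ AddCircle (1 : ℚ)) :
    N →ₗ[A] A →+ AddCircle (1 : ℚ) where
  toFun y := c.comp (AddMonoidHom.mk' (fun s => s • y) fun s t => add_smul s t y)
  map_add' x y := by
    ext s
    exact (congrArg c (smul_add s x y)).trans (map_add c _ _)
  map_smul' r y := by
    ext s
    exact congrArg c (mul_smul s r y).symm

variable (A)

instance injective_dual : Injective (ModuleCat.of A (A →+ AddCircle (1 : ℚ))) where
  factors {X Y} g i hi := by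
    obtain ⟨c, hc⟩ := CharacterModule.dual_surjective_of_injective
      (i.hom.toAddMonoidHom.toIntLinearMap) ((ModuleCat.mono_iff_injective i).1 hi)
      ((AddMonoidHom.eval (1 : A)).comp g.hom.toAddMonoidHom)
    refine ⟨ModuleCat.ofHom (toDual c), ?_⟩
    ext x s
    have h : c (i.hom (s • x)) = g.hom (s • x) 1 := DFunLike.congr_fun hc (s • x)
    rw [i.hom.map_smul, g.hom.map_smul] at h
    refine h.trans ?_
    change g.hom x (1 * s) = _
    rw [one_mul]

lemma isCogen_dual : IsCogen (ModuleCat.of A (A →+ AddCircle (1 : ℚ))) := by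
  intro N h
  rw [ModuleCat.isZero_iff_subsingleton]
  refine subsingleton_of_forall_eq 0 fun x => CharacterModule.eq_zero_of_character_apply fun c => ?_
  have h' : toDual (A := A) c = 0 := congrArg ModuleCat.Hom.hom (h (ModuleCat.ofHom (toDual c)))
  have : c ((1 : A) • x) = 0 := DFunLike.congr_fun (LinearMap.congr_fun h' x) 1
  rwa [one_smul] at this

end CharacterModules

section BoundedDerivedCategories

variable {A : Type u} [Ring A] [HasDerivedCategory.{w} (ModuleCat.{u} A)]
  {B : Type u} [Ring B] [HasDerivedCategory.{w} (ModuleCat.{u} B)]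

lemma isBoundedComplex_iff {X : DerivedCategory (ModuleCat.{u} A)} :
    IsBoundedComplex A X ↔ (∃ a, X.IsGE a) ∧ ∃ b, X.IsLE b := by
  simp only [IsBoundedComplex, DerivedCategory.isGE_iff, DerivedCategory.isLE_iff]
  exact ⟨fun ⟨a, b, h⟩ => ⟨⟨a, fun i hi => h i (Or.inl hi)⟩, b, fun i hi => h i (Or.inr hi)⟩,
    fun ⟨⟨a, ha⟩, b, hb⟩ => ⟨a, b, fun i hi => hi.elim (ha i) (hb i)⟩⟩

lemma exists_complexCowidth {X : DerivedCategory (ModuleCat.{u} A)} {β α : ℤ}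
    (h : IsRep (fun P => Injective P) β α X) :
    ∃ β α : ℤ, α - β = complexCowidth A X ∧ IsRep (fun P => Injective P) β α X := by
  obtain ⟨K, h₁, h₂, h₃⟩ := h.mono le_rfl (le_max_right β α)
  obtain ⟨β, α, K, hβα, hK, e⟩ := Nat.sInf_mem (⟨(max β α - β).toNat, β, max β α, K, by lia,
    ⟨h₁, h₂⟩, h₃⟩ : {d : ℕ | ∃ (β α : ℤ) (Q : CochainComplex (ModuleCat.{u} A) ℤ),
      α - β = (d : ℤ) ∧ IsInjComplexIn A Q β α ∧
      Nonempty (DerivedCategory.Q.obj Q ≅ X)}.Nonempty)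
  exact ⟨β, α, hβα, K, hK.1, hK.2, e⟩

variable {L : DerivedCategory (ModuleCat.{u} A) ⥤ DerivedCategory (ModuleCat.{u} B)}
  {G : DerivedCategory (ModuleCat.{u} B) ⥤ DerivedCategory (ModuleCat.{u} A)}

lemma exists_uniform_bound
    (hL : ∀ X, IsBoundedComplex A X → IsBoundedComplex B (L.obj X)) :
    ∃ m : ℕ, ∀ N : ModuleCat.{u} A, (L.obj (st N)).IsGE (-m) ∧ (L.obj (st N)).IsLE m := by
  by_contra! h
  choose N hN using h
  obtain ⟨⟨a, ha⟩, b, hb⟩ := isBoundedComplex_iff.1 (hL (st (ModuleCat.of A (∀ k, N k)))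
    (isBoundedComplex_iff.2 ⟨⟨0, st_isGE _⟩, 0, st_isLE _⟩))
  let F := DerivedCategory.singleFunctor (ModuleCat.{u} A) 0 ⋙ L
  obtain ⟨k, hk, hk'⟩ : ∃ k : ℕ, -(k : ℤ) ≤ a ∧ b ≤ k := ⟨max (-a).toNat b.toNat, by lia, by lia⟩
  let i : N k ⟶ ModuleCat.of A (∀ k, N k) := ModuleCat.ofHom (LinearMap.single A (fun k => N k) k)
  let r : ModuleCat.of A (∀ k, N k) ⟶ N k := ModuleCat.ofHom (LinearMap.proj k)
  have hir : F.map i ≫ F.map r = 𝟙 _ := by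
    rw [← F.map_comp, ← F.map_id]
    congr 1
    ext x
    exact Pi.single_eq_same (M := fun k => N k) k x
  exact hN k (isGE_mono (isGE_of_retract ha _ _ hir) hk)
    (isLE_mono (isLE_of_retract hb _ _ hir) hk')

variable [L.CommShift ℤ] (adj : L ⊣ G)
include adj

lemma hom_stShift_eq_zero {N : ModuleCat.{u} A} {I : ModuleCat.{u} B} {n : ℤ}
    (h : ∀ f : (L.obj (st N))⟦-n⟧ ⟶ st I, f = 0) (g : (st N)⟦-n⟧ ⟶ G.obj (st I)) : g = 0 :=
  eq_zero_of_adj adj (fun f => by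
    rw [← cancel_epi ((L.commShiftIso (-n)).inv.app _), comp_zero]
    exact h _) g

lemma hom_stShift_eq_zero' {N : ModuleCat.{u} A} {I : ModuleCat.{u} B} {n : ℤ}
    (h : ∀ g : (st N)⟦n⟧ ⟶ G.obj (st I), g = 0) (f : L.obj (st N) ⟶ (st I)⟦-n⟧) : f = 0 :=
  hom_shift_eq_zero (-n) n (by lia) (fun f => by
    rw [← cancel_epi ((L.commShiftIso n).hom.app _), comp_zero]
    exact eq_zero_of_adj' adj h _) f

lemma isRep_injective_right {I : ModuleCat.{u} B} [Injective I] {m : ℕ}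
    (hm : ∀ N : ModuleCat.{u} A, (L.obj (st N)).IsGE (-m) ∧ (L.obj (st N)).IsLE m) :
    IsRep (fun P => Injective P) (-m) m (G.obj (st I)) := by
  have h₁ (N : ModuleCat.{u} A) (n : ℤ) (hn : m < n) (f : (st N)⟦-n⟧ ⟶ G.obj (st I)) : f = 0 :=
    hom_stShift_eq_zero adj ((isRep_st isAddClass_injective ‹_›).hom_eq_zero (fun _ h => h)
      (isGE_mono (isGE_shift (hm N).1 (-n) (n - m) (by lia)) (by lia))) f
  have h₂ (N : ModuleCat.{u} A) (n : ℤ) (hn : n < -m) (f : (st N)⟦-n⟧ ⟶ G.obj (st I)) : f = 0 :=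
    hom_stShift_eq_zero adj (hom_eq_zero (isLE_shift (hm N).2 (-n) (m + n) (by lia))
      (st_isGE I) (by lia)) f
  exact isRep_injective (isGE_of_free _ fun i hi => h₂ _ i hi)
    (isLE_of_free _ fun i hi => h₁ _ i hi)
    h₁ (by lia)

lemma map_st_isLE {I : ModuleCat.{u} B} (hI : IsCogen I)
    {N : ModuleCat.{u} A} {β : ℤ} (h : (G.obj (st I)).IsGE β) (hN : ∃ b, (L.obj (st N)).IsLE b) :
    (L.obj (st N)).IsLE (-β) :=
  isLE_of_isCogen hI hN fun i hi => hom_stShift_eq_zero' adj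
    (hom_eq_zero (isLE_shift (st_isLE N) i (-i) (by lia)) h (by lia))

lemma map_st_isGE {I : ModuleCat.{u} B} [Injective I] (hI : IsCogen I)
    {N : ModuleCat.{u} A} {β α : ℤ} (h : IsRep (fun P => Injective P) β α (G.obj (st I)))
    (hN : ∃ a, (L.obj (st N)).IsGE a) : (L.obj (st N)).IsGE (-α) :=
  isGE_of_isCogen hI hN fun i hi => hom_stShift_eq_zero' adj
    (h.hom_eq_zero (fun _ h => h)
      (isGE_mono (isGE_shift (st_isGE N) i (-i) (by lia)) (by lia)))

lemma pdLE_of_fullyFaithful_left [L.Full] [L.Faithful]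
    (hL : ∀ X, IsBoundedComplex A X → IsBoundedComplex B (L.obj X))
    {Ψ : DerivedCategory (ModuleCat.{u} B) → Prop} (hΨ : IsFinClass Ψ) {f : ℕ}
    (hf : ∀ M : ModuleCat.{u} B, Ψ (st M) → PdLE (st M) f) {M : ModuleCat.{u} A}
    (hM : Ψ (L.obj (st M))) : PdLE (st M) (f + complexCowidth A (G.obj (dualObj B))) := by
  obtain ⟨m, hm⟩ := exists_uniform_bound hL
  obtain ⟨β, α, hw, h⟩ := exists_complexCowidth
    (isRep_injective_right adj (I := ModuleCat.of B (B →+ AddCircle (1 : ℚ))) hm)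
  have h₁ := hΨ.pdLE_of_isGE hf hM (map_st_isGE adj (isCogen_dual B) h ⟨_, (hm M).1⟩)
  have h₂ := map_st_isLE adj (isCogen_dual B) h.isGE ⟨_, (hm (ModuleCat.of A A)).2⟩
  have h₃ : PdLE (st M) (f + (α - β)) := fun Y hY φ => L.map_injective
    ((h₁ (isLE_mono (isLE_left adj h₂ hY) (by lia)) _).trans
      (h₁ (isLE_mono (isLE_left adj h₂ hY) (by lia)) _).symm)
  exact h₃.mono (by rw [hw]; rfl)

variable [L.IsTriangulated] [L.Full] [L.Faithful]
  (hL : ∀ X, IsBoundedComplex A X → IsBoundedComplex B (L.obj X))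
  {G' : DerivedCategory (ModuleCat.{u} A) ⥤ DerivedCategory (ModuleCat.{u} B)} (adj' : G ⊣ G')
include hL adj'

lemma ringfd_right_le :
    ringfd A ≤ ringfd B + en (complexCowidth A (G.obj (dualObj B))) := by
  rw [ringfd_eq, ringfd_eq]
  exact isFinClass_isCpt.le_finDim_add fun f hf => finDim_le fun M hM =>
    pdLE_of_fullyFaithful_left adj hL isFinClass_isCpt hf (hM.map adj adj')

lemma ringFd_right_le :
    ringFd A ≤ ringFd B + en (complexCowidth A (G.obj (dualObj B))) := by
  rw [ringFd_eq, ringFd_eq]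
  exact isFinClass_isBig.le_finDim_add fun f hf => finDim_le fun M hM =>
    pdLE_of_fullyFaithful_left adj hL isFinClass_isBig hf
      (IsBig.map adj (isCpt_ring.map adj adj').isBig hM)

end BoundedDerivedCategories

/-- Corollary 1.8 = [CX17, Theorem 1.1]: finitistic and big finitistic
dimensions of rings linked by a recollement of unbounded derived categories. -/
theorem stmt8 (R S T : Type u) [Ring R] [Ring S] [Ring T]
    [HasDerivedCategory.{w} (ModuleCat.{u} R)]
    [HasDerivedCategory.{w} (ModuleCat.{u} S)]
    [HasDerivedCategory.{w} (ModuleCat.{u} T)]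
    (iStar : DerivedCategory (ModuleCat.{u} S) ⥤ DerivedCategory (ModuleCat.{u} R)) (iLower : DerivedCategory (ModuleCat.{u} R) ⥤ DerivedCategory (ModuleCat.{u} S)) (iShriek : DerivedCategory (ModuleCat.{u} S) ⥤ DerivedCategory (ModuleCat.{u} R))
    (jLower : DerivedCategory (ModuleCat.{u} T) ⥤ DerivedCategory (ModuleCat.{u} S)) (jStar : DerivedCategory (ModuleCat.{u} S) ⥤ DerivedCategory (ModuleCat.{u} T)) (jUpper : DerivedCategory (ModuleCat.{u} T) ⥤ DerivedCategory (ModuleCat.{u} S))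
    [iStar.CommShift ℤ] [iStar.IsTriangulated]
    [iLower.CommShift ℤ] [iLower.IsTriangulated]
    [iShriek.CommShift ℤ] [iShriek.IsTriangulated]
    [jLower.CommShift ℤ] [jLower.IsTriangulated]
    [jStar.CommShift ℤ] [jStar.IsTriangulated]
    [jUpper.CommShift ℤ] [jUpper.IsTriangulated]
    (adjI₁ : iStar ⊣ iLower) (adjI₂ : iLower ⊣ iShriek)
    (adjJ₁ : jLower ⊣ jStar) (adjJ₂ : jStar ⊣ jUpper)
    [iLower.Full] [iLower.Faithful] [jLower.Full] [jLower.Faithful]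
    [jUpper.Full] [jUpper.Faithful]
    (hJI : ∀ X : DerivedCategory (ModuleCat.{u} R), IsZero (jStar.obj (iLower.obj X)))
    (hglue₁ : ∀ Y : DerivedCategory (ModuleCat.{u} S), ∃ h : jUpper.obj (jStar.obj Y) ⟶ (iLower.obj (iShriek.obj Y))⟦(1 : ℤ)⟧,
      Triangle.mk (adjI₂.counit.app Y) (adjJ₂.unit.app Y) h ∈ distTriang (DerivedCategory (ModuleCat.{u} S)))
    (hglue₂ : ∀ Y : DerivedCategory (ModuleCat.{u} S), ∃ h : iLower.obj (iStar.obj Y) ⟶ (jLower.obj (jStar.obj Y))⟦(1 : ℤ)⟧,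
      Triangle.mk (adjJ₁.counit.app Y) (adjI₁.unit.app Y) h ∈ distTriang (DerivedCategory (ModuleCat.{u} S))) :
    ((∃ (a b : ℤ) (Q' : CochainComplex (ModuleCat.{u} S) ℤ),
        IsFgProjComplexIn S Q' a b ∧
        Nonempty (iLower.obj (ringObj R) ≅ DerivedCategory.Q.obj Q')) →
      (ringfd R ≤ ringfd S + en (complexWidthFg R (iStar.obj (ringObj S))) ∧
        ringfd S ≤ ringfd R + ringfd T + en (complexWidthFg S (iLower.obj (ringObj R)))
          + en (complexWidthFg S (jLower.obj (ringObj T))) + 1)) ∧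
    ((∃ (a b : ℤ) (Q' : CochainComplex (ModuleCat.{u} S) ℤ),
        IsProjComplexIn S Q' a b ∧
        Nonempty (iLower.obj (ringObj R) ≅ DerivedCategory.Q.obj Q')) →
      (ringFd R ≤ ringFd S + en (complexWidth R (iStar.obj (ringObj S))) ∧
        ringFd S ≤ ringFd R + ringFd T + en (complexWidth S (iLower.obj (ringObj R)))
          + en (complexWidth S (jLower.obj (ringObj T))) + 1)) ∧
    ((∀ X : DerivedCategory (ModuleCat.{u} T), IsBoundedComplex T X → IsBoundedComplex S (jLower.obj X)) →
      (ringfd T ≤ ringfd S + en (complexCowidth T (jStar.obj (dualObj S))) ∧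
        ringFd T ≤ ringFd S + en (complexCowidth T (jStar.obj (dualObj S))))) := by
  refine ⟨fun ⟨a, b, Q', hQ, ⟨e⟩⟩ => ?_, fun ⟨a, b, Q', hQ, ⟨e⟩⟩ => ?_,
    fun hL => ⟨ringfd_right_le adjJ₁ hL adjJ₂, ringFd_right_le adjJ₁ hL adjJ₂⟩⟩
  · have h : IsRep IsFgProj a b (iLower.obj (ringObj R)) := ⟨Q', hQ.1, hQ.2, ⟨e.symm⟩⟩
    exact ⟨ringfd_left_le adjI₁ adjI₂ h.isCpt,
      ringfd_middle_le adjI₁ adjI₂ adjJ₁ adjJ₂ hglue₂ h.isCpt⟩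
  · have h : IsRep (fun P => Projective P) a b (iLower.obj (ringObj R)) :=
      ⟨Q', hQ.1, hQ.2, ⟨e.symm⟩⟩
    exact ⟨ringFd_left_le adjI₁ adjI₂ h.isBig,
      ringFd_middle_le adjI₁ adjI₂ adjJ₁ adjJ₂ hglue₂ h⟩


end TriFD
end

section
/- Let U and V be triangulated categories with objects G_U ∈ U and G_V ∈ V, and let F : U → V be a triangle functor with a right adjoint H : V → U such that F(G_U) ∈ ⟨G_V⟩. If fd(U, G_U) = r < +∞, then for every X ∈ G_V(-∞,-1]^⊥ one has F(H(X)) ∈ ⟨G_V⟩^{[0,+∞)}[r + w_{G_V}(F(G_U))]. In particular, if H is fully faithful, then fd(V, G_V) ≤ fd(U, G_U) + w_{G_V}(F(G_U)). -/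
/-! Core definitions for homological dimensions in triangulated categories,
following Chen–Chen–Zhang, "Finiteness of homological dimensions in
triangulated categories". -/

open CategoryTheory CategoryTheory.Limits CategoryTheory.Pretriangulated

universe v u

namespace TriFD

variable {C : Type u} [Category.{v} C] [HasZeroObject C] [HasShift C ℤ]
  [Preadditive C] [∀ n : ℤ, (shiftFunctor C n).Additive] [Pretriangulated C]

/-- `Hom(A, B) = 0`. -/
def homZero (A B : C) : Prop := ∀ f : A ⟶ B, f = 0

/-- `smd 𝒜`: the closure of `𝒜` under direct summands (retracts). -/
def smdSet (A : Set C) : Set C :=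
  {X | ∃ Y ∈ A, ∃ (s : X ⟶ Y) (r : Y ⟶ X), s ≫ r = 𝟙 X}

/-- `𝒜 ∗ ℬ`: the full subcategory of objects `Z` sitting in a distinguished triangle
`X → Z → Y → X⟦1⟧` with `X ∈ 𝒜`, `Y ∈ ℬ`. -/
def extSet (A B : Set C) : Set C :=
  {Z | ∃ (X : C) (_ : X ∈ A) (Y : C) (_ : Y ∈ B) (f : X ⟶ Z) (g : Z ⟶ Y) (h : Y ⟶ X⟦(1 : ℤ)⟧),
    Triangle.mk f g h ∈ distTriang C}

/-- The closure `add 𝒜` of `𝒜` under finite direct sums (a direct sum being witnessed by a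
split distinguished triangle). -/
inductive addP (A : Set C) : C → Prop
  | of {X : C} : X ∈ A → addP A X
  | zero {X : C} : IsZero X → addP A X
  | sum {X Z Y : C} (f : X ⟶ Z) (g : Z ⟶ Y) :
      addP A X → addP A Y → (Triangle.mk f g (0 : Y ⟶ X⟦(1 : ℤ)⟧) ∈ distTriang C) → addP A Z

/-- `add 𝒜` as a set. -/
def addSet (A : Set C) : Set C := setOf (addP A)

/-- `coprodIter 𝒜 n = coprod_{n+1}(𝒜)`, i.e. `coprod_1 = add 𝒜` and
`coprod_{n+1} = add 𝒜 ∗ coprod_n`. -/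
def coprodIter (A : Set C) : ℕ → Set C
  | 0 => addSet A
  | n + 1 => extSet (addSet A) (coprodIter A n)

/-- `Add 𝒜`: the closure of `𝒜` under arbitrary (small) coproducts. -/
def AddSet (A : Set C) : Set C :=
  {X | ∃ (ι : Type v) (f : ι → C) (_ : ∀ i, f i ∈ A) (c : Cofan f),
      Nonempty (IsColimit c) ∧ X = c.pt}

/-- `CoprodIter 𝒜 n = Coprod_{n+1}(𝒜)`, i.e. `Coprod_1 = Add 𝒜` and
`Coprod_{n+1} = Add 𝒜 ∗ Coprod_n`. -/
def CoprodIter (A : Set C) : ℕ → Set C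
  | 0 => AddSet A
  | n + 1 => extSet (AddSet A) (CoprodIter A n)

/-- `Coprod(𝒜)`: the smallest full subcategory of `C` containing `𝒜` and closed under
(small) coproducts and extensions. -/
inductive CoprodP (A : Set C) : C → Prop
  | of {X : C} : X ∈ A → CoprodP A X
  | zero {X : C} : IsZero X → CoprodP A X
  | coprod {ι : Type v} (f : ι → C) (c : Cofan f) :
      (∀ i, CoprodP A (f i)) → Nonempty (IsColimit c) → CoprodP A c.pt
  | ext {X Z Y : C} (f : X ⟶ Z) (g : Z ⟶ Y) (h : Y ⟶ X⟦(1 : ℤ)⟧) :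
      CoprodP A X → CoprodP A Y → (Triangle.mk f g h ∈ distTriang C) → CoprodP A Z

/-- `Coprod(𝒜)` as a set. -/
def CoprodSet (A : Set C) : Set C := setOf (CoprodP A)

/-- `G[p] = { G[-i] ∣ i ∈ ℤ, p i }`; e.g. `G[A,B]` corresponds to `p i = (A ≤ i ∧ i ≤ B)`. -/
def shiftsOf (G : C) (p : ℤ → Prop) : Set C := {X | ∃ i : ℤ, p i ∧ X = G⟦(-i : ℤ)⟧}

/-- `⟨G⟩^{p}_{n+1} = smd (coprod_{n+1} (G[p]))`. -/
def sClGr (G : C) (p : ℤ → Prop) (n : ℕ) : Set C := smdSet (coprodIter (shiftsOf G p) n)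

/-- `⟨G⟩^{p} = ⋃ₙ ⟨G⟩^{p}_n`; for `p = ⊤` this is `⟨G⟩`, the smallest full triangulated
subcategory of `C` containing `G` and closed under direct summands. -/
def sCl (G : C) (p : ℤ → Prop) : Set C := ⋃ n : ℕ, sClGr G p n

/-- `⟨G⟩bar^{p}_{n+1} = smd (Coprod_{n+1} (G[p]))`. -/
def bClGr (G : C) (p : ℤ → Prop) (n : ℕ) : Set C := smdSet (CoprodIter (shiftsOf G p) n)

/-- `⟨G⟩bar^{p} = smd (Coprod (G[p]))`. -/
def bCl (G : C) (p : ℤ → Prop) : Set C := smdSet (CoprodSet (shiftsOf G p))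

/-- The shift `𝒜[n]` of a subcategory (up to isomorphism). -/
def shiftSet (A : Set C) (n : ℤ) : Set C := {X | ∃ Y ∈ A, Nonempty (X ≅ Y⟦n⟧)}

/-- The finitistic dimension of the full (triangulated) subcategory of objects satisfying `P`
at an object `G`:
`fd = inf { n ∈ ℕ ∣ G(-∞,-1]^⊥ ⊆ ⟨G⟩^{[0,+∞)}[n] }` (computed among objects of `P`). -/
noncomputable def fdRel (P : Set C) (G : C) : EReal :=
  sInf {x : EReal | ∃ n : ℕ, x = en n ∧
    ∀ X ∈ P, (∀ m : ℤ, 1 ≤ m → homZero (G⟦m⟧) X) →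
      X ∈ shiftSet (sCl G (fun i => 0 ≤ i)) (n : ℤ)}

/-- The finitistic dimension `fd(C, G)` of `C` at `G`. -/
noncomputable def fd (G : C) : EReal := fdRel Set.univ G

/-- The width `w_G(P) = min { β - α ∣ P ∈ ⟨G⟩^{[α,β]} }` (junk value `0` when no such
interval exists). -/
noncomputable def width (G P : C) : ℕ :=
  sInf {d : ℕ | ∃ a b : ℤ, b - a = (d : ℤ) ∧ P ∈ sCl G (fun i => a ≤ i ∧ i ≤ b)}

/-- The big width `wbar_G(P) = min { β - α ∣ P ∈ ⟨G⟩bar^{[α,β]} }`. -/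
noncomputable def bwidth (G P : C) : ℕ :=
  sInf {d : ℕ | ∃ a b : ℤ, b - a = (d : ℤ) ∧ P ∈ bCl G (fun i => a ≤ i ∧ i ≤ b)}

/-- The lower self-orthogonal index `o⁻(G) = inf { b ≥ 0 ∣ Hom(G[i], G) = 0 for all i > b }`. -/
noncomputable def oMinus (G : C) : EReal :=
  sInf {x : EReal | ∃ b : ℕ, x = en b ∧ ∀ i : ℤ, (b : ℤ) < i → homZero (G⟦i⟧) G}

/-- The upper self-orthogonal index `o⁺(G) = inf { c ≥ 0 ∣ Hom(G, G[i]) = 0 for all i > c }`. -/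
noncomputable def oPlus (G : C) : EReal :=
  sInf {x : EReal | ∃ c : ℕ, x = en c ∧ ∀ i : ℤ, (c : ℤ) < i → homZero G (G⟦i⟧)}

/-- The aisle `C_G^{≤ n} = Coprod (G(-∞, n])` of the `t`-structure generated by the
compact object `G` (the description for general `n` agreeing, up to the canonical
identifications, with `C_G^{≤0}[-n]`). -/
def tLE (G : C) (n : ℤ) : Set C := CoprodSet (shiftsOf G (fun i => i ≤ n))

/-- The coaisle `C_G^{≥ n}` of the `t`-structure generated by the compact object `G`:
`C_G^{≥ 1} = (G(-∞,0])^⊥ = { X ∣ Hom(G⟦i⟧, X) = 0 for all i ≥ 0 }`, and in general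
`C_G^{≥ n} = { X ∣ Hom(G⟦i⟧, X) = 0 for all i ≥ 1 - n }`. -/
def tGE (G : C) (n : ℤ) : Set C := {X | ∀ i : ℤ, 1 - n ≤ i → homZero (G⟦i⟧) X}

/-- Bounded above objects `C^- = ⋃ₘ C^{≤ m}`. -/
def tMinus (G : C) : Set C := ⋃ m : ℕ, tLE G (m : ℤ)

/-- Bounded below objects `C^+ = ⋃ₘ C^{≥ -m}`. -/
def tPlus (G : C) : Set C := ⋃ m : ℕ, tGE G (-(m : ℤ))

/-- Bounded objects `C^b = C^- ∩ C^+`. -/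
def tB (G : C) : Set C := tMinus G ∩ tPlus G

/-- An object `X` is compact if `Hom(X, -)` commutes with (small) coproducts. -/
def IsCompactObj (X : C) : Prop :=
  ∀ ι : Type v, Nonempty (PreservesColimitsOfShape (Discrete ι) (coyoneda.obj (Opposite.op X)))

/-- `G` is a compact generator of `C` if `G` is compact and `C = ⟨G⟩bar^{(-∞,+∞)}`. -/
def IsCompactGenerator (G : C) : Prop :=
  IsCompactObj G ∧ ∀ X : C, X ∈ bCl G (fun _ => True)

/-- The projective dimension of `X` with respect to `G`:
`pd_G(X) = inf { n ∈ ℤ ∣ Hom(X, Y[i]) = 0 for all i > n and Y ∈ C^b ∩ C^{≤ 0} }`. -/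
noncomputable def pd (G X : C) : EReal :=
  sInf {x : EReal | ∃ n : ℤ, x = ec n ∧
    ∀ Y : C, Y ∈ tB G → Y ∈ tLE G 0 → ∀ i : ℤ, n < i → homZero X (Y⟦i⟧)}

/-- The finitistic dimension
`fpd(C, G) = sup { pd_G(X) ∣ X ∈ C^c ∩ C^b ∩ C^{≥ 0}, pd_G(X) < +∞ }`. -/
noncomputable def fpd (G : C) : EReal :=
  sSup {x : EReal | ∃ X : C,
    IsCompactObj X ∧ X ∈ tB G ∧ X ∈ tGE G 0 ∧ pd G X < ⊤ ∧ x = pd G X}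

/-- The big finitistic dimension
`Fpd(C, G) = sup { pd_G(X) ∣ X ∈ C^b ∩ C^{≥ 0}, pd_G(X) < +∞ }`. -/
noncomputable def Fpd (G : C) : EReal :=
  sSup {x : EReal | ∃ X : C, X ∈ tB G ∧ X ∈ tGE G 0 ∧ pd G X < ⊤ ∧ x = pd G X}

/-- The global dimension `gpd(C, G) = sup { pd_G(X) ∣ X ∈ C^b ∩ C^{≥ 0} }`. -/
noncomputable def gpd (G : C) : EReal :=
  sSup {x : EReal | ∃ X : C, X ∈ tB G ∧ X ∈ tGE G 0 ∧ x = pd G X}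

/-- The approximable index `b(M)` of `M ∈ C^{≤0}`: the least `n ≥ 0` such that there is a
distinguished triangle `E → M → D → E⟦1⟧` with `E ∈ ⟨G⟩bar^{[-n,n]}` and `D ∈ C^{≤ -1}`. -/
noncomputable def bIdx (G M : C) : EReal :=
  sInf {x : EReal | ∃ n : ℕ, x = en n ∧
    ∃ (E D : C) (_ : E ∈ bCl G (fun i => -(n : ℤ) ≤ i ∧ i ≤ (n : ℤ))) (_ : D ∈ tLE G (-1))
      (f : E ⟶ M) (g : M ⟶ D) (h : D ⟶ E⟦(1 : ℤ)⟧), Triangle.mk f g h ∈ distTriang C}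

/-- The `G`-approximable index `a(G) = sup { b(M) ∣ M ∈ C^{≤ 0} }`. -/
noncomputable def aIdx (G : C) : EReal :=
  sSup {x : EReal | ∃ M ∈ tLE G 0, x = bIdx G M}

/-- `C` is weakly approximable, as witnessed by the compact generator `G` (and the
`t`-structure generated by `G`, which lies in the preferred equivalence class). -/
def IsWeaklyApproximable (G : C) : Prop :=
  IsCompactGenerator G ∧ ∃ A : ℕ, 0 < A ∧
    G⟦(A : ℤ)⟧ ∈ tLE G 0 ∧
    (∀ Y ∈ tLE G 0, homZero (G⟦-(A : ℤ)⟧) Y) ∧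
    ∀ F ∈ tLE G 0, ∃ (E D : C) (_ : E ∈ bCl G (fun i => -(A : ℤ) ≤ i ∧ i ≤ (A : ℤ)))
      (_ : D ∈ tLE G (-1)) (f : E ⟶ F) (g : F ⟶ D) (h : D ⟶ E⟦(1 : ℤ)⟧),
        Triangle.mk f g h ∈ distTriang C

/-- `C` is approximable, as witnessed by the compact generator `G`. -/
def IsApproximable (G : C) : Prop :=
  IsCompactGenerator G ∧ ∃ A : ℕ, 0 < A ∧
    G⟦(A : ℤ)⟧ ∈ tLE G 0 ∧
    (∀ Y ∈ tLE G 0, homZero (G⟦-(A : ℤ)⟧) Y) ∧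
    ∀ F ∈ tLE G 0, ∃ (E D : C) (_ : E ∈ bClGr G (fun i => -(A : ℤ) ≤ i ∧ i ≤ (A : ℤ)) (A - 1))
      (_ : D ∈ tLE G (-1)) (f : E ⟶ F) (g : F ⟶ D) (h : D ⟶ E⟦(1 : ℤ)⟧),
        Triangle.mk f g h ∈ distTriang C

/-- Strongly bounded objects: `C^sb = ⋃_{i ≥ 0} ⟨G⟩bar^{[-i,i]}`. -/
def sSB (G : C) : Set C := ⋃ i : ℕ, bCl G (fun k => -(i : ℤ) ≤ k ∧ k ≤ (i : ℤ))

/-- A pair of full subcategories `(L, R)` is a `t`-structure. -/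
def IsTStructurePair (L Rt : Set C) : Prop :=
  (∀ X ∈ L, X⟦(1 : ℤ)⟧ ∈ L) ∧ (∀ X ∈ Rt, X⟦(-1 : ℤ)⟧ ∈ Rt) ∧
  (∀ X ∈ L, ∀ Y ∈ Rt, homZero X Y) ∧
  ∀ X : C, ∃ (A B : C) (_ : A ∈ L) (_ : B ∈ Rt) (f : A ⟶ X) (g : X ⟶ B) (h : B ⟶ A⟦(1 : ℤ)⟧),
    Triangle.mk f g h ∈ distTriang C

/-- `M` is a silting object: `(M[1,+∞)^⊥, M(-∞,0]^⊥)` is a `t`-structure. -/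
def IsSilting (M : C) : Prop :=
  IsTStructurePair {X | ∀ i : ℤ, 1 ≤ i → homZero (M⟦(-i : ℤ)⟧) X}
    {X | ∀ i : ℤ, i ≤ 0 → homZero (M⟦(-i : ℤ)⟧) X}

/-- `M` is a tilting object: `M` is silting and `Hom(M', M[i]) = 0` for every `i ≠ 0` and
every direct summand `M'` of a coproduct of copies of `M`. -/
def IsTilting (M : C) : Prop :=
  IsSilting M ∧ ∀ i : ℤ, i ≠ 0 → ∀ M' ∈ smdSet (AddSet {M}), homZero M' (M⟦i⟧)

/-- `Killed 𝒜 f` means that `f : X ⟶ T` becomes zero after composing with finitely many morphisms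
`T ⟶ T₁ ⟶ ⋯ ⟶ Tₙ`, each of which has its fibre in `𝒜`. -/
inductive Killed (A : Set C) {X : C} : ∀ {T : C}, (X ⟶ T) → Prop
  | zero {T : C} : Killed A (0 : X ⟶ T)
  | step {P T T₁ : C} (i : P ⟶ T) (q : T ⟶ T₁) (h : T₁ ⟶ P⟦(1 : ℤ)⟧) (f : X ⟶ T) :
      P ∈ A → (Triangle.mk i q h ∈ distTriang C) → Killed A (f ≫ q) → Killed A f

lemma Killed.precomp {A : Set C} {X Y T : C} {f : X ⟶ T} (hf : Killed A f) (g : Y ⟶ X) :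
    Killed A (g ≫ f) := by
  induction hf with
  | zero => rw [comp_zero]; exact .zero
  | step i q h f hP hT _ ih => exact .step i q h _ hP hT (by rwa [Category.assoc])

lemma Killed.of_triangle {A : Set C} {X Z Y : C} {i : X ⟶ Z} {p : Z ⟶ Y} {h : Y ⟶ X⟦(1 : ℤ)⟧}
    (hT : Triangle.mk i p h ∈ distTriang C) (hY : ∀ {T : C} (f : Y ⟶ T), Killed A f)
    {T : C} {k : X ⟶ T} (hk : Killed A k) (f : Z ⟶ T) (hf : i ≫ f = k) : Killed A f := by
  induction hk with
  | zero =>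
    obtain ⟨g, hg⟩ := Triangle.yoneda_exact₂ _ hT f hf
    rw [hg]
    exact (hY g).precomp p
  | step i' q h' k hP hT' _ ih =>
    exact .step i' q h' f hP hT' (ih (f ≫ q) (by rw [← hf, Category.assoc]))

/-- A killed morphism factors through an iterated extension. The octahedral axiom is not needed. -/
lemma Killed.exists_factorization {A : Set C} {X T : C} {f : X ⟶ T} (hf : Killed A f) :
    ∃ (n : ℕ) (E : C) (_ : E ∈ coprodIter A n) (s : X ⟶ E) (e : E ⟶ T), s ≫ e = f := by
  induction hf with
  | zero => exact ⟨0, _, addP.zero (isZero_zero C), 0, 0, by simp⟩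
  | @step P T T₁ i q h f hP hT _ ih =>
    obtain ⟨n, E₁, hE₁, s₁, e₁, he₁⟩ := ih
    obtain ⟨E, j, g, hE⟩ := distinguished_cocone_triangle₂ (e₁ ≫ h)
    obtain ⟨e, he, he'⟩ := complete_distinguished_triangle_morphism₂ _ _ hE hT (𝟙 P) e₁ (by
        change (e₁ ≫ h) ≫ (𝟙 P)⟦(1 : ℤ)⟧' = e₁ ≫ h
        rw [CategoryTheory.Functor.map_id, Category.comp_id])
    have hqh : q ≫ h = 0 := comp_distTriang_mor_zero₂₃ _ hT
    obtain ⟨s, hs⟩ := Triangle.coyoneda_exact₃ _ hE s₁ (by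
      change s₁ ≫ e₁ ≫ h = 0
      rw [← Category.assoc, he₁, Category.assoc, hqh, comp_zero])
    change E ⟶ T at e
    change X ⟶ E at s
    change j ≫ e = 𝟙 P ≫ i at he
    change g ≫ e₁ = e ≫ q at he'
    change s₁ = s ≫ g at hs
    obtain ⟨k, hk⟩ := Triangle.coyoneda_exact₂ _ hT (f - s ≫ e : X ⟶ T) (by
      change (f - s ≫ e) ≫ q = 0
      rw [Preadditive.sub_comp, Category.assoc, ← he', ← he₁, hs, Category.assoc, sub_self])
    change X ⟶ P at k
    change f - s ≫ e = k ≫ i at hk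
    refine ⟨n + 1, E, ⟨P, addP.of hP, E₁, hE₁, j, g, _, hE⟩, s + k ≫ j, e, ?_⟩
    rw [Preadditive.add_comp, Category.assoc, he, Category.id_comp, ← hk, add_sub_cancel]

/-- Induction principle for `⟨G⟩^{p}`. -/
lemma sCl_induction {G : C} {p : ℤ → Prop} (Q : C → Prop)
    (gen : ∀ i, p i → Q (G⟦-i⟧)) (zero : ∀ {X : C}, IsZero X → Q X)
    (ext : ∀ {X Z Y : C} (f : X ⟶ Z) (g : Z ⟶ Y) (h : Y ⟶ X⟦(1 : ℤ)⟧),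
      Triangle.mk f g h ∈ distTriang C → Q X → Q Y → Q Z)
    (retract : ∀ {X Y : C} (s : X ⟶ Y) (r : Y ⟶ X), s ≫ r = 𝟙 X → Q Y → Q X)
    {X : C} (hX : X ∈ sCl G p) : Q X := by
  obtain ⟨n, Y, hY, s, r, hsr⟩ := Set.mem_iUnion.1 hX
  have hadd : ∀ {Z : C}, Z ∈ addSet (shiftsOf G p) → Q Z := by
    intro Z hZ
    induction hZ with
    | of h => obtain ⟨i, hi, rfl⟩ := h; exact gen i hi
    | zero h => exact zero h
    | sum f g _ _ hT hX hY => exact ext f g _ hT hX hY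
  refine retract s r hsr ?_
  clear hsr hX
  induction n generalizing Y with
  | zero => exact hadd hY
  | succ n ih =>
    obtain ⟨A, hA, B, hB, f, g, h, hT⟩ := hY
    exact ext f g h hT (hadd hA) (ih B hB (s ≫ g) (0 : B ⟶ X))

lemma mem_sCl_iff_killed {G : C} {p : ℤ → Prop} {X : C} :
    X ∈ sCl G p ↔ ∀ {T : C} (f : X ⟶ T), Killed (shiftsOf G p) f := by
  constructor
  · intro hX
    refine sCl_induction (fun X => ∀ {T : C} (f : X ⟶ T), Killed (shiftsOf G p) f)
      ?_ ?_ ?_ ?_ hX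
    · intro i hi T f
      obtain ⟨Z, g, h, hT⟩ := distinguished_cocone_triangle f
      refine .step f g h f ⟨i, hi, rfl⟩ hT ?_
      have : f ≫ g = 0 := comp_distTriang_mor_zero₁₂ _ hT
      rw [this]
      exact .zero
    · intro X hX T f
      rw [hX.eq_of_src f 0]
      exact .zero
    · intro X Z Y f g h hT hX hY T k
      exact .of_triangle hT hY (hX (f ≫ k)) k rfl
    · intro X Y s r hsr hY T f
      have := (hY (r ≫ f)).precomp s
      rwa [← Category.assoc, hsr, Category.id_comp] at this
  · intro hX
    obtain ⟨n, E, hE, s, e, hse⟩ := (hX (𝟙 X)).exists_factorization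
    exact Set.mem_iUnion.2 ⟨n, E, hE, s, e, hse⟩

lemma sCl_of_isZero (G : C) (p : ℤ → Prop) {X : C} (hX : IsZero X) : X ∈ sCl G p :=
  mem_sCl_iff_killed.2 fun f => by rw [hX.eq_of_src f 0]; exact .zero

lemma sCl_ext {G : C} {p : ℤ → Prop} {X Z Y : C} (f : X ⟶ Z) (g : Z ⟶ Y) (h : Y ⟶ X⟦(1 : ℤ)⟧)
    (hT : Triangle.mk f g h ∈ distTriang C) (hX : X ∈ sCl G p) (hY : Y ∈ sCl G p) :
    Z ∈ sCl G p := by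
  rw [mem_sCl_iff_killed] at *
  exact fun k => .of_triangle hT hY (hX (f ≫ k)) k rfl

lemma sCl_retract {G : C} {p : ℤ → Prop} {X Y : C} (s : X ⟶ Y) (r : Y ⟶ X) (hsr : s ≫ r = 𝟙 X)
    (hY : Y ∈ sCl G p) : X ∈ sCl G p := by
  obtain ⟨n, E, hE, s', r', h'⟩ := Set.mem_iUnion.1 hY
  refine Set.mem_iUnion.2 ⟨n, E, hE, s ≫ s', r' ≫ r, ?_⟩
  rw [Category.assoc, ← Category.assoc s', h', Category.id_comp, hsr]

lemma sCl_of_iso {G : C} {p : ℤ → Prop} {X Y : C} (e : X ≅ Y) (hY : Y ∈ sCl G p) :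
    X ∈ sCl G p :=
  sCl_retract e.hom e.inv e.hom_inv_id hY

lemma sCl_gen {G : C} {p : ℤ → Prop} (i : ℤ) (hi : p i) : G⟦-i⟧ ∈ sCl G p :=
  Set.mem_iUnion.2 ⟨0, _, addP.of ⟨i, hi, rfl⟩, 𝟙 _, 𝟙 _, Category.comp_id _⟩

lemma sCl_mono {G : C} {p q : ℤ → Prop} (h : ∀ i, p i → q i) {X : C} (hX : X ∈ sCl G p) :
    X ∈ sCl G q :=
  sCl_induction (· ∈ sCl G q) (fun i hi => sCl_gen i (h i hi)) (sCl_of_isZero G q)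
    sCl_ext sCl_retract hX

lemma sCl_shift {G : C} {p q : ℤ → Prop} (n : ℤ) (h : ∀ i, p i → q (i - n)) {X : C}
    (hX : X ∈ sCl G p) : X⟦n⟧ ∈ sCl G q := by
  refine sCl_induction (fun X => X⟦n⟧ ∈ sCl G q) ?_ ?_ ?_ ?_ hX
  · intro i hi
    exact sCl_of_iso ((shiftFunctorAdd' C (-i) n (-(i - n)) (by lia)).symm.app G)
      (sCl_gen _ (h i hi))
  · intro X hX
    exact sCl_of_isZero G q ((shiftFunctor C n).map_isZero hX)
  · intro X Z Y f g k hT hX hY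
    exact sCl_ext _ _ _ (Triangle.shift_distinguished _ hT n) hX hY
  · intro X Y s r hsr hY
    exact sCl_retract (s⟦n⟧') (r⟦n⟧') (by rw [← Functor.map_comp, hsr, CategoryTheory.Functor.map_id]) hY

lemma exists_bounded_of_mem_sCl {G X : C} (hX : X ∈ sCl G (fun _ => True)) :
    ∃ a b : ℤ, a ≤ b ∧ X ∈ sCl G (fun i => a ≤ i ∧ i ≤ b) := by
  refine sCl_induction (fun X => ∃ a b : ℤ, a ≤ b ∧ X ∈ sCl G (fun i => a ≤ i ∧ i ≤ b))
    ?_ ?_ ?_ ?_ hX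
  · exact fun i _ => ⟨i, i, le_rfl, sCl_gen i ⟨le_rfl, le_rfl⟩⟩
  · exact fun hX => ⟨0, 0, le_rfl, sCl_of_isZero G _ hX⟩
  · rintro X Z Y f g h hT ⟨a, b, hab, hX⟩ ⟨a', b', hab', hY⟩
    refine ⟨min a a', max b b', by lia, sCl_ext f g h hT (sCl_mono ?_ hX) (sCl_mono ?_ hY)⟩
    · intro i hi; lia
    · intro i hi; lia
  · rintro X Y s r hsr ⟨a, b, hab, hY⟩
    exact ⟨a, b, hab, sCl_retract s r hsr hY⟩

/-- The width is attained by some interval. -/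
lemma exists_width_eq {G X : C} (hX : X ∈ sCl G (fun _ => True)) :
    ∃ a b : ℤ, b - a = (width G X : ℤ) ∧ X ∈ sCl G (fun i => a ≤ i ∧ i ≤ b) := by
  obtain ⟨a, b, hab, hX⟩ := exists_bounded_of_mem_sCl hX
  exact Nat.sInf_mem (s := {d : ℕ | ∃ a b : ℤ, b - a = (d : ℤ) ∧
    X ∈ sCl G (fun i => a ≤ i ∧ i ≤ b)}) ⟨(b - a).toNat, a, b, by lia, hX⟩

lemma homZero_of_iso {D : Type u} [Category.{v} D] [Preadditive D] {X X' Y Y' : D}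
    (e : X ≅ X') (e' : Y ≅ Y') (h : homZero X Y) :
    homZero X' Y' := by
  intro f
  have h0 := h (e.hom ≫ f ≫ e'.inv)
  rw [← cancel_epi e.hom, ← cancel_mono e'.inv, Category.assoc, h0, comp_zero, zero_comp]

lemma homZero_shift {D : Type u} [Category.{v} D] [Preadditive D] [HasShift D ℤ]
    [∀ n : ℤ, (shiftFunctor D n).Additive] {X Y : D} (n : ℤ) (h : homZero X Y) :
    homZero (X⟦n⟧) (Y⟦n⟧) := by
  intro f
  obtain ⟨g, rfl⟩ := (shiftFunctor D n).map_surjective f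
  rw [h g, Functor.map_zero]

lemma homZero_of_mem_sCl {G P X : C} {p : ℤ → Prop} (hP : P ∈ sCl G p)
    (h : ∀ i, p i → homZero (G⟦-i⟧) X) : homZero P X := by
  refine sCl_induction (fun P => homZero P X) h ?_ ?_ ?_ hP
  · exact fun hZ f => hZ.eq_of_src f 0
  · intro A Z B i q h hT hA hB f
    obtain ⟨g, hg⟩ := Triangle.yoneda_exact₂ _ hT f (hA _)
    change B ⟶ X at g
    change f = q ≫ g at hg
    rw [hg, hB g, comp_zero]
  · intro A B s r hsr hB f
    rw [← Category.id_comp f, ← hsr, Category.assoc, hB (r ≫ f), comp_zero]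

/-- If the finitistic dimension is finite, then it is attained. -/
lemma exists_fd_eq {G : C} (h : fd G ≠ ⊤) :
    ∃ n : ℕ, fd G = en n ∧ ∀ X : C, (∀ m : ℤ, 1 ≤ m → homZero (G⟦m⟧) X) →
      X ∈ shiftSet (sCl G (fun i => 0 ≤ i)) (n : ℤ) := by
  classical
  have hne : ∃ n : ℕ, ∀ X : C, (∀ m : ℤ, 1 ≤ m → homZero (G⟦m⟧) X) →
      X ∈ shiftSet (sCl G (fun i => 0 ≤ i)) (n : ℤ) := by
    by_contra hcon
    refine h (sInf_eq_top.2 ?_)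
    rintro _ ⟨n, -, hn⟩
    exact (hcon ⟨n, fun X hX => hn X trivial hX⟩).elim
  refine ⟨Nat.find hne, IsLeast.csInf_eq ⟨⟨_, rfl, fun X _ => Nat.find_spec hne X⟩, ?_⟩,
    Nat.find_spec hne⟩
  rintro _ ⟨n, rfl, hn⟩
  exact EReal.coe_le_coe (Nat.cast_le.2 (Nat.find_min' hne fun X hX => hn X trivial hX))

lemma en_injective : Function.Injective en := fun _ _ h =>
  Nat.cast_injective (EReal.coe_injective h)

section Functor

variable {U : Type u} [Category.{v} U] [HasZeroObject U] [HasShift U ℤ]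
  [Preadditive U] [∀ n : ℤ, (shiftFunctor U n).Additive] [Pretriangulated U]

/-- A triangle functor sending `G` into `⟨G'⟩^{[a,b]}` sends `⟨G⟩^{[0,+∞)}` into
`⟨G'⟩^{[a,+∞)}`. -/
lemma map_mem_sCl (F : U ⥤ C) [F.CommShift ℤ] [F.IsTriangulated] {G : U} {G' : C} {a : ℤ}
    (hG : F.obj G ∈ sCl G' (fun i => a ≤ i)) {X : U} (hX : X ∈ sCl G (fun i => 0 ≤ i)) :
    F.obj X ∈ sCl G' (fun i => a ≤ i) := by
  refine sCl_induction (fun X => F.obj X ∈ sCl G' (fun i => a ≤ i)) ?_ ?_ ?_ ?_ hX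
  · intro i hi
    exact sCl_of_iso ((F.commShiftIso (-i)).app G) (sCl_shift (-i) (by intro j hj; lia) hG)
  · exact fun hX => sCl_of_isZero _ _ (F.map_isZero hX)
  · intro X Z Y f g h hT hX hY
    exact sCl_ext _ _ _ (F.map_distinguished _ hT) hX hY
  · intro X Y s r hsr hY
    exact sCl_retract (F.map s) (F.map r)
      (by rw [← F.map_comp, hsr, CategoryTheory.Functor.map_id]) hY

lemma map_rightAdjoint_mem_shiftSet (F : U ⥤ C) (H : C ⥤ U) [F.CommShift ℤ] [F.IsTriangulated]
    (adj : F ⊣ H) {G : U} {G' : C} (hFG : F.obj G ∈ sCl G' (fun _ => True)) {r : ℕ}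
    (hr : ∀ X : U, (∀ m : ℤ, 1 ≤ m → homZero (G⟦m⟧) X) →
      X ∈ shiftSet (sCl G (fun i => 0 ≤ i)) (r : ℤ))
    {X : C} (hX : ∀ m : ℤ, 1 ≤ m → homZero (G'⟦m⟧) X) :
    F.obj (H.obj X) ∈ shiftSet (sCl G' (fun i => 0 ≤ i))
      ((r : ℤ) + (width G' (F.obj G) : ℤ)) := by
  obtain ⟨a, b, hab, hFab⟩ := exists_width_eq hFG
  set w : ℤ := (width G' (F.obj G) : ℤ)
  have hvan : ∀ m : ℤ, 1 ≤ m → homZero (G⟦m + b⟧) (H.obj X) := by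
    intro m hm f
    have hz : homZero ((F.obj G)⟦m + b⟧) X :=
      homZero_of_mem_sCl (sCl_shift (q := fun i => i ≤ -m) (m + b) (by intro i hi; lia) hFab)
        fun i hi => hX (-i) (by lia)
    have hz' : homZero (F.obj (G⟦m + b⟧)) X :=
      homZero_of_iso ((F.commShiftIso (m + b)).app G).symm (Iso.refl X) hz
    exact (adj.homEquiv _ _).symm.injective ((hz' _).trans (hz' _).symm)
  obtain ⟨Y, hY, ⟨e⟩⟩ := hr ((H.obj X)⟦-b⟧) fun m hm =>
    homZero_of_iso ((shiftFunctorAdd' U (m + b) (-b) m (by lia)).symm.app G) (Iso.refl _)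
      (homZero_shift (-b) (hvan m hm))
  have hFY : F.obj Y ∈ sCl G' (fun i => a ≤ i) :=
    map_mem_sCl F (sCl_mono (fun _ hi => hi.1) hFab) hY
  let e' : F.obj (H.obj X) ≅ (F.obj Y)⟦(r : ℤ)⟧⟦b⟧ :=
    F.mapIso (shiftNegShift (H.obj X) b).symm ≪≫ (F.commShiftIso b).app _ ≪≫
      (shiftFunctor C b).mapIso (F.mapIso e ≪≫ (F.commShiftIso (r : ℤ)).app Y)
  have h₁ : (F.obj Y)⟦(r : ℤ)⟧ ∈ sCl G' (fun i => a - r ≤ i) :=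
    sCl_shift _ (by intro i hi; lia) hFY
  have h₂ : (F.obj Y)⟦(r : ℤ)⟧⟦b⟧ ∈ sCl G' (fun i => -(r + w) ≤ i) :=
    sCl_shift _ (by intro i hi; lia) h₁
  exact ⟨(F.obj (H.obj X))⟦-((r : ℤ) + w)⟧,
    sCl_shift _ (by intro i hi; lia) (sCl_of_iso e' h₂),
    ⟨(shiftNegShift (F.obj (H.obj X)) ((r : ℤ) + w)).symm⟩⟩

end Functor

/-- Lemma 4.1: transfer of finitistic dimension along an adjoint pair of
triangle functors. -/
theorem stmt19
    {U : Type u} [Category.{v} U] [HasZeroObject U] [HasShift U ℤ]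
    [Preadditive U] [∀ n : ℤ, (shiftFunctor U n).Additive] [Pretriangulated U]
    {V : Type u} [Category.{v} V] [HasZeroObject V] [HasShift V ℤ]
    [Preadditive V] [∀ n : ℤ, (shiftFunctor V n).Additive] [Pretriangulated V]
    (F : U ⥤ V) (H : V ⥤ U)
    [F.CommShift ℤ] [F.IsTriangulated]
    (adj : F ⊣ H)
    (G_U : U) (G_V : V)
    (hFG : F.obj G_U ∈ sCl G_V (fun _ => True)) :
    (∀ r : ℕ, fd G_U = en r →
      ∀ X : V, (∀ m : ℤ, 1 ≤ m → homZero (G_V⟦m⟧) X) →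
        F.obj (H.obj X) ∈ shiftSet (sCl G_V (fun i => 0 ≤ i))
          ((r : ℤ) + (width G_V (F.obj G_U) : ℤ))) ∧
    (H.Full → H.Faithful → fd G_V ≤ fd G_U + en (width G_V (F.obj G_U))) := by
  constructor
  · intro r hr X hX
    obtain ⟨n, hn, h⟩ := exists_fd_eq (G := G_U) (hr ▸ EReal.coe_ne_top _)
    obtain rfl := en_injective (hn.symm.trans hr)
    exact map_rightAdjoint_mem_shiftSet F H adj hFG h hX
  · intro _ _
    by_cases htop : fd G_U = ⊤
    · rw [htop, en, EReal.top_add_coe]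
      exact le_top
    · obtain ⟨n, hn, h⟩ := exists_fd_eq htop
      refine sInf_le ⟨n + width G_V (F.obj G_U), ?_, fun X _ hX => ?_⟩
      · rw [hn, en, en, en, Nat.cast_add, EReal.coe_add]
      · obtain ⟨Y, hY, ⟨e⟩⟩ := map_rightAdjoint_mem_shiftSet F H adj hFG h hX
        rw [Nat.cast_add]
        exact ⟨Y, hY, ⟨(asIso (adj.counit.app X)).symm ≪≫ e⟩⟩


end TriFD
end
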